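/- arXiv:1401.7301 — 2 statements merged into one kernel-verified Lean document; each statement's English description precedes it below -/
import Mathlib

section
/- Let M be a loopless matroid of rank r ≥ 2 on E = {1,…,n}, and let B(M) ⊆ ℝ^{n−1} be its Bergman fan. Then the subspace B(M) ∩ S^{n−2}, where S^{n−2} = {x ∈ ℝ^{n−1} : ‖x‖ = 1} is the Euclidean unit sphere, is (r−3)-connected. -/
open Function

noncomputable section

/-- `k`-connectedness of a topological space, for `k : ℤ`: nonempty, path-connected
when `k ≥ 0`, and trivial homotopy groups `π_i` for `1 ≤ i ≤ k`; by convention every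
space is `k`-connected for `k ≤ -2`. -/
def KConn (X : Type*) [TopologicalSpace X] (k : ℤ) : Prop :=
  k ≤ -2 ∨ (Nonempty X ∧ (0 ≤ k → PathConnectedSpace X) ∧
    ∀ i : ℕ, 1 ≤ i → (i : ℤ) ≤ k → ∀ x : X, Subsingleton (HomotopyGroup (Fin i) X x))

/-- The rank function of a matroid: the largest cardinality of an independent subset of `X`. -/
def mrk {n : ℕ} (M : Matroid (Fin n)) (X : Set (Fin n)) : ℕ :=
  sSup {k | ∃ I, M.Indep I ∧ I ⊆ X ∧ I.ncard = k}

/-- The set of all nonnegative linear combinations of elements of `s`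
(the positive span, a convex cone; `posSpan ∅ = {0}`). -/
def posSpan {V : Type*} [AddCommMonoid V] [Module ℝ V] (s : Set V) : Set V :=
  {x | ∃ (T : Finset V) (c : V → ℝ), (↑T : Set V) ⊆ s ∧ (∀ v, 0 ≤ c v) ∧
        x = ∑ v ∈ T, c v • v}

/-- The vector `e_S = Σ_{i ∈ S} e_i` associated to a subset `S` of the ground set. -/
def eVec {n : ℕ} {V : Type*} [AddCommMonoid V] (e : Fin n → V) (S : Set (Fin n)) : V :=
  ∑ᶠ i ∈ S, e i

/-- The proper nonempty flats of a matroid on ground set `Fin n` (with `M.E = univ`). -/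
def properFlats {n : ℕ} (M : Matroid (Fin n)) : Set (Set (Fin n)) :=
  {F | M.closure F = F ∧ F.Nonempty ∧ F ≠ Set.univ}

/-- The Bergman fan of `M` with respect to the vectors `e`: the union, over all chains
`C` of proper nonempty flats, of the cones `pos {e_F : F ∈ C}`. -/
def bergmanFan {n : ℕ} {V : Type*} [AddCommMonoid V] [Module ℝ V]
    (M : Matroid (Fin n)) (e : Fin n → V) : Set V :=
  ⋃ C ∈ {C : Set (Set (Fin n)) | C ⊆ properFlats M ∧ IsChain (· ⊆ ·) C},
    posSpan (eVec e '' C)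

namespace BergmanLink

open Set Topology unitInterval Module

/-- The union of the subspaces of `Fin n → ℝ` consisting of the vectors which are constant on
some set of `r` coordinates. -/
def constOnCard (n r : ℕ) : Set (Fin n → ℝ) :=
  {h | ∃ b : Finset (Fin n), r ≤ b.card ∧ ∃ c : ℝ, ∀ i ∈ b, h i = c}

/-- A generic small translate of a `C¹` map from a space of dimension less than `r - 1` avoids the
vectors which are constant on `r` coordinates. -/
theorem exists_small_translate_notMem_constOnCard {n r : ℕ} {E : Type*} [NormedAddCommGroup E]
    [NormedSpace ℝ E] [FiniteDimensional ℝ E] (hE : finrank ℝ E + 1 < r)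
    {g : E → Fin n → ℝ} (hg : ContDiff ℝ 1 g) {ε : ℝ} (hε : 0 < ε) :
    ∃ v : Fin n → ℝ, ‖v‖ < ε ∧ ∀ p, g p + v ∉ constOnCard n r := by
  rcases Nat.eq_zero_or_pos n with rfl | hn
  · refine ⟨0, by rwa [norm_zero], ?_⟩
    rintro p ⟨b, hb, -⟩
    have := b.card_le_univ
    simp only [Fintype.card_fin] at this
    omega
  let Φ (b : Finset (Fin n)) (q : (ℝ × ({i // i ∉ b} → ℝ)) × E) : Fin n → ℝ :=
    fun i => (if h : i ∈ b then q.1.1 else q.1.2 ⟨i, h⟩) - g q.2 i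
  have hΦ (b) : ContDiff ℝ 1 (Φ b) := by
    refine contDiff_pi.2 fun i => ContDiff.sub ?_ ?_
    · by_cases h : i ∈ b
      · simp only [h, dif_pos]; fun_prop
      · simp only [h, dif_neg, not_false_eq_true]; fun_prop
    · exact (contDiff_pi.1 hg i).comp contDiff_snd
  have hdim : dimH (⋃ b ∈ {b : Finset (Fin n) | r ≤ b.card}, range (Φ b))
      < finrank ℝ (Fin n → ℝ) := by
    rw [dimH_bUnion (Set.to_countable _)]
    have hbound : ∀ b ∈ {b : Finset (Fin n) | r ≤ b.card},
        dimH (range (Φ b)) ≤ ((n - 1 : ℕ) : ENNReal) := by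
      intro b hb
      refine (hΦ b).dimH_range_le.trans ?_
      have hbn : b.card ≤ n := by simpa using b.card_le_univ
      have hb' : r ≤ b.card := hb
      have hcard : Fintype.card {i // i ∉ b} = n - b.card := by
        simp [Fintype.card_subtype_compl]
      rw [finrank_prod, finrank_prod, finrank_self, finrank_fintype_fun_eq_card, hcard]
      exact_mod_cast (by omega : 1 + (n - b.card) + finrank ℝ E ≤ n - 1)
    refine (iSup₂_le hbound).trans_lt ?_
    rw [finrank_fintype_fun_eq_card, Fintype.card_fin]
    exact_mod_cast (by omega : n - 1 < n)
  have hdense := dense_compl_of_dimH_lt_finrank hdim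
  obtain ⟨v, hv, hvε⟩ := hdense.exists_mem_open Metric.isOpen_ball
    (⟨0, Metric.mem_ball_self hε⟩ : (Metric.ball (0 : Fin n → ℝ) ε).Nonempty)
  refine ⟨v, by simpa using hvε, fun p hp => hv ?_⟩
  obtain ⟨b, hb, c, hc⟩ := hp
  refine mem_iUnion₂.2 ⟨b, hb, ((c, fun i => g p i + v i), p), ?_⟩
  ext i
  by_cases h : i ∈ b
  · simp only [Φ, h, dif_pos]
    rw [← hc i h]; simp
  · simp [Φ, h]

/-- A map from a space of dimension less than `r - 1` can be pushed off a closed set of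
vectors constant on `r` coordinates, without changing it on a compact set where it already avoids
this closed set. -/
theorem exists_eqOn_forall_notMem_of_subset_constOnCard {n r : ℕ} {E : Type*}
    [NormedAddCommGroup E] [NormedSpace ℝ E] [FiniteDimensional ℝ E]
    (hE : finrank ℝ E + 1 < r) {Z : Set (Fin n → ℝ)} (hZ : IsClosed Z)
    (hZr : Z ⊆ constOnCard n r) {F : E → Fin n → ℝ} (hF : Continuous F)
    {D K : Set E} (hK : IsCompact K) (hD : IsClosed D) (hFD : ∀ p ∈ D, F p ∉ Z) :
    ∃ G : E → Fin n → ℝ, Continuous G ∧ EqOn G F D ∧ ∀ p ∈ K, G p ∉ Z := by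
  obtain ⟨U, hU, hDU, hUZ⟩ := normal_exists_closure_subset hD (hZ.isOpen_compl.preimage hF)
    (fun p hp => hFD p hp)
  obtain ⟨θ, hθ0, hθ1, hθ⟩ := exists_continuous_zero_one_of_isClosed hD hU.isClosed_compl
    (disjoint_compl_right_iff_subset.2 hDU)
  obtain ⟨δ, hδ, hδZ⟩ := ((hK.inter_right (isClosed_closure (s := U))).image
    hF).exists_thickening_subset_open hZ.isOpen_compl (by
      rintro _ ⟨p, hp, rfl⟩
      exact hUZ hp.2)
  obtain ⟨g, hg, hgF, -⟩ := hF.exists_contDiff_approx 1 (ε := fun _ => δ / 2) continuous_const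
    (fun _ => half_pos hδ)
  obtain ⟨v, hv, hgv⟩ := exists_small_translate_notMem_constOnCard hE hg (half_pos hδ)
  refine ⟨fun p => F p + θ p • (g p + v - F p), ?_, ?_, ?_⟩
  · have := hg.continuous
    fun_prop
  · intro p hp
    simp [hθ0 hp]
  · intro p hp
    by_cases hpU : p ∈ U
    · apply hδZ
      refine Metric.mem_thickening_iff.2 ⟨F p, mem_image_of_mem _ ⟨hp, subset_closure hpU⟩, ?_⟩
      have h1 : ‖g p - F p‖ < δ / 2 := by simpa [dist_eq_norm] using hgF p
      have h2 : ‖g p + v - F p‖ < δ := by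
        calc ‖g p + v - F p‖ = ‖(g p - F p) + v‖ := by congr 1; abel
          _ ≤ ‖g p - F p‖ + ‖v‖ := norm_add_le _ _
          _ < δ := by linarith
      rw [dist_eq_norm, add_sub_cancel_left, norm_smul, Real.norm_of_nonneg (hθ p).1]
      exact (mul_le_of_le_one_left (norm_nonneg _) (hθ p).2).trans_lt h2
    · intro hmem
      refine hgv p (hZr ?_)
      simpa [hθ1 hpU] using hmem

section Retract

variable {n r : ℕ} {X : Type*} [TopologicalSpace X] {Z : Set (Fin n → ℝ)}
  {ι : X → Fin n → ℝ} {ρ : ↥Zᶜ → X}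

/-- A map from a low-dimensional space to `Fin n → ℝ` whose restriction to `D` comes from a
retract of the complement of `Z` gives a map of `K` to this retract. -/
theorem exists_continuous_retract_lift (hZ : IsClosed Z) (hZr : Z ⊆ constOnCard n r)
    (hιZ : ∀ x, ι x ∈ Zᶜ) (hρ : Continuous ρ) (hρι : ∀ x, ρ ⟨ι x, hιZ x⟩ = x)
    {E : Type*} [NormedAddCommGroup E] [NormedSpace ℝ E] [FiniteDimensional ℝ E]
    (hE : finrank ℝ E + 1 < r) {F : E → Fin n → ℝ} (hF : Continuous F)
    {D K : Set E} (hK : IsCompact K) (hD : IsClosed D) (hFD : ∀ p ∈ D, ∃ x, F p = ι x) :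
    ∃ G : K → X, Continuous G ∧ ∀ p : K, ∀ x, p.1 ∈ D → F p = ι x → G p = x := by
  obtain ⟨G, hG, hGF, hGZ⟩ := exists_eqOn_forall_notMem_of_subset_constOnCard hE hZ hZr hF hK hD
    (fun p hp => by obtain ⟨x, hx⟩ := hFD p hp; rw [hx]; exact hιZ x)
  refine ⟨fun p => ρ ⟨G p, hGZ p p.2⟩, hρ.comp (by fun_prop), ?_⟩
  intro p x hp hx
  have : G p = ι x := (hGF hp).trans hx
  simp only [this, hρι]

theorem pathConnectedSpace_of_retract (hZ : IsClosed Z) (hZr : Z ⊆ constOnCard n r)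
    (hιZ : ∀ x, ι x ∈ Zᶜ) (hρ : Continuous ρ) (hρι : ∀ x, ρ ⟨ι x, hιZ x⟩ = x)
    (hne : Nonempty X) (hr : 3 ≤ r) : PathConnectedSpace X := by
  refine ⟨hne, fun x y => ?_⟩
  obtain ⟨G, hG, hGD⟩ := exists_continuous_retract_lift hZ hZr hιZ hρ hρι (E := ℝ)
    (by rw [finrank_self]; omega) (F := fun t => (1 - t) • ι x + t • ι y) (by fun_prop)
    (D := {0, 1}) (K := Icc 0 1) isCompact_Icc (Set.toFinite _).isClosed (by
      rintro p (rfl | rfl)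
      · exact ⟨x, by simp⟩
      · exact ⟨y, by simp⟩)
  exact ⟨⟨⟨G, hG⟩, hGD _ _ (by simp) (by simp), hGD _ _ (by simp) (by simp)⟩⟩

theorem subsingleton_homotopyGroup_of_retract (hZ : IsClosed Z) (hZr : Z ⊆ constOnCard n r)
    (hι : Continuous ι) (hιZ : ∀ x, ι x ∈ Zᶜ) (hρ : Continuous ρ)
    (hρι : ∀ x, ρ ⟨ι x, hιZ x⟩ = x) {i : ℕ} (hi : i + 3 ≤ r) (x : X) :
    Subsingleton (HomotopyGroup (Fin i) X x) := by
  suffices h : ∀ f : GenLoop (Fin i) X x, GenLoop.Homotopic f GenLoop.const by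
    refine ⟨fun a b => ?_⟩
    induction a using Quotient.inductionOn with | _ f
    induction b using Quotient.inductionOn with | _ g
    exact Quotient.sound ((h f).trans (h g).symm)
  intro f
  let proj (p : Fin i → ℝ) : Fin i → I := fun j => projIcc 0 1 zero_le_one (p j)
  have hproj : Continuous proj :=
    continuous_pi fun j => continuous_projIcc.comp (continuous_apply j)
  have hproj' (p : Fin i → I) : proj (fun j => (p j : ℝ)) = p := by
    ext j; simp [proj]
  let D : Set (ℝ × (Fin i → ℝ)) :=
    {q | q.1 = 0} ∪ {q | q.1 = 1} ∪ ⋃ j, ({q | q.2 j = 0} ∪ {q | q.2 j = 1})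
  have hD : IsClosed D := by
    refine IsClosed.union (IsClosed.union ?_ ?_) (isClosed_iUnion_of_finite fun j =>
      IsClosed.union ?_ ?_) <;> exact isClosed_eq (by fun_prop) (by fun_prop)
  have hbd (q : ℝ × (Fin i → ℝ)) (j : Fin i) (hj : q.2 j = 0 ∨ q.2 j = 1) :
      f (proj q.2) = x := by
    refine f.2 _ ⟨j, ?_⟩
    rcases hj with h | h <;> simp [proj, h]
  let F (q : ℝ × (Fin i → ℝ)) : Fin n → ℝ := (1 - q.1) • ι (f (proj q.2)) + q.1 • ι x
  have hF : Continuous F := by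
    have : Continuous fun q : ℝ × (Fin i → ℝ) => ι (f (proj q.2)) :=
      hι.comp (f.1.continuous.comp (hproj.comp continuous_snd))
    fun_prop
  have hF0 (q) (hq : q.1 = 0) : F q = ι (f (proj q.2)) := by simp [F, hq]
  have hF1 (q) (hq : q.1 = 1) : F q = ι x := by simp [F, hq]
  have hFj (q) (j) (hj : q.2 j = 0 ∨ q.2 j = 1) : F q = ι x := by
    simp only [F, hbd q j hj]
    module
  obtain ⟨G, hG, hGD⟩ := exists_continuous_retract_lift hZ hZr hιZ hρ hρι
    (E := ℝ × (Fin i → ℝ)) (by simp; omega) hF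
    (D := D) (K := Icc 0 1) isCompact_Icc hD (by
      rintro q ((hq | hq) | hq)
      · exact ⟨_, hF0 q hq⟩
      · exact ⟨_, hF1 q hq⟩
      · obtain ⟨j, hj⟩ := mem_iUnion.1 hq
        exact ⟨_, hFj q j hj⟩)
  let c (q : I × (Fin i → I)) : ↥(Icc (0 : ℝ × (Fin i → ℝ)) 1) :=
    ⟨(q.1, fun j => q.2 j), ⟨⟨q.1.2.1, fun j => (q.2 j).2.1⟩, ⟨q.1.2.2, fun j => (q.2 j).2.2⟩⟩⟩
  have hc : Continuous c := by fun_prop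
  refine ⟨⟨⟨⟨fun q => G (c q), hG.comp hc⟩, ?_, ?_⟩, ?_⟩⟩
  · intro p
    refine hGD _ _ (Or.inl (Or.inl rfl)) ((hF0 _ rfl).trans ?_)
    simp only [c, hproj']
    rfl
  · intro p
    exact hGD _ _ (Or.inl (Or.inr rfl)) (hF1 _ rfl)
  · rintro t p ⟨j, hj⟩
    have hj' : (c (t, p)).1.2 j = 0 ∨ (c (t, p)).1.2 j = 1 := by
      rcases hj with h | h <;> simp [c, h]
    refine (hGD _ _ (Or.inr (mem_iUnion.2 ⟨j, hj'⟩)) (hFj _ j hj')).trans ?_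
    exact (f.2 p ⟨j, hj⟩).symm

end Retract

section Matroid

variable {n : ℕ} {M : Matroid (Fin n)}

/-- The vectors all of whose superlevel sets are flats of `M`. -/
def flatVectors (M : Matroid (Fin n)) : Set (Fin n → ℝ) :=
  {h | ∀ t : ℝ, M.closure {j | t ≤ h j} = {j | t ≤ h j}}

open Classical in
/-- The least vector above `h` whose superlevel sets are flats of `M`. -/
def flatHull (hE : M.E = univ) (h : Fin n → ℝ) (i : Fin n) : ℝ :=
  (Finset.univ : Finset {S : Finset (Fin n) // S.Nonempty ∧ i ∈ M.closure S}).sup'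
    (Finset.univ_nonempty_iff.2
      ⟨⟨{i}, by simp, M.mem_closure_of_mem (by simp) (by simp [hE])⟩⟩)
    fun S => S.1.inf' S.2.1 h

theorem continuous_flatHull (hE : M.E = univ) : Continuous (flatHull hE) := by
  refine continuous_pi fun i => ?_
  unfold flatHull
  exact Continuous.finset_sup'_apply _ fun S _ =>
    Continuous.finset_inf'_apply _ fun j _ => continuous_apply j

theorem le_flatHull_iff (hE : M.E = univ) (hM : M.closure ∅ = ∅) {h : Fin n → ℝ} {i : Fin n}
    {t : ℝ} : t ≤ flatHull hE h i ↔ i ∈ M.closure {j | t ≤ h j} := by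
  classical
  unfold flatHull
  rw [Finset.le_sup'_iff]
  simp only [Finset.mem_univ, true_and, Finset.le_inf'_iff]
  constructor
  · rintro ⟨⟨S, hS, hi⟩, ht⟩
    exact M.closure_subset_closure (fun j hj => ht j hj) hi
  · intro hi
    have hcoe : ((Finset.univ.filter fun j => t ≤ h j : Finset (Fin n)) : Set (Fin n))
        = {j | t ≤ h j} := by simp
    refine ⟨⟨Finset.univ.filter fun j => t ≤ h j, ?_, by rwa [hcoe]⟩, by simp⟩
    rw [← Finset.coe_nonempty, hcoe, nonempty_iff_ne_empty]
    intro hempty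
    rw [hempty, hM] at hi
    exact hi

theorem flatHull_mem_flatVectors (hE : M.E = univ) (hM : M.closure ∅ = ∅) (h : Fin n → ℝ) :
    flatHull hE h ∈ flatVectors M := by
  intro t
  simp only [le_flatHull_iff hE hM, ofPred_mem_eq, M.closure_closure]

theorem flatHull_eq_self (hE : M.E = univ) (hM : M.closure ∅ = ∅) {h : Fin n → ℝ}
    (hh : h ∈ flatVectors M) : flatHull hE h = h := by
  ext i
  refine eq_of_forall_le_iff fun t => ?_
  rw [le_flatHull_iff hE hM, hh t]
  rfl

theorem add_const_mem_flatVectors {h : Fin n → ℝ} (hh : h ∈ flatVectors M) (c : ℝ) :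
    (fun i => h i + c) ∈ flatVectors M := by
  intro t
  simpa only [sub_le_iff_le_add] using hh (t - c)

theorem le_ncard_of_isBase {r : ℕ} (hrank : mrk M univ = r) {B : Set (Fin n)}
    (hB : M.IsBase B) : r ≤ B.ncard := by
  have hmem : mrk M univ ∈ {k | ∃ J, M.Indep J ∧ J ⊆ univ ∧ J.ncard = k} := by
    refine Nat.sSup_mem ⟨0, ∅, M.empty_indep, by simp, by simp⟩ ⟨n, ?_⟩
    rintro _ ⟨J, -, -, rfl⟩
    simpa using ncard_le_card J
  obtain ⟨J, hJ, -, hcard⟩ := hmem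
  obtain ⟨B', hB', hJB'⟩ := hJ.exists_isBase_superset
  rw [← hrank, ← hcard, hB.ncard_eq_ncard_of_isBase hB']
  exact ncard_le_ncard hJB' (toFinite _)

/-- If the hull of `h` is constant, then `h` attains its maximum on a basis of `M`. -/
theorem mem_constOnCard_of_flatHull_const (hE : M.E = univ) (hM : M.closure ∅ = ∅) {r : ℕ}
    (hrank : mrk M univ = r) (hn : 0 < n) {h : Fin n → ℝ}
    (hh : ∀ i j, flatHull hE h i = flatHull hE h j) : h ∈ constOnCard n r := by
  have : Nonempty (Fin n) := ⟨⟨0, hn⟩⟩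
  obtain ⟨i₀, hi₀⟩ := Finite.exists_max h
  have hcl : M.closure {j | h i₀ ≤ h j} = M.E := by
    rw [hE, eq_univ_iff_forall]
    intro i
    rw [← le_flatHull_iff hE hM, hh i i₀, le_flatHull_iff hE hM]
    exact M.mem_closure_of_mem (le_refl (h i₀)) (by simp [hE])
  obtain ⟨B, hB, hBs⟩ := ((M.spanning_iff_closure_eq (by simp [hE])).2 hcl).exists_isBase_subset
  refine ⟨B.toFinite.toFinset, ?_, h i₀, ?_⟩
  · rw [← ncard_eq_toFinset_card]
    exact le_ncard_of_isBase hrank hB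
  · intro i hi
    exact le_antisymm (hi₀ i) (hBs (by simpa using hi))

end Matroid

section PosSpan

variable {V : Type*} [AddCommMonoid V] [Module ℝ V]

theorem posSpan_mono {s t : Set V} (h : s ⊆ t) : posSpan s ⊆ posSpan t := by
  rintro _ ⟨T, c, hT, hc, rfl⟩
  exact ⟨T, c, hT.trans h, hc, rfl⟩

theorem zero_mem_posSpan (s : Set V) : (0 : V) ∈ posSpan s :=
  ⟨∅, 0, by simp, by simp, by simp⟩

theorem smul_mem_posSpan {s : Set V} {a : ℝ} (ha : 0 ≤ a) {x : V} (hx : x ∈ posSpan s) :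
    a • x ∈ posSpan s := by
  obtain ⟨T, c, hT, hc, rfl⟩ := hx
  exact ⟨T, fun v => a * c v, hT, fun v => mul_nonneg ha (hc v), by
    simp only [Finset.smul_sum, mul_smul]⟩

theorem add_smul_mem_posSpan {s : Set V} {a : ℝ} (ha : 0 ≤ a) {x v : V} (hx : x ∈ posSpan s)
    (hv : v ∈ s) : x + a • v ∈ posSpan s := by
  classical
  obtain ⟨T, c, hT, hc, rfl⟩ := hx
  refine ⟨insert v T, fun w => (if w ∈ T then c w else 0) + (if w = v then a else 0), ?_, ?_, ?_⟩
  · simpa [insert_subset_iff] using ⟨hv, hT⟩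
  · intro w
    have := hc w
    dsimp only
    positivity
  · simp only [add_smul, Finset.sum_add_distrib, ite_smul, zero_smul]
    congr 1
    · rw [← Finset.sum_filter]
      congr 1
      ext w
      simp only [Finset.mem_filter, Finset.mem_insert]
      tauto
    · simp

end PosSpan

section Fan

variable {n : ℕ} {M : Matroid (Fin n)} {V : Type*} [AddCommGroup V] [Module ℝ V] {e : Fin n → V}

theorem eVec_eq_linearCombination (S : Set (Fin n)) :
    eVec e S = Fintype.linearCombination ℝ e (S.indicator 1) := by
  classical
  rw [eVec, finsum_mem_def, finsum_eq_sum_of_fintype, Fintype.linearCombination_apply]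
  refine Finset.sum_congr rfl fun i _ => ?_
  by_cases h : i ∈ S <;> simp [h]

theorem linearCombination_mem_posSpan_superlevel (hsum : ∑ i, e i = 0) (h : Fin n → ℝ) :
    Fintype.linearCombination ℝ e h ∈
      posSpan (eVec e '' {S | S.Nonempty ∧ S ≠ univ ∧ ∃ t : ℝ, S = {j | t ≤ h j}}) := by
  classical
  induction hk : (Finset.univ.image h).card using Nat.strong_induction_on generalizing h with
  | _ k ih =>
  by_cases hconst : ∀ i j, h i = h j
  · have hzero : Fintype.linearCombination ℝ e h = 0 := by
      rw [Fintype.linearCombination_apply]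
      rcases isEmpty_or_nonempty (Fin n) with hn | ⟨⟨i⟩⟩
      · simp
      · simp [hconst _ i, ← Finset.smul_sum, hsum]
    rw [hzero]
    exact zero_mem_posSpan _
  push Not at hconst
  obtain ⟨a, b, hab⟩ := hconst
  have : Nonempty (Fin n) := ⟨a⟩
  obtain ⟨i₀, hi₀⟩ := Finite.exists_max h
  have hne : (Finset.univ.filter fun j => h j ≠ h i₀).Nonempty := by
    by_cases ha : h a = h i₀
    · exact ⟨b, by simpa using fun hb => hab (ha.trans hb.symm)⟩
    · exact ⟨a, by simpa using ha⟩
  obtain ⟨i₁, hi₁, hmax⟩ := Finset.exists_max_image _ h hne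
  simp only [Finset.mem_filter, Finset.mem_univ, true_and] at hi₁ hmax
  have hlt : h i₁ < h i₀ := lt_of_le_of_ne (hi₀ i₁) hi₁
  let h' : Fin n → ℝ := fun j => min (h j) (h i₁)
  have hcard : (Finset.univ.image h').card < k := by
    rw [← hk]
    refine Finset.card_lt_card (Finset.ssubset_iff_subset_ne.2 ⟨?_, fun heq => ?_⟩)
    · intro y hy
      obtain ⟨j, -, rfl⟩ := Finset.mem_image.1 hy
      rcases min_choice (h j) (h i₁) with hj | hj <;> simp [h', hj]
    · have : h i₀ ∈ Finset.univ.image h' := heq ▸ Finset.mem_image_of_mem h (Finset.mem_univ i₀)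
      obtain ⟨j, -, hj⟩ := Finset.mem_image.1 this
      exact absurd (hj ▸ min_le_right (h j) (h i₁)) (not_le.2 hlt)
  have hdecomp : h = h' + (h i₀ - h i₁) • ({j | h i₀ ≤ h j} : Set (Fin n)).indicator 1 := by
    ext j
    by_cases hj : h i₀ ≤ h j
    · have : h j = h i₀ := le_antisymm (hi₀ j) hj
      simp [h', this, hlt.le]
    · have : h j ≤ h i₁ := hmax j (fun heq => hj heq.ge)
      simp [h', hj, this]
  have key : Fintype.linearCombination ℝ e h = Fintype.linearCombination ℝ e h' +
      (h i₀ - h i₁) • eVec e {j | h i₀ ≤ h j} := by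
    conv_lhs => rw [hdecomp]
    rw [map_add, map_smul, eVec_eq_linearCombination]
  rw [key]
  refine add_smul_mem_posSpan (sub_nonneg.2 hlt.le) (posSpan_mono (image_mono ?_)
    (ih _ hcard h' rfl)) ⟨_, ⟨⟨i₀, le_refl (h i₀)⟩, ?_, _, rfl⟩, rfl⟩
  · rintro S ⟨hS, hSu, t, rfl⟩
    refine ⟨hS, hSu, t, ?_⟩
    obtain ⟨j, hj⟩ := hS
    have ht : t ≤ h i₁ := le_trans hj (min_le_right _ _)
    ext j
    simp [h', ht]
  · intro hu
    exact absurd (eq_univ_iff_forall.1 hu i₁) (not_le.2 hlt)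

theorem linearCombination_mem_bergmanFan (hsum : ∑ i, e i = 0) {h : Fin n → ℝ}
    (hh : h ∈ flatVectors M) : Fintype.linearCombination ℝ e h ∈ bergmanFan M e := by
  refine mem_iUnion₂.2 ⟨{S | S.Nonempty ∧ S ≠ univ ∧ ∃ t : ℝ, S = {j | t ≤ h j}}, ⟨?_, ?_⟩,
    linearCombination_mem_posSpan_superlevel hsum h⟩
  · rintro S ⟨hS, hSu, t, rfl⟩
    exact ⟨hh t, hS, hSu⟩
  · rintro _ ⟨-, -, t, rfl⟩ _ ⟨-, -, t', rfl⟩ -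
    rcases le_total t t' with htt | htt
    · exact Or.inr fun j hj => le_trans htt hj
    · exact Or.inl fun j hj => le_trans htt hj

theorem smul_mem_bergmanFan {a : ℝ} (ha : 0 ≤ a) {x : V} (hx : x ∈ bergmanFan M e) :
    a • x ∈ bergmanFan M e := by
  obtain ⟨C, hC, hxC⟩ := mem_iUnion₂.1 hx
  exact mem_iUnion₂.2 ⟨C, hC, smul_mem_posSpan ha hxC⟩

/-- A nonnegative combination of indicators of a chain of flats has flat superlevel sets. -/
theorem sum_indicator_mem_flatVectors (hE : M.E = univ) (hM : M.closure ∅ = ∅) {κ : Type*} (T : Finset κ)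
    {c : κ → ℝ} (hc : ∀ v, 0 ≤ c v) {F : κ → Set (Fin n)}
    (hF : ∀ v ∈ T, M.closure (F v) = F v) (hchain : ∀ v ∈ T, ∀ w ∈ T, F v ⊆ F w ∨ F w ⊆ F v) :
    ∑ v ∈ T, c v • (F v).indicator (1 : Fin n → ℝ) ∈ flatVectors M := by
  classical
  intro t
  set h := ∑ v ∈ T, c v • (F v).indicator (1 : Fin n → ℝ) with hdef
  have hval (j) : h j = ∑ v ∈ T with j ∈ F v, c v := by
    rw [hdef, Finset.sum_apply, Finset.sum_filter]
    refine Finset.sum_congr rfl fun v _ => ?_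
    by_cases hj : j ∈ F v <;> simp [hj]
  rcases eq_empty_or_nonempty {j | t ≤ h j} with hS | hS
  · rw [hS, hM]
  obtain ⟨i, hi, hmin⟩ := Set.exists_min_image {j | t ≤ h j}
    (fun j => (T.filter fun v => j ∈ F v).card) (toFinite _) hS
  have hsub (v) (hv : v ∈ T) (hiv : i ∈ F v) : {j | t ≤ h j} ⊆ F v := by
    intro j hj
    by_contra hjv
    have hss : (T.filter fun w => j ∈ F w) ⊂ T.filter fun w => i ∈ F w := by
      refine Finset.ssubset_iff_subset_ne.2 ⟨fun w hw => ?_, fun heq => ?_⟩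
      · rw [Finset.mem_filter] at hw ⊢
        rcases hchain v hv w hw.1 with hvw | hwv
        · exact ⟨hw.1, hvw hiv⟩
        · exact absurd (hwv hw.2) hjv
      · have : v ∈ T.filter fun w => j ∈ F w := heq ▸ Finset.mem_filter.2 ⟨hv, hiv⟩
        exact hjv (Finset.mem_filter.1 this).2
    exact absurd (hmin j hj) (not_le.2 (Finset.card_lt_card hss))
  refine Subset.antisymm (fun j hj => ?_) (M.subset_closure _ (by simp [hE]))
  refine le_trans (show t ≤ h i from hi) ?_
  rw [hval, hval]
  refine Finset.sum_le_sum_of_subset_of_nonneg (fun v hv => ?_) fun v _ _ => hc v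
  rw [Finset.mem_filter] at hv ⊢
  refine ⟨hv.1, ?_⟩
  rw [← hF v hv.1]
  exact M.closure_subset_closure (hsub v hv.1 hv.2) hj

theorem exists_mem_flatVectors_of_mem_bergmanFan (hE : M.E = univ) (hM : M.closure ∅ = ∅)
    {y : V} (hy : y ∈ bergmanFan M e) :
    ∃ h ∈ flatVectors M, Fintype.linearCombination ℝ e h = y := by
  classical
  obtain ⟨C, ⟨hCF, hC⟩, T, c, hT, hc, rfl⟩ := mem_iUnion₂.1 hy
  have hch : ∀ v, ∃ S : Set (Fin n), v ∈ T → S ∈ C ∧ eVec e S = v := by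
    intro v
    by_cases hv : v ∈ T
    · obtain ⟨S, hS, hSv⟩ := hT hv
      exact ⟨S, fun _ => ⟨hS, hSv⟩⟩
    · exact ⟨∅, fun h => absurd h hv⟩
  choose F hF using hch
  refine ⟨_, sum_indicator_mem_flatVectors hE hM T hc (F := F) (fun v hv => (hCF (hF v hv).1).1)
    (fun v hv w hw => hC.total (hF v hv).1 (hF w hw).1), ?_⟩
  rw [map_sum]
  refine Finset.sum_congr rfl fun v hv => ?_
  rw [map_smul, ← eVec_eq_linearCombination, (hF v hv).2]

theorem eq_of_linearCombination_eq_zero (hsum : ∑ i, e i = 0)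
    (hind : ∀ s : Finset (Fin n), s ≠ Finset.univ → LinearIndependent ℝ (fun i : ↥s => e ↑i))
    {h : Fin n → ℝ} (hh : Fintype.linearCombination ℝ e h = 0) (i j : Fin n) : h i = h j := by
  classical
  rcases eq_or_ne i j with rfl | hij
  · rfl
  have hs : Finset.univ.erase j ≠ Finset.univ := fun heq =>
    Finset.notMem_erase j Finset.univ (heq.symm ▸ Finset.mem_univ j :)
  have hzero : ∑ k : ↥(Finset.univ.erase j), (h k - h j) • e k = 0 := by
    rw [Finset.sum_coe_sort _ fun k => (h k - h j) • e k, Finset.sum_erase _ (by simp)]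
    rw [Fintype.linearCombination_apply] at hh
    simp [sub_smul, hh, ← Finset.smul_sum, hsum]
  exact sub_eq_zero.1 (Fintype.linearIndependent_iff.1 (hind _ hs) (fun k => h k - h j) hzero
    ⟨i, by simp [hij]⟩)

theorem mem_flatVectors_of_linearCombination_mem (hE : M.E = univ) (hM : M.closure ∅ = ∅)
    (hsum : ∑ i, e i = 0)
    (hind : ∀ s : Finset (Fin n), s ≠ Finset.univ → LinearIndependent ℝ (fun i : ↥s => e ↑i))
    {h : Fin n → ℝ} (hh : Fintype.linearCombination ℝ e h ∈ bergmanFan M e) :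
    h ∈ flatVectors M := by
  obtain ⟨h', hh', heq⟩ := exists_mem_flatVectors_of_mem_bergmanFan hE hM hh
  have hconst := eq_of_linearCombination_eq_zero hsum hind (h := h - h') (by
    rw [map_sub, heq, sub_self])
  rcases isEmpty_or_nonempty (Fin n) with hn | ⟨⟨i⟩⟩
  · rwa [Subsingleton.elim h h']
  · convert add_const_mem_flatVectors hh' ((h - h') i) using 1
    ext j
    rw [← hconst j i, Pi.sub_apply]
    ring

theorem linearCombination_surjective [FiniteDimensional ℝ V] (hV : finrank ℝ V = n - 1)
    (hind : ∀ s : Finset (Fin n), s ≠ Finset.univ → LinearIndependent ℝ (fun i : ↥s => e ↑i)) :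
    Function.Surjective (Fintype.linearCombination ℝ e) := by
  classical
  rw [← LinearMap.range_eq_top, Fintype.range_linearCombination]
  rcases isEmpty_or_nonempty (Fin n) with hn | ⟨⟨i⟩⟩
  · obtain rfl : n = 0 := by
      by_contra h0
      exact hn.false ⟨0, Nat.pos_of_ne_zero h0⟩
    have := finrank_zero_iff.1 hV
    exact Subsingleton.elim _ _
  have hli := hind (Finset.univ.erase i) fun heq =>
    Finset.notMem_erase i Finset.univ (heq.symm ▸ Finset.mem_univ i :)
  have hspan := hli.span_eq_top_of_card_eq_finrank' (by simp [hV])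
  refine top_unique (hspan ▸ Submodule.span_mono ?_)
  rintro _ ⟨k, rfl⟩
  exact ⟨k, rfl⟩

end Fan

section Link

variable {n r : ℕ} {M : Matroid (Fin n)} {V : Type*} [NormedAddCommGroup V] [NormedSpace ℝ V]
  [FiniteDimensional ℝ V] {e : Fin n → V}

/-- The link of the Bergman fan is a retract of the complement of a closed set of vectors which are
constant on `r` coordinates. -/
theorem exists_retract_bergmanFan_link (hE : M.E = univ) (hM : M.closure ∅ = ∅)
    (hrank : mrk M univ = r) (hn : 0 < n) (hV : finrank ℝ V = n - 1) (hsum : ∑ i, e i = 0)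
    (hind : ∀ s : Finset (Fin n), s ≠ Finset.univ →
      LinearIndependent ℝ (fun i : ↥s => e ↑i)) :
    ∃ (Z : Set (Fin n → ℝ)) (ι : ↥(bergmanFan M e ∩ Metric.sphere (0 : V) 1) → Fin n → ℝ)
      (ρ : ↥Zᶜ → ↥(bergmanFan M e ∩ Metric.sphere (0 : V) 1)) (hιZ : ∀ x, ι x ∈ Zᶜ),
      IsClosed Z ∧ Z ⊆ constOnCard n r ∧ Continuous ι ∧ Continuous ρ ∧
        ∀ x, ρ ⟨ι x, hιZ x⟩ = x := by
  let Φ := Fintype.linearCombination ℝ e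
  have hΦ : Continuous Φ := LinearMap.continuous_of_finiteDimensional Φ
  obtain ⟨τ, hτ⟩ := Φ.exists_rightInverse_of_surjective
    (LinearMap.range_eq_top.2 (linearCombination_surjective hV hind))
  have hτ' (y) : Φ (τ y) = y := LinearMap.congr_fun hτ y
  have hhull (x : ↥(bergmanFan M e ∩ Metric.sphere (0 : V) 1)) :
      Φ (flatHull hE (τ x)) = x := by
    rw [flatHull_eq_self hE hM, hτ']
    refine mem_flatVectors_of_linearCombination_mem (e := e) hE hM hsum hind ?_
    exact (hτ' x).symm ▸ x.2.1
  have hcont : Continuous fun h => Φ (flatHull hE h) := hΦ.comp (continuous_flatHull hE)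
  have hnorm (x : ↥(bergmanFan M e ∩ Metric.sphere (0 : V) 1)) : ‖(x : V)‖ = 1 := by
    simpa using x.2.2
  have hne (h : ↥{h | Φ (flatHull hE h) = 0}ᶜ) : ‖Φ (flatHull hE h)‖ ≠ 0 :=
    norm_ne_zero_iff.2 h.2
  refine ⟨{h | Φ (flatHull hE h) = 0}, fun x => τ x,
    fun h => ⟨‖Φ (flatHull hE h)‖⁻¹ • Φ (flatHull hE h), ?_, ?_⟩, ?_, ?_, ?_, ?_, ?_, ?_⟩
  · exact smul_mem_bergmanFan (inv_nonneg.2 (norm_nonneg _))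
      (linearCombination_mem_bergmanFan hsum (flatHull_mem_flatVectors hE hM _))
  · simp [norm_smul, hne h]
  · intro x hx
    have hzero : (x : V) = 0 := (hhull x).symm.trans hx
    simpa [hzero] using hnorm x
  · exact isClosed_eq hcont continuous_const
  · intro h hh
    exact mem_constOnCard_of_flatHull_const hE hM hrank hn
      (eq_of_linearCombination_eq_zero hsum hind hh)
  · exact (LinearMap.continuous_of_finiteDimensional τ).comp continuous_subtype_val
  · have hc : Continuous fun h : ↥{h | Φ (flatHull hE h) = 0}ᶜ => Φ (flatHull hE h) :=
      hcont.comp continuous_subtype_val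
    exact Continuous.subtype_mk ((hc.norm.inv₀ hne).smul hc) _
  · intro x
    ext1
    simp only [hhull, hnorm]
    simp

end Link

end BergmanLink

/-- **The link of a Bergman fan is `(r-3)`-connected**: for a loopless matroid `M` of
rank `r ≥ 2` on `{1,…,n}`, the intersection of the Bergman fan `B(M) ⊆ ℝ^{n-1}` with
the unit sphere is `(r-3)`-connected. -/
theorem bergmanFan_link_connected
    {n r : ℕ} (M : Matroid (Fin n)) (hE : M.E = Set.univ)
    (hLoopless : M.closure ∅ = ∅)
    (hrank : mrk M Set.univ = r) (hr : 2 ≤ r)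
    (e : Fin n → EuclideanSpace ℝ (Fin (n - 1)))
    (hsum : ∑ i, e i = 0)
    (hind : ∀ s : Finset (Fin n), s ≠ Finset.univ →
      LinearIndependent ℝ (fun i : ↥s => e ↑i)) :
    KConn (↥(bergmanFan M e ∩ Metric.sphere (0 : EuclideanSpace ℝ (Fin (n - 1))) 1))
      ((r : ℤ) - 3) := by
  have hn : 0 < n := by
    by_contra hn
    obtain rfl : n = 0 := by omega
    obtain ⟨B, hB⟩ := M.exists_isBase
    have := BergmanLink.le_ncard_of_isBase hrank hB
    have := Set.ncard_le_card B
    simp only [Nat.card_eq_fintype_card, Fintype.card_fin] at this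
    omega
  obtain ⟨Z, ι, ρ, hιZ, hZ, hZr, hι, hρ, hρι⟩ :=
    BergmanLink.exists_retract_bergmanFan_link hE hLoopless hrank hn (by simp) hsum hind
  have hne : Nonempty ↥(bergmanFan M e ∩ Metric.sphere (0 : EuclideanSpace ℝ (Fin (n - 1))) 1) := by
    obtain ⟨v, -, hv⟩ := BergmanLink.exists_small_translate_notMem_constOnCard (n := n)
      (r := r) (E := Fin 0 → ℝ) (by simp; omega) (g := 0) contDiff_const one_pos
    exact ⟨ρ ⟨v, fun hmem => hv 0 (by simpa using hZr hmem)⟩⟩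
  refine Or.inr ⟨hne, fun hk => ?_, fun i _ hi x => ?_⟩
  · exact BergmanLink.pathConnectedSpace_of_retract hZ hZr hιZ hρ hρι hne (by omega)
  · exact BergmanLink.subsingleton_homotopyGroup_of_retract hZ hZr hι hιZ hρ hρι (by omega) x
end
end

section
/- Let M be a loopless matroid of rank r on E = {1,…,n} with 2 ≤ r < n, and let B(M) ⊆ ℝ^{n−1} be its Bergman fan. Then the complement ℝ^{n−1} ∖ B(M) is (n−r−2)-connected and is homotopy equivalent to the geometric realization of a finite simplicial complex of dimension at most n−r−1 (indeed, it is homotopy equivalent to a wedge of spheres of dimension n−r−1). -/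
open Function

noncomputable section

/-- The geometric realization of the (abstract, finite) simplicial complex `K` on the
vertex set `α`: convex combinations supported inside a face of `K`. -/
def simplicialRealization {α : Type*} (K : Set (Finset α)) : Set (α → ℝ) :=
  {f | (∀ x, 0 ≤ f x) ∧ (∃ s ∈ K, Function.support f ⊆ ↑s) ∧ ∑ᶠ x, f x = 1}

/-- A concrete model for a wedge of `k` spheres of dimension `d`, realized in
`ℝ^{d+1}` as the union of `k` pairwise tangent spheres through the origin
(for `k = 0` it is the one-point space `{0}`). -/
def wedgeOfSpheres (d k : ℕ) : Set (EuclideanSpace ℝ (Fin (d + 1))) :=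
  {0} ∪ ⋃ i ∈ Finset.range k,
    Metric.sphere (((i : ℝ) + 1) • EuclideanSpace.single (0 : Fin (d + 1)) (1 : ℝ))
      ((i : ℝ) + 1)

set_option linter.unusedSectionVars false

/-- A homotopy on a space descends to a quotient of that space. -/
theorem Quot.homotopic {T Z : Type*} [TopologicalSpace T] [TopologicalSpace Z]
    {rel : T → T → Prop} {F G : C(Quot rel, Z)} (H : T → unitInterval → Z)
    (hH : Continuous fun p : T × unitInterval => H p.1 p.2)
    (hr : ∀ a b, rel a b → ∀ s, H a s = H b s)
    (h0 : ∀ a, H a 0 = F (Quot.mk rel a)) (h1 : ∀ a, H a 1 = G (Quot.mk rel a)) :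
    F.Homotopic G := by
  let c : C(T, C(unitInterval, Z)) := ContinuousMap.curry ⟨fun p : T × unitInterval => H p.1 p.2, hH⟩
  have hc : ∀ a b, rel a b → c a = c b := fun a b h => by
    ext t; exact hr a b h t
  let d : C(Quot rel, C(unitInterval, Z)) := ⟨Quot.lift c hc, continuous_quot_lift hc c.continuous⟩
  refine ⟨⟨⟨fun p => d p.2 p.1, ?_⟩, ?_, ?_⟩⟩
  · exact (ContinuousMap.continuous_uncurry_of_continuous d).comp continuous_swap
  · rintro ⟨a⟩; exact h0 a
  · rintro ⟨a⟩; exact h1 a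

/-- The relation whose quotient is the mapping cone of `f`. -/
inductive MConeRel {A X : Type*} (f : A → X) :
    Unit ⊕ (A × unitInterval) ⊕ X → Unit ⊕ (A × unitInterval) ⊕ X → Prop
  | zero (a : A) : MConeRel f (Sum.inr (Sum.inl (a, 0))) (Sum.inl ())
  | one (a : A) : MConeRel f (Sum.inr (Sum.inl (a, 1))) (Sum.inr (Sum.inr (f a)))

/-- The mapping cone of `f : A → X`; its vertex is present even if `A` is empty. -/
def MCone {A X : Type*} (f : A → X) : Type _ := Quot (MConeRel f)

namespace MCone

variable {A X Z : Type*} [TopologicalSpace A] [TopologicalSpace X] [TopologicalSpace Z]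

instance (f : A → X) : TopologicalSpace (MCone f) :=
  inferInstanceAs (TopologicalSpace (Quot (MConeRel f)))

/-- Clamping a real number to the unit interval. -/
abbrev clamp (t : ℝ) : unitInterval := Set.projIcc 0 1 zero_le_one t

theorem clamp_of_le {t : ℝ} (h : t ≤ 0) : clamp t = 0 := Set.projIcc_of_le_left _ h
theorem clamp_of_ge {t : ℝ} (h : 1 ≤ t) : clamp t = 1 := Set.projIcc_of_right_le _ h
theorem clamp_coe (t : unitInterval) : clamp t = t := Set.projIcc_val _ t
theorem coe_clamp (t : ℝ) : (clamp t : ℝ) = max 0 (min 1 t) := rfl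
theorem continuous_clamp : Continuous clamp := continuous_projIcc

/-- The vertex of the mapping cone. -/
def pt (f : A → X) : MCone f := Quot.mk _ (Sum.inl ())

/-- Points on the cylinder of the mapping cone, with clamped height. -/
def cyl (f : A → X) (a : A) (t : ℝ) : MCone f := Quot.mk _ (Sum.inr (Sum.inl (a, clamp t)))

/-- Points on the base of the mapping cone. -/
def base (f : A → X) (x : X) : MCone f := Quot.mk _ (Sum.inr (Sum.inr x))

theorem cyl_of_le (f : A → X) (a : A) {t : ℝ} (h : t ≤ 0) : cyl f a t = pt f := by
  rw [cyl, clamp_of_le h]; exact Quot.sound (.zero a)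

theorem cyl_of_ge (f : A → X) (a : A) {t : ℝ} (h : 1 ≤ t) : cyl f a t = base f (f a) := by
  rw [cyl, clamp_of_ge h]; exact Quot.sound (.one a)

theorem continuous_cyl (f : A → X) : Continuous fun p : A × ℝ => cyl f p.1 p.2 :=
  continuous_quot_mk.comp (continuous_inr.comp (continuous_inl.comp
    (continuous_fst.prodMk (continuous_clamp.comp continuous_snd))))

theorem continuous_base (f : A → X) : Continuous (base f) :=
  continuous_quot_mk.comp (continuous_inr.comp continuous_inr)

/-- Maps out of a mapping cone. -/
def desc {f : A → X} (p : Z) (c : A → ℝ → Z) (b : X → Z)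
    (hc : Continuous fun x : A × ℝ => c x.1 x.2) (hb : Continuous b)
    (h0 : ∀ a, c a 0 = p) (h1 : ∀ a, c a 1 = b (f a)) : C(MCone f, Z) where
  toFun := Quot.lift (Sum.elim (fun _ => p) (Sum.elim (fun q => c q.1 q.2) b)) (by
    rintro _ _ (a | a)
    · simpa using h0 a
    · simpa using h1 a)
  continuous_toFun := continuous_quot_lift _ (by
    refine continuous_const.sumElim (Continuous.sumElim ?_ hb)
    exact hc.comp (continuous_fst.prodMk (continuous_subtype_val.comp continuous_snd)))

section desc
variable {f : A → X} {p : Z} {c : A → ℝ → Z} {b : X → Z}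
    {hc : Continuous fun x : A × ℝ => c x.1 x.2} {hb : Continuous b}
    {h0 : ∀ a, c a 0 = p} {h1 : ∀ a, c a 1 = b (f a)}

@[simp] theorem desc_pt : desc p c b hc hb h0 h1 (pt f) = p := rfl
@[simp] theorem desc_base (x : X) : desc p c b hc hb h0 h1 (base f x) = b x := rfl
theorem desc_cyl_clamp (a : A) (t : ℝ) :
    desc p c b hc hb h0 h1 (cyl f a t) = c a (clamp t) := rfl
theorem desc_cyl (a : A) {t : ℝ} (ht0 : 0 ≤ t) (ht1 : t ≤ 1) :
    desc p c b hc hb h0 h1 (cyl f a t) = c a t := by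
  rw [desc_cyl_clamp, coe_clamp, min_eq_right ht1, max_eq_right ht0]
theorem desc_cyl' (hl : ∀ a t, t ≤ 0 → c a t = p) (hg : ∀ a t, 1 ≤ t → c a t = b (f a))
    (a : A) (t : ℝ) : desc p c b hc hb h0 h1 (cyl f a t) = c a t := by
  rcases le_total t 0 with h | h
  · rw [cyl_of_le f a h, hl a t h]; rfl
  rcases le_total 1 t with h' | h'
  · rw [cyl_of_ge f a h', hg a t h']; rfl
  · exact desc_cyl a h h'
end desc

/-- Homotopies between maps out of a mapping cone. -/
theorem homotopic {f : A → X} {F G : C(MCone f, Z)} (p : ℝ → Z) (c : A → ℝ → ℝ → Z) (b : X → ℝ → Z)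
    (hp : Continuous p) (hc : Continuous fun x : A × ℝ × ℝ => c x.1 x.2.1 x.2.2)
    (hb : Continuous fun x : X × ℝ => b x.1 x.2)
    (h0 : ∀ a, ∀ s ∈ unitInterval, c a 0 s = p s)
    (h1 : ∀ a, ∀ s ∈ unitInterval, c a 1 s = b (f a) s)
    (hp0 : p 0 = F (pt f)) (hp1 : p 1 = G (pt f))
    (hc0 : ∀ a, ∀ t ∈ unitInterval, c a t 0 = F (cyl f a t))
    (hc1 : ∀ a, ∀ t ∈ unitInterval, c a t 1 = G (cyl f a t))
    (hb0 : ∀ x, b x 0 = F (base f x)) (hb1 : ∀ x, b x 1 = G (base f x)) : F.Homotopic G := by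
  refine Quot.homotopic (rel := MConeRel f) (Z := Z)
    (fun y s => Sum.elim (fun _ => p s) (Sum.elim (fun q => c q.1 q.2 s) (fun x => b x s)) y)
    ?_ ?_ ?_ ?_
  · rw [← (Homeomorph.sumProdDistrib (X := Unit) (Y := (A × unitInterval) ⊕ X)
      (Z := unitInterval)).symm.comp_continuous_iff']
    refine continuous_sum_dom.2 ⟨?_, ?_⟩
    · exact hp.comp (continuous_subtype_val.comp continuous_snd)
    · rw [← (Homeomorph.sumProdDistrib (X := A × unitInterval) (Y := X)
        (Z := unitInterval)).symm.comp_continuous_iff']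
      refine continuous_sum_dom.2 ⟨?_, ?_⟩
      · refine hc.comp (f := fun q : (A × unitInterval) × unitInterval =>
          (q.1.1, (q.1.2 : ℝ), (q.2 : ℝ))) (by fun_prop)
      · refine hb.comp (f := fun q : X × unitInterval => (q.1, (q.2 : ℝ))) (by fun_prop)
  · rintro _ _ (a | a) s
    · simpa using h0 a s s.2
    · simpa using h1 a s s.2
  · rintro (u | ⟨a, t⟩ | x)
    · exact hp0
    · refine (hc0 a t t.2).trans ?_; simp only [cyl, clamp_coe]; rfl
    · exact hb0 x
  · rintro (u | ⟨a, t⟩ | x)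
    · exact hp1
    · refine (hc1 a t t.2).trans ?_; simp only [cyl, clamp_coe]; rfl
    · exact hb1 x

theorem induction {f : A → X} {P : MCone f → Prop} (hp : P (pt f))
    (hc : ∀ a, ∀ t ∈ unitInterval, P (cyl f a t)) (hb : ∀ x, P (base f x)) (y : MCone f) : P y := by
  obtain ⟨u | ⟨a, t⟩ | x⟩ := y
  · exact hp
  · have := hc a t t.2
    rwa [cyl, clamp_coe] at this
  · exact hb x

end MCone

/-- Two spaces are homotopy equivalent. -/
def HEquiv (X Y : Type*) [TopologicalSpace X] [TopologicalSpace Y] : Prop :=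
  Nonempty (ContinuousMap.HomotopyEquiv X Y)

namespace HEquiv

variable {X Y Z : Type*} [TopologicalSpace X] [TopologicalSpace Y] [TopologicalSpace Z]

theorem symm : HEquiv X Y → HEquiv Y X := fun ⟨h⟩ => ⟨h.symm⟩
theorem trans : HEquiv X Y → HEquiv Y Z → HEquiv X Z := fun ⟨h⟩ ⟨k⟩ => ⟨h.trans k⟩
theorem of_homeo (h : X ≃ₜ Y) : HEquiv X Y := ⟨h.toHomotopyEquiv⟩

end HEquiv

/-- A continuous map admitting a homotopy inverse. -/
def IsHEquiv {X Y : Type*} [TopologicalSpace X] [TopologicalSpace Y] (f : C(X, Y)) : Prop :=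
  ∃ g : C(Y, X), (g.comp f).Homotopic (.id X) ∧ (f.comp g).Homotopic (.id Y)

namespace IsHEquiv

variable {X Y Z : Type*} [TopologicalSpace X] [TopologicalSpace Y] [TopologicalSpace Z]

theorem hEquiv {f : C(X, Y)} (h : IsHEquiv f) : HEquiv X Y :=
  let ⟨g, h1, h2⟩ := h; ⟨⟨f, g, h1, h2⟩⟩

theorem of_left_right {f : C(X, Y)} {l r : C(Y, X)} (hl : (l.comp f).Homotopic (.id X))
    (hr : (f.comp r).Homotopic (.id Y)) : IsHEquiv f := by
  refine ⟨l, hl, ?_⟩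
  have h1 : l.Homotopic r := by
    have a : ((l.comp f).comp r).Homotopic r := by
      simpa using hl.comp (.refl r)
    have b : (l.comp (f.comp r)).Homotopic l := by
      simpa using (ContinuousMap.Homotopic.refl l).comp hr
    exact b.symm.trans a
  exact ((ContinuousMap.Homotopic.refl f).comp h1).trans hr

theorem right_of_left {f : C(X, Y)} {c : C(Y, X)} (hc : IsHEquiv c)
    (h : (c.comp f).Homotopic (.id X)) : (f.comp c).Homotopic (.id Y) := by
  obtain ⟨d, h1, h2⟩ := hc
  have e : f.Homotopic d := by
    have a : ((d.comp c).comp f).Homotopic f := by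
      simpa using h1.comp (.refl f)
    have b : (d.comp (c.comp f)).Homotopic d := by
      simpa using (ContinuousMap.Homotopic.refl d).comp h
    exact a.symm.trans b
  exact (e.comp (.refl c)).trans h1

end IsHEquiv

namespace MCone

variable {A X Z : Type*} [TopologicalSpace A] [TopologicalSpace X] [TopologicalSpace Z]

section changeMap
variable {f g : C(A, X)} (F : f.Homotopy g)

/-- The path in the mapping cone of `g` running up the cylinder and then along the homotopy. -/
def ext (a : A) (s : ℝ) : MCone g :=
  if s ≤ 1 then cyl g a s else base g (F (clamp (2 - s), a))

theorem continuous_ext : Continuous fun p : A × ℝ => ext F p.1 p.2 := by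
  refine Continuous.if_le (continuous_cyl _) ?_ continuous_snd continuous_const ?_
  · exact (continuous_base _).comp (F.continuous.comp
      ((continuous_clamp.comp (by fun_prop)).prodMk continuous_fst))
  · rintro ⟨a, s⟩ (h : s = 1)
    subst h
    simp only
    rw [cyl_of_ge _ _ le_rfl, clamp_of_ge (by norm_num)]
    simp

theorem ext_of_le (a : A) {s : ℝ} (h : s ≤ 1) : ext F a s = cyl g a s := if_pos h
theorem ext_of_ge (a : A) {s : ℝ} (h : 1 ≤ s) :
    ext F a s = base g (F (clamp (2 - s), a)) := by
  rcases h.eq_or_lt with rfl | h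
  · rw [ext_of_le F a le_rfl, cyl_of_ge _ _ le_rfl, clamp_of_ge (by norm_num)]; simp
  · exact if_neg h.not_ge

theorem ext_of_le_zero (a : A) {s : ℝ} (h : s ≤ 0) : ext F a s = pt g := by
  rw [ext_of_le F a (h.trans zero_le_one), cyl_of_le _ _ h]
theorem ext_of_two_le (a : A) {s : ℝ} (h : 2 ≤ s) : ext F a s = base g (f a) := by
  rw [ext_of_ge F a (by linarith), clamp_of_le (by linarith)]; simp

/-- The map of mapping cones induced by a homotopy. -/
def changeMap : C(MCone f, MCone g) :=
  desc (pt g) (fun a t => ext F a (2 * t)) (base g)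
    ((continuous_ext F).comp (f := fun p : A × ℝ => (p.1, 2 * p.2)) (by fun_prop)) (continuous_base _)
    (fun a => by simpa using ext_of_le_zero F a le_rfl)
    (fun a => by simpa using ext_of_two_le F a le_rfl)

@[simp] theorem changeMap_pt : changeMap F (pt f) = pt g := rfl
@[simp] theorem changeMap_base (x : X) : changeMap F (base f x) = base g x := rfl
@[simp] theorem changeMap_cyl (a : A) (t : ℝ) : changeMap F (cyl f a t) = ext F a (2 * t) :=
  desc_cyl' (fun a t h => ext_of_le_zero F a (by linarith))
    (fun a t h => ext_of_two_le F a (by linarith)) a t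

theorem changeMap_symm_comp : ((changeMap F.symm).comp (changeMap F)).Homotopic (.id _) := by
  have key : ∀ a, ∀ t ∈ unitInterval, ((changeMap F.symm).comp (changeMap F)) (cyl f a t) =
      ext F.symm a (min (4 * t) (3 - 2 * t)) := by
    intro a t ht
    obtain ⟨ht0, ht1⟩ := ht
    simp only [ContinuousMap.comp_apply, changeMap_cyl]
    rcases le_total (2 * t) 1 with h | h
    · rw [ext_of_le F a h, changeMap_cyl, min_eq_left (by linarith)]
      congr 1; ring
    · rw [ext_of_ge F a h, min_eq_right (by linarith), changeMap_base]
      rw [ext_of_ge F.symm a (by linarith)]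
      rw [ContinuousMap.Homotopy.symm_apply]
      congr 3
      ext
      simp only [unitInterval.coe_symm_eq, coe_clamp]
      rw [min_eq_right, max_eq_right, min_eq_right, max_eq_right] <;> linarith
  refine homotopic (fun _ => pt f)
    (fun a t s => ext F.symm a ((1 - s) * min (4 * t) (3 - 2 * t) + s * t)) (fun x _ => base f x)
    continuous_const ?_ ?_ ?_ ?_ ?_ ?_ ?_ ?_ ?_ ?_
  · exact (continuous_ext F.symm).comp (f := fun p : A × ℝ × ℝ =>
      (p.1, ((1 - p.2.2) * min (4 * p.2.1) (3 - 2 * p.2.1) + p.2.2 * p.2.1))) (by fun_prop)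
  · exact (continuous_base f).comp continuous_fst
  · intro a s hs
    simpa using ext_of_le_zero F.symm a le_rfl
  · intro a s hs
    rw [show (1 - s) * min (4 * 1) (3 - 2 * 1) + s * 1 = 1 by norm_num, ext_of_le _ _ le_rfl,
      cyl_of_ge _ _ le_rfl]
  · rfl
  · rfl
  · intro a t ht
    rw [key a t ht]; simp
  · intro a t ht
    simpa using ext_of_le F.symm a ht.2
  · intro x; rfl
  · intro x; rfl

theorem isHEquiv_changeMap : IsHEquiv (changeMap F) :=
  ⟨changeMap F.symm, changeMap_symm_comp F, by
    simpa using changeMap_symm_comp F.symm⟩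
end changeMap

/-- Homotopic maps have homotopy equivalent mapping cones. -/
theorem hEquiv_of_homotopic {f f' : C(A, X)} : f.Homotopic f' → HEquiv (MCone f) (MCone f') :=
  fun ⟨F⟩ => (isHEquiv_changeMap F).hEquiv

section postcomp
variable {Y W : Type*} [TopologicalSpace Y] [TopologicalSpace W]

/-- The map of mapping cones induced by a map of the bases. -/
def postcomp (f : C(A, X)) (ξ : C(X, Y)) : C(MCone f, MCone (ξ.comp f)) :=
  desc (pt _) (fun a t => cyl _ a t) (fun x => base _ (ξ x)) (continuous_cyl _)
    ((continuous_base _).comp ξ.continuous) (fun _ => cyl_of_le _ _ le_rfl)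
    (fun _ => cyl_of_ge _ _ le_rfl)

variable (f : C(A, X)) (ξ : C(X, Y))
@[simp] theorem postcomp_pt : postcomp f ξ (pt f) = pt _ := rfl
@[simp] theorem postcomp_base (x : X) : postcomp f ξ (base f x) = base _ (ξ x) := rfl
@[simp] theorem postcomp_cyl (a : A) (t : ℝ) : postcomp f ξ (cyl f a t) = cyl _ a t := by
  rw [postcomp, desc_cyl']
  exacts [fun _ _ h => cyl_of_le _ _ h, fun _ _ h => cyl_of_ge _ _ h]

theorem postcomp_comp (η : C(Y, W)) :
    (postcomp (ξ.comp f) η).comp (postcomp f ξ) = postcomp f (η.comp ξ) := by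
  ext y
  induction y using MCone.induction with
  | hp => rfl
  | hc a t _ =>
    rw [ContinuousMap.comp_apply, postcomp_cyl, postcomp_cyl, postcomp_cyl]; rfl
  | hb x => rfl

variable {f}

/-- The homotopy between `ρ ∘ f` and `f` induced by a homotopy from `ρ` to the identity. -/
def whisker {ρ : C(X, X)} (G : ρ.Homotopy (.id X)) (f : C(A, X)) : (ρ.comp f).Homotopy f where
  toFun p := G (p.1, f p.2)
  map_zero_left := by simp
  map_one_left := by simp

theorem whisker_apply {ρ : C(X, X)} (G : ρ.Homotopy (.id X)) (p : unitInterval × A) :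
    whisker G f p = G (p.1, f p.2) := rfl

theorem changeMap_comp_postcomp {ρ : C(X, X)} (G : ρ.Homotopy (.id X)) :
    ((changeMap (whisker G f)).comp (postcomp f ρ)).Homotopic (.id _) := by
  refine homotopic (fun _ => pt f) (fun a t s => ext (whisker G f) a ((2 - s) * t))
    (fun x s => base f (G (clamp s, x))) continuous_const ?_ ?_ ?_ ?_ ?_ ?_ ?_ ?_ ?_ ?_
  · exact (continuous_ext (whisker G f)).comp (f := fun p : A × ℝ × ℝ =>
      (p.1, ((2 - p.2.2) * p.2.1))) (by fun_prop)
  · exact (continuous_base f).comp (G.continuous.comp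
      ((continuous_clamp.comp continuous_snd).prodMk continuous_fst))
  · intro a s hs
    simpa using ext_of_le_zero (whisker G f) a le_rfl
  · intro a s hs
    rw [ext_of_ge _ _ (by linarith [hs.2]), whisker_apply]
    simp
  · rfl
  · rfl
  · intro a t ht
    rw [ContinuousMap.comp_apply, postcomp_cyl, changeMap_cyl, sub_zero]
  · intro a t ht
    rw [ext_of_le _ _ (by linarith [ht.2])]
    simp; ring_nf
  · intro x
    rw [ContinuousMap.comp_apply, postcomp_base, changeMap_base, clamp_of_le le_rfl,
      ContinuousMap.Homotopy.apply_zero]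
  · intro x; simp

theorem postcomp_left {ρ : C(X, X)} (h : ρ.Homotopic (.id X)) :
    ∃ c : C(MCone (ρ.comp f), MCone f), (c.comp (postcomp f ρ)).Homotopic (.id _) ∧
      ((postcomp f ρ).comp c).Homotopic (.id _) := by
  obtain ⟨G⟩ := h
  exact ⟨_, changeMap_comp_postcomp G,
    IsHEquiv.right_of_left (isHEquiv_changeMap _) (changeMap_comp_postcomp G)⟩

/-- Homotopy equivalences of the base induce homotopy equivalences of mapping cones. -/
theorem hEquiv_postcomp (f : C(A, X)) (e : ContinuousMap.HomotopyEquiv X Y) :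
    HEquiv (MCone f) (MCone (e.toFun.comp f)) := by
  set ξ := e.toFun
  set η := e.invFun
  obtain ⟨c, -, hc⟩ := postcomp_left (f := f) e.left_inv
  obtain ⟨d, hd, -⟩ := postcomp_left (f := ξ.comp f) e.right_inv
  have h : IsHEquiv (postcomp (ξ.comp f) η) := by
    refine IsHEquiv.of_left_right (l := d.comp (postcomp (η.comp (ξ.comp f)) ξ))
      (r := (postcomp f ξ).comp c) ?_ ?_
    · rw [ContinuousMap.comp_assoc, postcomp_comp]
      exact hd
    · have := postcomp_comp f ξ η
      change (((postcomp (ξ.comp f) η).comp (postcomp f ξ)).comp c).Homotopic _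
      rw [this]
      exact hc
  refine (h.hEquiv.trans ?_).symm
  refine hEquiv_of_homotopic ?_
  have := e.left_inv.comp (.refl f)
  rwa [ContinuousMap.comp_assoc] at this
end postcomp

section const
variable {B : Type*} [TopologicalSpace B]

/-- The map of mapping cones of constant maps induced by a map of the sources. -/
def precomp (x : X) (g : C(A, B)) :
    C(MCone (ContinuousMap.const A x), MCone (ContinuousMap.const B x)) :=
  desc (pt _) (fun a t => cyl _ (g a) t) (fun x => base _ x)
    ((continuous_cyl _).comp (f := fun p : A × ℝ => (g p.1, p.2)) (by fun_prop))
    (continuous_base _) (fun _ => cyl_of_le _ _ le_rfl)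
    (fun _ => by rw [cyl_of_ge _ _ le_rfl]; rfl)

variable (x : X) (g : C(A, B))
@[simp] theorem precomp_pt : precomp x g (pt _) = pt _ := rfl
@[simp] theorem precomp_base (y : X) : precomp x g (base _ y) = base _ y := rfl
@[simp] theorem precomp_cyl (a : A) (t : ℝ) : precomp x g (cyl _ a t) = cyl _ (g a) t := by
  rw [precomp, desc_cyl']
  exacts [fun _ _ h => cyl_of_le _ _ h, fun _ _ h => cyl_of_ge _ _ h]

theorem precomp_homotopic {g : C(A, B)} {g' : C(B, A)} (h : (g'.comp g).Homotopic (.id A)) :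
    ((precomp x g').comp (precomp x g)).Homotopic (.id _) := by
  obtain ⟨H⟩ := h
  refine homotopic (fun _ => pt _) (fun a t s => cyl _ (H (clamp s, a)) t)
    (fun x s => base _ x) continuous_const ?_ ?_ ?_ ?_ ?_ ?_ ?_ ?_ ?_ ?_
  · refine (continuous_cyl _).comp (f := fun p : A × ℝ × ℝ =>
      ((H (clamp p.2.2, p.1)), p.2.1)) ?_
    refine (H.continuous.comp ((continuous_clamp.comp ?_).prodMk continuous_fst)).prodMk ?_
    · fun_prop
    · fun_prop
  · exact (continuous_base _).comp continuous_fst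
  · intro a s hs; exact cyl_of_le _ _ le_rfl
  · intro a s hs; rw [cyl_of_ge _ _ le_rfl]; rfl
  · rfl
  · rfl
  · intro a t ht
    rw [ContinuousMap.comp_apply, precomp_cyl, precomp_cyl, clamp_of_le le_rfl,
      ContinuousMap.Homotopy.apply_zero]; rfl
  · intro a t ht
    rw [clamp_of_ge le_rfl, ContinuousMap.Homotopy.apply_one]; rfl
  · intro x; rfl
  · intro x; rfl

theorem hEquiv_precomp (e : ContinuousMap.HomotopyEquiv A B) :
    HEquiv (MCone (ContinuousMap.const A x)) (MCone (ContinuousMap.const B x)) :=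
  IsHEquiv.hEquiv (f := precomp x e.toFun)
    ⟨precomp x e.invFun, precomp_homotopic x e.left_inv, precomp_homotopic x e.right_inv⟩
end const

end MCone

open MCone (clamp clamp_of_le clamp_of_ge clamp_coe coe_clamp continuous_clamp)

/-- The relation collapsing the boundaries of the cubes `ι × [0,1]^d` to a basepoint. -/
inductive CubeWedgeRel (d : ℕ) (ι : Type*) :
    Unit ⊕ (Σ _ : ι, Fin d → unitInterval) → Unit ⊕ (Σ _ : ι, Fin d → unitInterval) → Prop
  | bdry (j : ι) (z : Fin d → unitInterval) (h : ∃ i, z i = 0 ∨ z i = 1) :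
      CubeWedgeRel d ι (Sum.inr ⟨j, z⟩) (Sum.inl ())

/-- The wedge of `ι` spheres of dimension `d`, as a quotient of a disjoint union of cubes. -/
def CubeWedge (d : ℕ) (ι : Type*) : Type _ := Quot (CubeWedgeRel d ι)

namespace CubeWedge

variable {d : ℕ} {ι Z T : Type*} [TopologicalSpace Z] [TopologicalSpace T]

instance : TopologicalSpace (CubeWedge d ι) :=
  inferInstanceAs (TopologicalSpace (Quot (CubeWedgeRel d ι)))

instance [Finite ι] : CompactSpace (CubeWedge d ι) :=
  inferInstanceAs (CompactSpace (Quot (CubeWedgeRel d ι)))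

/-- The basepoint of the wedge. -/
def base (d : ℕ) (ι : Type*) : CubeWedge d ι := Quot.mk _ (Sum.inl ())

/-- The point of the `j`-th cube with given (clamped) coordinates. -/
def cell (j : ι) (z : Fin d → ℝ) : CubeWedge d ι :=
  Quot.mk _ (Sum.inr ⟨j, fun i => clamp (z i)⟩)

instance : Inhabited (CubeWedge d ι) := ⟨base d ι⟩

theorem cell_of_not_mem (j : ι) {z : Fin d → ℝ} (h : ∃ i, z i ≤ 0 ∨ 1 ≤ z i) :
    cell j z = base d ι := by
  refine Quot.sound (.bdry _ _ ?_)
  obtain ⟨i, h | h⟩ := h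
  · exact ⟨i, .inl (clamp_of_le h)⟩
  · exact ⟨i, .inr (clamp_of_ge h)⟩

theorem continuous_cell (j : ι) : Continuous (cell j : (Fin d → ℝ) → CubeWedge d ι) :=
  continuous_quot_mk.comp (continuous_inr.comp (continuous_sigmaMk.comp
    (continuous_pi fun i => continuous_clamp.comp (continuous_apply i))))

theorem induction {P : CubeWedge d ι → Prop} (hb : P (base d ι))
    (hc : ∀ j, ∀ z : Fin d → ℝ, (∀ i, z i ∈ unitInterval) → P (cell j z)) (y) : P y := by
  obtain ⟨u | ⟨j, z⟩⟩ := y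
  · exact hb
  · have := hc j (fun i => z i) (fun i => (z i).2)
    simpa only [cell, clamp_coe] using this

/-- Maps out of a wedge of spheres. -/
def desc (b : Z) (c : ι → (Fin d → ℝ) → Z) (hc : ∀ j, Continuous (c j))
    (h : ∀ j z, (∀ i, z i ∈ unitInterval) → (∃ i, z i = 0 ∨ z i = 1) → c j z = b) :
    C(CubeWedge d ι, Z) where
  toFun := Quot.lift (Sum.elim (fun _ => b) (fun q => c q.1 fun i => q.2 i)) (by
    rintro _ _ ⟨j, z, hz⟩
    simp only [Sum.elim_inr, Sum.elim_inl]
    refine h j _ (fun i => (z i).2) ?_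
    obtain ⟨i, hi | hi⟩ := hz
    · exact ⟨i, .inl (by rw [hi]; rfl)⟩
    · exact ⟨i, .inr (by rw [hi]; rfl)⟩)
  continuous_toFun := continuous_quot_lift _ (continuous_const.sumElim
    (continuous_sigma fun j => (hc j).comp
      (continuous_pi fun i => continuous_subtype_val.comp (continuous_apply i))))

section desc
variable {b : Z} {c : ι → (Fin d → ℝ) → Z} {hc : ∀ j, Continuous (c j)}
    {h : ∀ j z, (∀ i, z i ∈ unitInterval) → (∃ i, z i = 0 ∨ z i = 1) → c j z = b}

@[simp] theorem desc_base : desc b c hc h (base d ι) = b := rfl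
theorem desc_cell_clamp (j : ι) (z : Fin d → ℝ) :
    desc b c hc h (cell j z) = c j fun i => clamp (z i) := rfl
theorem desc_cell (j : ι) {z : Fin d → ℝ} (hz : ∀ i, z i ∈ unitInterval) :
    desc b c hc h (cell j z) = c j z := by
  rw [desc_cell_clamp]
  congr 1; ext i
  rw [coe_clamp, min_eq_right (hz i).2, max_eq_right (hz i).1]
theorem desc_cell' (h' : ∀ j z, (∃ i, z i ≤ 0 ∨ 1 ≤ z i) → c j z = b) (j : ι) (z : Fin d → ℝ) :
    desc b c hc h (cell j z) = c j z := by
  by_cases hz : ∃ i, z i ≤ 0 ∨ 1 ≤ z i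
  · rw [cell_of_not_mem j hz, h' j z hz]; rfl
  · push Not at hz
    exact desc_cell j fun i => ⟨(hz i).1.le, (hz i).2.le⟩
end desc

/-- Families of maps out of a wedge of spheres, parametrized by a locally compact space. -/
theorem exists_desc₂ [LocallyCompactSpace T] (b : T → Z) (c : ι → (Fin d → ℝ) → T → Z)
    (hb : Continuous b) (hc : ∀ j, Continuous fun p : (Fin d → ℝ) × T => c j p.1 p.2)
    (h : ∀ j z, (∀ i, z i ∈ unitInterval) → (∃ i, z i = 0 ∨ z i = 1) → ∀ s, c j z s = b s) :
    ∃ g : CubeWedge d ι → T → Z, (Continuous fun p : CubeWedge d ι × T => g p.1 p.2) ∧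
      (∀ s, g (base d ι) s = b s) ∧
      (∀ j z s, (∀ i, z i ∈ unitInterval) → g (cell j z) s = c j z s) := by
  let C : ι → C(Fin d → ℝ, C(T, Z)) := fun j => ContinuousMap.curry ⟨_, hc j⟩
  let D : C(CubeWedge d ι, C(T, Z)) := desc ⟨b, hb⟩ (fun j => C j) (fun j => (C j).continuous)
    (fun j z hz hz' => by ext s; exact h j z hz hz' s)
  refine ⟨fun y s => D y s, ContinuousMap.continuous_uncurry_of_continuous D, fun s => rfl, ?_⟩
  intro j z s hz
  simp only [D]
  rw [desc_cell j hz]; rfl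

/-- Homotopies between maps out of a wedge of spheres. -/
theorem homotopic {F G : C(CubeWedge d ι, Z)} (b : ℝ → Z) (c : ι → (Fin d → ℝ) → ℝ → Z)
    (hb : Continuous b) (hc : ∀ j, Continuous fun p : (Fin d → ℝ) × ℝ => c j p.1 p.2)
    (h : ∀ j z, (∀ i, z i ∈ unitInterval) → (∃ i, z i = 0 ∨ z i = 1) →
      ∀ s ∈ unitInterval, c j z s = b s)
    (hb0 : b 0 = F (base d ι)) (hb1 : b 1 = G (base d ι))
    (hc0 : ∀ j z, (∀ i, z i ∈ unitInterval) → c j z 0 = F (cell j z))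
    (hc1 : ∀ j z, (∀ i, z i ∈ unitInterval) → c j z 1 = G (cell j z)) : F.Homotopic G := by
  obtain ⟨g, hg, hgb, hgc⟩ := exists_desc₂ (T := unitInterval) (fun s => b s) (fun j z s => c j z s)
    (by fun_prop) (fun j => (hc j).comp (f := fun p : (Fin d → ℝ) × unitInterval =>
      (p.1, (p.2 : ℝ))) (by fun_prop)) (fun j z hz hz' s => h j z hz hz' s s.2)
  refine ⟨⟨⟨fun p => g p.2 p.1, hg.comp continuous_swap⟩, ?_, ?_⟩⟩
  · intro y
    induction y using CubeWedge.induction with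
    | hb => exact (hgb 0).trans hb0
    | hc j z hz => exact (hgc j z 0 hz).trans (hc0 j z hz)
  · intro y
    induction y using CubeWedge.induction with
    | hb => exact (hgb 1).trans hb1
    | hc j z hz => exact (hgc j z 1 hz).trans (hc1 j z hz)

/-- Relabelling and including wedge summands. -/
def map {κ : Type*} (f : ι → κ) : C(CubeWedge d ι, CubeWedge d κ) :=
  desc (base d κ) (fun j z => cell (f j) z) (fun _ => continuous_cell _)
    (fun _ _ _ h => cell_of_not_mem _ (h.imp fun _ h => h.imp le_of_eq ge_of_eq))

@[simp] theorem map_base {κ : Type*} (f : ι → κ) : map f (base d ι) = base d κ := rfl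
@[simp] theorem map_cell {κ : Type*} (f : ι → κ) (j : ι) (z : Fin d → ℝ) :
    map f (cell j z) = cell (f j) z := by
  rw [map, desc_cell']
  exact fun _ _ h => cell_of_not_mem _ h

/-- Wedges of spheres indexed by equivalent types are homeomorphic. -/
def congr {κ : Type*} (e : ι ≃ κ) : CubeWedge d ι ≃ₜ CubeWedge d κ where
  toFun := map e
  invFun := map e.symm
  left_inv y := by
    induction y using CubeWedge.induction <;> simp
  right_inv y := by
    induction y using CubeWedge.induction <;> simp
  continuous_toFun := (map e).continuous
  continuous_invFun := (map e.symm).continuous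

end CubeWedge

namespace CubeWedge

variable {d : ℕ} {ι κ : Type*}

/-- Sup-norm distance to the centre of the unit cube, normalised to be `1` on its boundary. -/
def cubeNorm {n : ℕ} (z : Fin n → ℝ) : ℝ := ‖fun i => 2 * z i - 1‖

/-- Dilation by the factor `l` about the centre of the unit cube. -/
def dilate {n : ℕ} (l : ℝ) (z : Fin n → ℝ) : Fin n → ℝ := fun i => 1 / 2 + l * (z i - 1 / 2)

theorem continuous_cubeNorm {n : ℕ} : Continuous (cubeNorm : (Fin n → ℝ) → ℝ) := by
  unfold cubeNorm; fun_prop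

theorem le_cubeNorm {n : ℕ} (z : Fin n → ℝ) (i : Fin n) : |2 * z i - 1| ≤ cubeNorm z :=
  norm_le_pi_norm (fun i => 2 * z i - 1) i

theorem cubeNorm_le_one {n : ℕ} {z : Fin n → ℝ} : cubeNorm z ≤ 1 ↔ ∀ i, z i ∈ unitInterval := by
  rw [cubeNorm, pi_norm_le_iff_of_nonneg zero_le_one]
  refine forall_congr' fun i => ?_
  rw [Real.norm_eq_abs, abs_le, unitInterval, Set.mem_Icc]
  constructor <;> rintro ⟨h1, h2⟩ <;> constructor <;> linarith

theorem one_le_cubeNorm_of {n : ℕ} {z : Fin n → ℝ} {i : Fin n} (h : z i ≤ 0 ∨ 1 ≤ z i) :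
    1 ≤ cubeNorm z := by
  refine le_trans ?_ (le_cubeNorm z i)
  rw [le_abs]
  rcases h with h | h
  · right; linarith
  · left; linarith

theorem exists_of_one_le_cubeNorm {n : ℕ} {z : Fin n → ℝ} (h : 1 ≤ cubeNorm z) :
    ∃ i, z i ≤ 0 ∨ 1 ≤ z i := by
  by_contra! hc
  refine h.not_gt ?_
  rw [cubeNorm, pi_norm_lt_iff zero_lt_one]
  intro i
  rw [Real.norm_eq_abs, abs_lt]
  constructor <;> linarith [(hc i).1, (hc i).2]

theorem cubeNorm_dilate {n : ℕ} {l : ℝ} (hl : 0 ≤ l) (z : Fin n → ℝ) :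
    cubeNorm (dilate l z) = l * cubeNorm z := by
  rw [cubeNorm, cubeNorm, ← Real.norm_of_nonneg hl, ← norm_smul]
  congr 1; ext i
  simp only [dilate, Pi.smul_apply, smul_eq_mul, Real.norm_of_nonneg hl]; ring

@[simp] theorem dilate_one {n : ℕ} (z : Fin n → ℝ) : dilate 1 z = z := by
  ext i; simp [dilate]

theorem cell_eq_base {n : ℕ} (j : ι) {z : Fin n → ℝ} (h : 1 ≤ cubeNorm z) :
    cell j z = base n ι := cell_of_not_mem j (exists_of_one_le_cubeNorm h)

section suspension

/-- The constant map from one wedge of spheres to the basepoint of another. -/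
abbrev cb (d : ℕ) (ι κ : Type*) : C(CubeWedge d κ, CubeWedge (d + 1) ι) :=
  ContinuousMap.const (CubeWedge d κ) (base (d + 1) ι)

/-- The cell of the suspension of a cell, extended to the whole space by collapsing. -/
def sCell (ι : Type*) (j : κ) (y : Fin (d + 1) → ℝ) : MCone (cb d ι κ) :=
  if cubeNorm y ≤ 1 then MCone.cyl _ (cell j (Fin.tail y)) (y 0)
  else MCone.cyl _ (base d κ) (max (y 0) (cubeNorm y - 1))

theorem sCell_of_le (j : κ) {y : Fin (d + 1) → ℝ} (h : cubeNorm y ≤ 1) :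
    sCell ι j y = MCone.cyl _ (cell j (Fin.tail y)) (y 0) := if_pos h

theorem sCell_aux (j : κ) {y : Fin (d + 1) → ℝ} (h : cubeNorm y = 1) :
    MCone.cyl (cb d ι κ) (cell j (Fin.tail y)) (y 0) =
      MCone.cyl (cb d ι κ) (base d κ) (max (y 0) (cubeNorm y - 1)) := by
  rw [h, sub_self]
  obtain ⟨i, hi⟩ := exists_of_one_le_cubeNorm h.ge
  have h0 := cubeNorm_le_one.1 h.le 0
  rw [max_eq_left h0.1]
  induction i using Fin.cases with
  | zero =>
    rcases hi with hi | hi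
    · rw [MCone.cyl_of_le _ _ hi, MCone.cyl_of_le _ _ hi]
    · rw [MCone.cyl_of_ge _ _ hi, MCone.cyl_of_ge _ _ hi]; rfl
  | succ i => rw [cell_of_not_mem j ⟨i, hi⟩]

theorem sCell_of_ge (j : κ) {y : Fin (d + 1) → ℝ} (h : 1 ≤ cubeNorm y) :
    sCell ι j y = MCone.cyl _ (base d κ) (max (y 0) (cubeNorm y - 1)) := by
  rcases h.eq_or_lt with h | h
  · rw [sCell_of_le j h.ge, sCell_aux j h.symm]
  · exact if_neg h.not_ge

theorem continuous_sCell (j : κ) : Continuous (sCell ι j : (Fin (d + 1) → ℝ) → _) := by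
  refine Continuous.if_le ?_ ?_ continuous_cubeNorm continuous_const fun y => sCell_aux j
  · exact (MCone.continuous_cyl _).comp (((continuous_cell j).comp
      (continuous_pi fun i => continuous_apply _)).prodMk (continuous_apply _))
  · exact (MCone.continuous_cyl _).comp (continuous_const.prodMk
      ((continuous_apply _).max (continuous_cubeNorm.sub continuous_const)))

theorem mem_unitInterval_cons {t : ℝ} {z : Fin d → ℝ} (ht : t ∈ unitInterval)
    (hz : ∀ i, z i ∈ unitInterval) (i : Fin (d + 1)) :
    (Fin.cons t z : Fin (d + 1) → ℝ) i ∈ unitInterval := by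
  induction i using Fin.cases with
  | zero => simpa using ht
  | succ i => simpa using hz i

theorem continuous_cons : Continuous fun p : (Fin d → ℝ) × ℝ =>
    (Fin.cons p.2 p.1 : Fin (d + 1) → ℝ) := by
  refine continuous_pi fun i => ?_
  induction i using Fin.cases with
  | zero => simpa using continuous_snd
  | succ i => simp only [Fin.cons_succ]; fun_prop

theorem exists_fromMCone : ∃ p : C(MCone (cb d ι κ), CubeWedge (d + 1) (ι ⊕ κ)),
    p (MCone.pt _) = base _ _ ∧ (∀ y, p (MCone.base _ y) = map Sum.inl y) ∧
    (∀ j z t, t ∈ unitInterval → (∀ i, z i ∈ unitInterval) →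
      p (MCone.cyl _ (cell j z) t) = cell (Sum.inr j) (Fin.cons t z : Fin (d + 1) → ℝ)) ∧
    (∀ t ∈ unitInterval, p (MCone.cyl _ (base d κ) t) = base _ _) := by
  obtain ⟨g, hg, hgb, hgc⟩ := exists_desc₂ (d := d) (ι := κ) (T := ℝ)
    (fun _ => base (d + 1) (ι ⊕ κ))
    (fun j z t => cell (Sum.inr j) (Fin.cons t z : Fin (d + 1) → ℝ)) continuous_const
    (fun j => (continuous_cell _).comp continuous_cons)
    (fun j z hz ⟨i, hi⟩ s => cell_of_not_mem _ ⟨i.succ, by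
      simpa using hi.imp le_of_eq ge_of_eq⟩)
  refine ⟨MCone.desc (base _ _) g (map Sum.inl) hg (map Sum.inl).continuous ?_ ?_, rfl,
    fun _ => rfl, ?_, ?_⟩
  · intro y
    induction y using CubeWedge.induction with
    | hb => exact hgb 0
    | hc j z hz => rw [hgc j z 0 hz, cell_of_not_mem _ ⟨0, by simp⟩]
  · intro y
    induction y using CubeWedge.induction with
    | hb => exact hgb 1
    | hc j z hz => rw [hgc j z 1 hz, cell_of_not_mem _ ⟨0, by simp⟩]; rfl
  · intro j z t ht hz
    rw [MCone.desc_cyl _ ht.1 ht.2, hgc j z t hz]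
  · intro t ht
    rw [MCone.desc_cyl _ ht.1 ht.2, hgb]

theorem exists_toMCone : ∃ q : C(CubeWedge (d + 1) (ι ⊕ κ), MCone (cb d ι κ)),
    q (base _ _) = MCone.base _ (base _ _) ∧ (∀ y, q (map Sum.inl y) = MCone.base _ y) ∧
    (∀ j z, (∀ i, z i ∈ unitInterval) → q (cell (Sum.inr j) z) = sCell ι j (dilate 2 z)) := by
  refine ⟨desc (MCone.base _ (base _ _))
    (fun j z => Sum.elim (fun j => MCone.base _ (cell j z)) (fun j => sCell ι j (dilate 2 z)) j)
    ?_ ?_, rfl, ?_, ?_⟩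
  · rintro (j | j)
    · exact (MCone.continuous_base _).comp (continuous_cell j)
    · exact (continuous_sCell j).comp (by unfold dilate; fun_prop)
  · rintro (j | j) z hz ⟨i, hi⟩
    · simp only [Sum.elim_inl]
      rw [cell_of_not_mem j ⟨i, hi.imp le_of_eq ge_of_eq⟩]
    · simp only [Sum.elim_inr]
      have h2 : 2 ≤ cubeNorm (dilate 2 z) := by
        rw [cubeNorm_dilate zero_le_two]
        linarith [one_le_cubeNorm_of (hi.imp le_of_eq ge_of_eq)]
      rw [sCell_of_ge j (by linarith), MCone.cyl_of_ge]
      · rfl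
      · exact le_max_of_le_right (by linarith)
  · intro y
    induction y using CubeWedge.induction with
    | hb => rfl
    | hc j z hz => rw [map_cell, desc_cell _ hz]; rfl
  · intro j z hz
    rw [desc_cell _ hz]; rfl

theorem continuous_dilate {n : ℕ} : Continuous fun p : (Fin n → ℝ) × ℝ => dilate p.2 p.1 := by
  unfold dilate; fun_prop

/-- The mapping cone of the constant map between wedges of spheres is a wedge of spheres. -/
theorem hEquiv_mcone_const : HEquiv (MCone (cb d ι κ)) (CubeWedge (d + 1) (ι ⊕ κ)) := by
  obtain ⟨p, pp, pb, pc, pc'⟩ := exists_fromMCone (d := d) (ι := ι) (κ := κ)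
  obtain ⟨q, qb, ql, qr⟩ := exists_toMCone (d := d) (ι := ι) (κ := κ)
  have hρ : ∀ (t : ℝ) (z : Fin d → ℝ), t ∈ unitInterval → (∀ i, z i ∈ unitInterval) →
      (∃ i, z i = 0 ∨ z i = 1) → cubeNorm (Fin.cons t z : Fin (d + 1) → ℝ) = 1 := by
    rintro t z ht hz ⟨i, hi⟩
    refine le_antisymm (cubeNorm_le_one.2 (mem_unitInterval_cons ht hz)) ?_
    exact one_le_cubeNorm_of (i := i.succ) (by simpa using hi.imp le_of_eq ge_of_eq)
  obtain ⟨g, hg, hgb, hgc⟩ := exists_desc₂ (d := d) (ι := κ) (T := ℝ × unitInterval)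
    (Z := MCone (cb d ι κ))
    (fun s => MCone.cyl _ (base d κ) (max (1 / 2 + (2 - s.2) * (clamp s.1 - 1 / 2)) (1 - s.2)))
    (fun j z s => sCell ι j (dilate (2 - s.2) (Fin.cons (clamp s.1 : ℝ) z : Fin (d + 1) → ℝ)))
    ((MCone.continuous_cyl _).comp (continuous_const.prodMk (by fun_prop)))
    (fun j => (continuous_sCell j).comp (continuous_dilate.comp
      (Continuous.prodMk (continuous_cons.comp (f := fun p : (Fin d → ℝ) × ℝ × unitInterval =>
        (p.1, (clamp p.2.1 : ℝ))) (by fun_prop)) (by fun_prop))))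
    (by
      rintro j z hz hz' ⟨t, s⟩
      have h1 : cubeNorm (dilate (2 - (s : ℝ)) (Fin.cons (clamp t : ℝ) z : Fin (d + 1) → ℝ)) =
          2 - s := by
        rw [cubeNorm_dilate (by linarith [s.2.2]), hρ _ z (clamp t).2 hz hz', mul_one]
      simp only
      rw [sCell_of_ge j (by rw [h1]; linarith [s.2.2]), h1]
      congr 1
      simp only [dilate, Fin.cons_zero]
      congr 1; ring)
  refine ⟨⟨p, q, ?_, ?_⟩⟩
  · refine MCone.homotopic (fun s => MCone.cyl _ (base d κ) (1 - clamp s))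
      (fun y t s => g y (t, clamp s)) (fun y _ => MCone.base _ y) ?_ ?_ ?_ ?_ ?_ ?_ ?_ ?_ ?_ ?_ ?_
    · exact (MCone.continuous_cyl _).comp (continuous_const.prodMk (by fun_prop))
    · refine hg.comp (f := fun x : CubeWedge d κ × ℝ × ℝ => (x.1, (x.2.1, clamp x.2.2))) ?_
      exact continuous_fst.prodMk (Continuous.prodMk (by fun_prop)
        (continuous_clamp.comp (by fun_prop)))
    · exact (MCone.continuous_base _).comp continuous_fst
    · intro y s hs
      have hcs : ((clamp s : unitInterval) : ℝ) = s := by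
        rw [coe_clamp, min_eq_right hs.2, max_eq_right hs.1]
      induction y using CubeWedge.induction with
      | hb =>
        rw [hgb]
        simp only [clamp_of_le le_rfl, hcs, Set.Icc.coe_zero]
        rw [max_eq_right (by linarith [hs.2])]
      | hc j z hz =>
        rw [hgc j z _ hz]
        simp only [clamp_of_le le_rfl, hcs, Set.Icc.coe_zero]
        have h1 : cubeNorm (dilate (2 - s) (Fin.cons 0 z : Fin (d + 1) → ℝ)) = 2 - s := by
          rw [cubeNorm_dilate (by linarith [hs.2]), le_antisymm
            (cubeNorm_le_one.2 (mem_unitInterval_cons ⟨le_rfl, zero_le_one⟩ hz))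
            (one_le_cubeNorm_of (i := 0) (by simp)), mul_one]
        rw [sCell_of_ge j (by linarith [hs.2]), h1]
        congr 1
        simp only [dilate, Fin.cons_zero]
        rw [max_eq_right (by linarith [hs.2])]; ring
    · intro y s hs
      have hcs : ((clamp s : unitInterval) : ℝ) = s := by
        rw [coe_clamp, min_eq_right hs.2, max_eq_right hs.1]
      induction y using CubeWedge.induction with
      | hb =>
        rw [hgb]
        simp only [clamp_of_ge le_rfl, hcs, Set.Icc.coe_one]
        rw [MCone.cyl_of_ge _ _ (le_max_of_le_left (by linarith [hs.2]))]
      | hc j z hz =>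
        rw [hgc j z _ hz]
        simp only [clamp_of_ge le_rfl, hcs, Set.Icc.coe_one]
        have h1 : cubeNorm (dilate (2 - s) (Fin.cons 1 z : Fin (d + 1) → ℝ)) = 2 - s := by
          rw [cubeNorm_dilate (by linarith [hs.2]), le_antisymm
            (cubeNorm_le_one.2 (mem_unitInterval_cons ⟨zero_le_one, le_rfl⟩ hz))
            (one_le_cubeNorm_of (i := 0) (by simp)), mul_one]
        rw [sCell_of_ge j (by linarith [hs.2]), h1, MCone.cyl_of_ge]
        · rfl
        refine le_max_of_le_left ?_
        simp only [dilate, Fin.cons_zero]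
        linarith [hs.2]
    · rw [ContinuousMap.comp_apply, pp, qb, clamp_of_le le_rfl, MCone.cyl_of_ge _ _ (by simp)]; try rfl
    · rw [clamp_of_ge le_rfl, MCone.cyl_of_le _ _ (by simp)]; rfl
    · intro y t ht
      have hct : ((clamp t : unitInterval) : ℝ) = t := by
        rw [coe_clamp, min_eq_right ht.2, max_eq_right ht.1]
      induction y using CubeWedge.induction with
      | hb =>
        rw [hgb, ContinuousMap.comp_apply, pc' t ht, qb]
        rw [MCone.cyl_of_ge _ _ (le_max_of_le_right (by simp))]; rfl
      | hc j z hz =>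
        rw [hgc j z _ hz, ContinuousMap.comp_apply, pc j z t ht hz,
          qr j _ (mem_unitInterval_cons ht hz)]
        simp only [clamp_of_le le_rfl, hct, Set.Icc.coe_zero, sub_zero]
    · intro y t ht
      have hct : ((clamp t : unitInterval) : ℝ) = t := by
        rw [coe_clamp, min_eq_right ht.2, max_eq_right ht.1]
      induction y using CubeWedge.induction with
      | hb =>
        rw [hgb]
        simp only [clamp_of_ge le_rfl, hct, Set.Icc.coe_one, ContinuousMap.id_apply]
        congr 1
        rw [max_eq_left (by linarith [ht.1])]; ring
      | hc j z hz =>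
        rw [hgc j z _ hz]
        simp only [clamp_of_ge le_rfl, hct, Set.Icc.coe_one, ContinuousMap.id_apply]
        rw [show (2 - 1 : ℝ) = 1 by norm_num, dilate_one,
          sCell_of_le j (cubeNorm_le_one.2 (mem_unitInterval_cons ht hz))]
        simp
    · intro y
      rw [ContinuousMap.comp_apply, pb, ql]
    · intro y; rfl
  · refine CubeWedge.homotopic (fun _ => base _ _)
      (fun j z s => Sum.elim (fun j => cell (Sum.inl j) z)
        (fun j => cell (Sum.inr j) (dilate (2 - s) z)) j) continuous_const ?_ ?_ ?_ ?_ ?_ ?_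
    · rintro (j | j)
      · exact (continuous_cell _).comp continuous_fst
      · exact (continuous_cell _).comp (continuous_dilate.comp
          (f := fun p : (Fin (d + 1) → ℝ) × ℝ => (p.1, 2 - p.2)) (by fun_prop))
    · rintro (j | j) z hz ⟨i, hi⟩ s hs
      · exact cell_of_not_mem _ ⟨i, hi.imp le_of_eq ge_of_eq⟩
      · refine cell_eq_base _ ?_
        rw [cubeNorm_dilate (by linarith [hs.2])]
        nlinarith [one_le_cubeNorm_of (hi.imp le_of_eq ge_of_eq), hs.2]
    · rw [ContinuousMap.comp_apply, qb, pb]; rfl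
    · rfl
    · rintro (j | j) z hz
      · rw [ContinuousMap.comp_apply, ← map_cell, ql, pb]; simp
      · rw [ContinuousMap.comp_apply, qr j z hz]
        simp only [Sum.elim_inr, sub_zero]
        rcases le_total (cubeNorm (dilate 2 z)) 1 with h | h
        · rw [sCell_of_le j h]
          have hz' := cubeNorm_le_one.1 h
          rw [pc j (Fin.tail (dilate 2 z)) _ (hz' 0) (fun i => hz' i.succ), Fin.cons_self_tail]
        · rw [cell_eq_base _ h, sCell_of_ge j h]
          rcases le_total 1 (max (dilate 2 z 0) (cubeNorm (dilate 2 z) - 1)) with h1 | h1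
          · rw [MCone.cyl_of_ge _ _ h1, pb]; rfl
          · rw [pc' _ ⟨le_max_of_le_right (by linarith), h1⟩]
    · rintro (j | j) z hz
      · rfl
      · simp only [Sum.elim_inr]
        rw [show (2 - 1 : ℝ) = 1 by norm_num, dilate_one]; rfl

end suspension

/-- The mapping cone of a map from an empty space just adds an isolated point. -/
theorem hEquiv_mcone_empty {A X : Type*} [TopologicalSpace A] [TopologicalSpace X] [IsEmpty A]
    (f : C(A, X)) (h : HEquiv X (CubeWedge 0 ι)) :
    HEquiv (MCone f) (CubeWedge 0 (ι ⊕ Unit)) := by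
  obtain ⟨e⟩ := h
  refine (MCone.hEquiv_postcomp f e).trans ?_
  refine ⟨⟨MCone.desc (cell (Sum.inr ()) Fin.elim0) (fun a => isEmptyElim a) (map Sum.inl)
    ?_ (map Sum.inl).continuous (fun a => isEmptyElim a) (fun a => isEmptyElim a),
    desc (MCone.base _ (base _ _)) (fun j z => Sum.elim (fun j => MCone.base _ (cell j z))
      (fun _ => MCone.pt _) j) ?_ ?_, ?_, ?_⟩⟩
  · exact continuous_iff_continuousAt.2 fun p => isEmptyElim p.1
  · rintro (j | j)
    · exact (MCone.continuous_base _).comp (continuous_cell j)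
    · exact continuous_const
  · rintro j z hz ⟨i, _⟩
    exact i.elim0
  · convert ContinuousMap.Homotopic.refl _
    symm
    ext y
    induction y using MCone.induction with
    | hp => simp [desc_cell]
    | hc a => exact isEmptyElim a
    | hb y =>
      induction y using CubeWedge.induction with
      | hb => rfl
      | hc j z hz => simp [desc_cell]
  · convert ContinuousMap.Homotopic.refl _
    symm
    ext y
    induction y using CubeWedge.induction with
    | hb => rfl
    | hc j z hz =>
      have hz0 : z = Fin.elim0 := Subsingleton.elim _ _
      obtain j | j := j
      · simp [desc_cell]
      · simp [desc_cell, hz0]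

end CubeWedge

section
variable {E : Type*} [NormedAddCommGroup E] [NormedSpace ℝ E]

/-- Maps into a subset which are joined by line segments within this subset are homotopic. -/
theorem homotopic_of_segment {Y : Type*} [TopologicalSpace Y] {S : Set E} (f g : C(Y, S))
    (h : ∀ y, ∀ t ∈ unitInterval, (f y : E) + t • ((g y : E) - f y) ∈ S) : f.Homotopic g := by
  refine ⟨⟨⟨fun p => ⟨(f p.2 : E) + (p.1 : ℝ) • ((g p.2 : E) - f p.2), h p.2 p.1 p.1.2⟩, ?_⟩,
    ?_, ?_⟩⟩
  · fun_prop
  · intro y; ext; simp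
  · intro y; ext; simp

/-- An open set in a metric space is the positivity locus of a function with values in `[0,1]`. -/
theorem IsOpen.exists_bump {A : Set E} (hA : IsOpen A) :
    ∃ δ : E → ℝ, Continuous δ ∧ (∀ w, 0 ≤ δ w) ∧ (∀ w, δ w ≤ 1) ∧ ∀ w, 0 < δ w ↔ w ∈ A := by
  rcases (Aᶜ).eq_empty_or_nonempty with h | h
  · refine ⟨fun _ => 1, continuous_const, fun _ => zero_le_one, fun _ => le_rfl, fun w => ?_⟩
    simp [Set.compl_empty_iff.1 h]
  · refine ⟨fun w => min (Metric.infDist w Aᶜ) 1, by fun_prop,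
      fun w => le_min Metric.infDist_nonneg zero_le_one, fun w => min_le_right _ _, fun w => ?_⟩
    rw [lt_min_iff, and_iff_left zero_lt_one]
    rw [← not_iff_not, not_lt]
    have := hA.isClosed_compl.mem_iff_infDist_zero h (x := w)
    rw [← Set.mem_compl_iff, this]
    exact ⟨fun h => le_antisymm h Metric.infDist_nonneg, fun h => h.le⟩

variable {A X : Set E}

/-- The union of a lower half space, an upper half cylinder over `X` and a full cylinder
over `A`. -/
def gluedCyl (A X : Set E) : Set (E × ℝ) :=
  {p | p.2 < 0 ∨ (0 < p.2 ∧ p.1 ∈ X) ∨ p.1 ∈ A}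

/-- A half space glued to a half cylinder over `X` along `A` is the mapping cone of `A ⊆ X`. -/
theorem hEquiv_gluedCyl (hA : IsOpen A) (h : A ⊆ X) :
    HEquiv (gluedCyl A X)
      (MCone (⟨Set.inclusion h, continuous_inclusion h⟩ : C(A, X))) := by
  classical
  obtain ⟨δ, hδ, h0, h1, hpos⟩ := hA.exists_bump
  set f : C(A, X) := ⟨Set.inclusion h, continuous_inclusion h⟩ with hf
  let Φ : C(MCone f, gluedCyl A X) := MCone.desc ⟨(0, -1), .inl (by norm_num)⟩
    (fun a t => ⟨(min 1 (2 * t) • (a : E), max (-1) (4 * t - 3)), by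
      rcases le_total t (1 / 2) with ht | ht
      · left
        simp only
        rw [max_eq_left (by linarith)]; norm_num
      · right; right
        simp only
        rw [min_eq_left (by linarith), one_smul]; exact a.2⟩)
    (fun x => ⟨(x, 1), .inr (.inl ⟨zero_lt_one, x.2⟩)⟩)
    (by fun_prop) (by fun_prop)
    (fun a => by ext <;> simp) (fun a => by ext <;> norm_num [hf])
  have hmem : ∀ p : gluedCyl A X, 0 < p.1.2 → p.1.1 ∈ X := by
    rintro ⟨⟨w, s⟩, hs | hs | hs⟩ h'
    · exact absurd h' hs.not_gt
    · exact hs.2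
    · exact h hs
  let Ψ₀ : gluedCyl A X → MCone f := fun p =>
    if hw : p.1.1 ∈ A then MCone.cyl f ⟨p.1.1, hw⟩ (1 / 2 + p.1.2 / (2 * δ p.1.1))
    else if hs : 0 < p.1.2 then MCone.base f ⟨p.1.1, hmem p hs⟩ else MCone.pt f
  have hΨA : ∀ (p : gluedCyl A X) (hw : p.1.1 ∈ A),
      Ψ₀ p = MCone.cyl f ⟨p.1.1, hw⟩ (1 / 2 + p.1.2 / (2 * δ p.1.1)) := fun p hw => dif_pos hw
  have hΨX : ∀ (p : gluedCyl A X) (hs : δ p.1.1 ≤ p.1.2) (hs0 : 0 < p.1.2),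
      Ψ₀ p = MCone.base f ⟨p.1.1, hmem p hs0⟩ := by
    intro p hs hs0
    by_cases hw : p.1.1 ∈ A
    · rw [hΨA p hw, MCone.cyl_of_ge]
      · rfl
      · have := (hpos _).2 hw
        have : 1 / 2 ≤ p.1.2 / (2 * δ p.1.1) := by
          rw [le_div_iff₀ (by positivity)]; linarith
        linarith
    · simp only [Ψ₀]
      rw [dif_neg hw, dif_pos hs0]
  have hΨp : ∀ (p : gluedCyl A X) (hs : p.1.2 ≤ - δ p.1.1), Ψ₀ p = MCone.pt f := by
    intro p hs
    by_cases hw : p.1.1 ∈ A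
    · rw [hΨA p hw, MCone.cyl_of_le]
      have := (hpos _).2 hw
      have : p.1.2 / (2 * δ p.1.1) ≤ -1 / 2 := by
        rw [div_le_iff₀ (by positivity)]; linarith
      linarith
    · simp only [Ψ₀]
      rw [dif_neg hw, dif_neg]
      linarith [h0 p.1.1]
  have hΨ : Continuous Ψ₀ := by
    rw [continuous_iff_continuousAt]
    intro p
    by_cases hw : p.1.1 ∈ A
    · have hop : IsOpen {p : gluedCyl A X | p.1.1 ∈ A} := hA.preimage (by fun_prop)
      refine ContinuousOn.continuousAt ?_ (hop.mem_nhds hw)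
      rw [continuousOn_iff_continuous_domRestrict]
      have : Continuous fun q : {p : gluedCyl A X | p.1.1 ∈ A} =>
          MCone.cyl f ⟨q.1.1.1, q.2⟩ (1 / 2 + q.1.1.2 / (2 * δ q.1.1.1)) := by
        refine (MCone.continuous_cyl f).comp (f := fun q : {p : gluedCyl A X | p.1.1 ∈ A} =>
          ((⟨q.1.1.1, q.2⟩ : A), (1 / 2 + q.1.1.2 / (2 * δ q.1.1.1)))) ?_
        refine Continuous.prodMk (by fun_prop) (continuous_const.add (Continuous.div ?_ ?_ ?_))
        · fun_prop
        · fun_prop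
        · intro q
          have := (hpos _).2 q.2
          positivity
      exact this.congr fun q => (hΨA q.1 q.2).symm
    · have hδ0 : δ p.1.1 = 0 := le_antisymm (not_lt.1 fun h' => hw ((hpos _).1 h')) (h0 _)
      by_cases hs : 0 < p.1.2
      · have hop : IsOpen {p : gluedCyl A X | δ p.1.1 < p.1.2} :=
          isOpen_lt (by fun_prop) (by fun_prop)
        refine ContinuousOn.continuousAt ?_ (hop.mem_nhds (by simpa [hδ0] using hs))
        rw [continuousOn_iff_continuous_domRestrict]
        have : Continuous fun q : {p : gluedCyl A X | δ p.1.1 < p.1.2} =>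
            MCone.base f ⟨q.1.1.1, hmem q.1 ((h0 _).trans_lt q.2)⟩ :=
          (MCone.continuous_base f).comp (by fun_prop)
        exact this.congr fun q => (hΨX q.1 (le_of_lt q.2) ((h0 _).trans_lt q.2)).symm
      · have hop : IsOpen {p : gluedCyl A X | p.1.2 < - δ p.1.1} :=
          isOpen_lt (by fun_prop) (by fun_prop)
        have hs' : p.1.2 < 0 := by
          rcases p.2 with h' | h' | h'
          exacts [h', absurd h'.1 hs, absurd h' hw]
        refine ContinuousOn.continuousAt ?_ (hop.mem_nhds (by simpa [hδ0] using hs'))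
        rw [continuousOn_iff_continuous_domRestrict]
        exact (continuous_const (y := MCone.pt f)).congr fun q => (hΨp q.1 (le_of_lt q.2)).symm
  let Ψ : C(gluedCyl A X, MCone f) := ⟨Ψ₀, hΨ⟩
  have hΦc : ∀ a t, t ∈ unitInterval →
      ((Φ (MCone.cyl f a t)) : E × ℝ) = (min 1 (2 * t) • (a : E), max (-1) (4 * t - 3)) := by
    intro a t ht
    simp only [Φ]
    rw [MCone.desc_cyl a ht.1 ht.2]
  refine ⟨⟨Ψ, Φ, ?_, ?_⟩⟩
  · refine homotopic_of_segment _ _ ?_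
    rintro p t ht
    simp only [ContinuousMap.comp_apply, ContinuousMap.id_apply]
    have hn : ∀ a b : ℝ, a < 0 → b < 0 → a + t * (b - a) < 0 := by
      intro a b ha hb
      obtain ⟨ht0, ht1⟩ := ht
      rcases le_total a b with hab | hab
      · nlinarith
      · nlinarith
    by_cases hw : p.1.1 ∈ A
    · have hc : Ψ p = MCone.cyl f ⟨p.1.1, hw⟩
          (MCone.clamp (1 / 2 + p.1.2 / (2 * δ p.1.1)) : unitInterval) := by
        rw [MCone.cyl, MCone.clamp_coe]; exact hΨA p hw
      rw [hc, hΦc _ _ (Subtype.prop _)]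
      set u : ℝ := 1 / 2 + p.1.2 / (2 * δ p.1.1)
      have hδp := (hpos _).2 hw
      rcases le_or_gt (1 / 2) u with hu | hu
      · right; right
        have : min 1 (2 * ((MCone.clamp u : unitInterval) : ℝ)) = 1 := by
          rw [MCone.coe_clamp, min_eq_left]
          have : 1 / 2 ≤ max 0 (min 1 u) := le_max_of_le_right (le_min (by norm_num) hu)
          linarith
        simp [this, hw]
      · left
        have hs : p.1.2 < 0 := by
          by_contra! hs
          have : 0 ≤ p.1.2 / (2 * δ p.1.1) := by positivity
          simp only [u] at hu
          linarith
        have : max (-1) (4 * ((MCone.clamp u : unitInterval) : ℝ) - 3) < 0 := by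
          rw [MCone.coe_clamp]
          have : max 0 (min 1 u) ≤ 1 / 2 := max_le (by norm_num) (min_le_of_right_le hu.le)
          exact max_lt (by norm_num) (by linarith)
        simp only [Prod.snd_add, Prod.smul_snd, Prod.snd_sub, smul_eq_mul]
        exact hn _ _ this hs
    · have hδ0 : δ p.1.1 = 0 := le_antisymm (not_lt.1 fun h' => hw ((hpos _).1 h')) (h0 _)
      by_cases hs : 0 < p.1.2
      · have hc : Ψ p = _ := hΨX p (by rw [hδ0]; exact hs.le) hs
        rw [hc]
        right; left
        simp only [Φ, MCone.desc_base]
        refine ⟨?_, ?_⟩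
        · simp only [Prod.snd_add, Prod.smul_snd, Prod.snd_sub, smul_eq_mul]
          have := hn (-1) (-p.1.2) (by norm_num) (by linarith)
          linarith
        · simpa using hmem p hs
      · have hs' : p.1.2 < 0 := by
          rcases p.2 with h' | h' | h'
          exacts [h', absurd h'.1 hs, absurd h' hw]
        have hc : Ψ p = _ := hΨp p (by rw [hδ0]; linarith)
        rw [hc]
        left
        simp only [Φ, MCone.desc_pt, Prod.snd_add, Prod.smul_snd, Prod.snd_sub, smul_eq_mul]
        exact hn _ _ (by norm_num) hs'
  · refine MCone.homotopic (fun _ => MCone.pt f)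
      (fun a t s => MCone.cyl f a ((1 - s) * (1 / 2 + (4 * t - 3) / (2 * δ a)) + s * t))
      (fun x _ => MCone.base f x) continuous_const ?_ ?_ ?_ ?_ ?_ ?_ ?_ ?_ ?_ ?_
    · refine (MCone.continuous_cyl f).comp (f := fun x : A × ℝ × ℝ =>
        (x.1, ((1 - x.2.2) * (1 / 2 + (4 * x.2.1 - 3) / (2 * δ x.1)) + x.2.2 * x.2.1))) ?_
      refine continuous_fst.prodMk (Continuous.add (Continuous.mul (by fun_prop)
        (continuous_const.add (Continuous.div (by fun_prop) (by fun_prop) ?_))) (by fun_prop))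
      intro q
      have := (hpos _).2 q.1.2
      positivity
    · exact (MCone.continuous_base f).comp continuous_fst
    · intro a s hs
      refine MCone.cyl_of_le _ _ ?_
      have hd := (hpos _).2 a.2
      have : (4 * 0 - 3) / (2 * δ a) ≤ -1 / 2 := by
        rw [div_le_iff₀ (by positivity)]; linarith [h1 a]
      nlinarith [hs.1, hs.2]
    · intro a s hs
      rw [MCone.cyl_of_ge]
      have hd := (hpos _).2 a.2
      have : 1 / 2 ≤ (4 * 1 - 3) / (2 * δ a) := by
        rw [le_div_iff₀ (by positivity)]; linarith [h1 a]
      nlinarith [hs.1, hs.2]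
    · refine (hΨp _ ?_).symm
      simp only [Φ, MCone.desc_pt]
      linarith [h1 0]
    · rfl
    · intro a t ht
      simp only [sub_zero, one_mul, zero_mul, add_zero, ContinuousMap.comp_apply]
      have hd := (hpos _).2 a.2
      rcases le_total t (1 / 2) with h2 | h2
      · rw [MCone.cyl_of_le]
        · refine (hΨp _ ?_).symm
          rw [hΦc a t ht]
          simp only
          rw [max_eq_left (by linarith)]
          linarith [h1 (min 1 (2 * t) • (a : E))]
        · have : (4 * t - 3) / (2 * δ a) ≤ -1 / 2 := by
            rw [div_le_iff₀ (by positivity)]; linarith [h1 a]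
          linarith
      · have e : ((Φ (MCone.cyl f a t)) : E × ℝ) = ((a : E), 4 * t - 3) := by
          rw [hΦc a t ht, min_eq_left (by linarith), one_smul, max_eq_right (by linarith)]
        have hw : (Φ (MCone.cyl f a t)).1.1 ∈ A := by rw [e]; exact a.2
        refine Eq.trans ?_ (hΨA _ hw).symm
        simp only [e]
    · intro a t ht
      simp
    · intro x
      have := hΨX (Φ (MCone.base f x)) (h1 _) zero_lt_one
      exact this.symm
    · intro x; rfl

end

/-- A region of `α → ℝ` cut out by the position of one coordinate relative to a threshold
depending on the other coordinates is a mapping cone. -/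
theorem hEquiv_threshold {α : Type*} [Fintype α] [DecidableEq α] (a : α) {U A X : Set (α → ℝ)}
    (v : (α → ℝ) → ℝ) (hv : Continuous v) (hA : IsOpen A) (h : A ⊆ X)
    (hva : ∀ w c, v (update w a c) = v w) (hAa : ∀ w c, update w a c ∈ A ↔ w ∈ A)
    (hXa : ∀ w c, update w a c ∈ X ↔ w ∈ X)
    (hU : ∀ w, w ∈ U ↔ w a < v w ∨ (v w < w a ∧ w ∈ X) ∨ w ∈ A) :
    HEquiv U (MCone (⟨Set.inclusion h, continuous_inclusion h⟩ : C(A, X))) := by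
  refine HEquiv.trans ?_ (hEquiv_gluedCyl hA h)
  refine ⟨⟨⟨fun w => ⟨(w, w.1 a - v w), ?_⟩, ?_⟩,
    ⟨fun p => ⟨update p.1.1 a (p.1.2 + v p.1.1), ?_⟩, ?_⟩, ?_, ?_⟩⟩
  · have := (hU _).1 w.2
    simpa [gluedCyl, sub_neg, sub_pos] using this
  · refine Continuous.subtype_mk (Continuous.prodMk (by fun_prop) (Continuous.sub ?_ ?_)) _
    · exact (continuous_apply a).comp continuous_subtype_val
    · fun_prop
  · rw [hU, hva, hXa, hAa, update_self]
    simpa [gluedCyl] using p.2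
  · fun_prop
  · convert ContinuousMap.Homotopic.refl _
    symm
    ext w i
    simp
  · refine homotopic_of_segment _ _ ?_
    intro p t ht
    set w := p.1.1 with hw
    have hq : update w a (p.1.2 + v w) + t • (w - update w a (p.1.2 + v w)) =
        update w a (p.1.2 + v w + t * (w a - (p.1.2 + v w))) := by
      ext i
      by_cases hi : i = a
      · subst hi; simp
      · simp [hi]
    change (update w a (p.1.2 + v w) + t • (w - update w a (p.1.2 + v w)),
      (update w a (p.1.2 + v w) a - v (update w a (p.1.2 + v w))) + t • (p.1.2 -
        (update w a (p.1.2 + v w) a - v (update w a (p.1.2 + v w))))) ∈ gluedCyl A X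
    have := p.2
    rw [hq, hva, update_self]
    simpa [gluedCyl, hXa, hAa] using this

section GeneralPosition

variable {E : Type*} [NormedAddCommGroup E] [NormedSpace ℝ E]

theorem homotopicRel_of_family {Y : Type*} [TopologicalSpace Y] {X : Set E} {S : Set Y}
    (f g : C(Y, X)) (H : ℝ → Y → E) (hH : Continuous fun p : ℝ × Y => H p.1 p.2)
    (hm : ∀ t ∈ unitInterval, ∀ y, H t y ∈ X) (h0 : ∀ y, H 0 y = f y) (h1 : ∀ y, H 1 y = g y)
    (hS : ∀ t ∈ unitInterval, ∀ y ∈ S, H t y = f y) : f.HomotopicRel g S :=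
  ⟨{ toFun := fun p => ⟨H p.1 p.2, hm _ p.1.2 _⟩
     continuous_toFun := by
       refine Continuous.subtype_mk ?_ _
       exact hH.comp ((continuous_subtype_val.comp continuous_fst).prodMk continuous_snd)
     map_zero_left := fun y => Subtype.ext (h0 y)
     map_one_left := fun y => Subtype.ext (h1 y)
     prop' := fun t y hy => Subtype.ext (hS _ t.2 y hy) }⟩

variable [FiniteDimensional ℝ E]

/-- A smooth family of dimension `i + 1` can be pushed off countably many subspaces of codimension
greater than `i + 1`. -/
theorem exists_translation_avoiding {κ : Type*} [Countable κ] (L : κ → Submodule ℝ E) (i : ℕ)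
    (hi : ∀ k, Module.finrank ℝ (L k) + i + 1 < Module.finrank ℝ E)
    (x : E) (φ : (Fin i → ℝ) → ℝ) (hφ : ContDiff ℝ 1 φ) (g : (Fin i → ℝ) → E)
    (hg : ContDiff ℝ 1 g) {Q : Set (Fin i → ℝ)} (hQ : Convex ℝ Q) (hφQ : ∀ z ∈ Q, φ z ≠ 0) :
    ∃ v : E, ∀ z ∈ Q, ∀ t ∈ Set.Ioo (0 : ℝ) 1, ∀ k,
      x + (1 - t) • g z + (φ z * (t * (1 - t))) • v ∉ L k := by
  cases isEmpty_or_nonempty κ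
  · exact ⟨0, fun z _ t _ k => isEmptyElim k⟩
  let F : ∀ k, ((Fin i → ℝ) × ℝ) × L k → E := fun k p =>
    (φ p.1.1 * (p.1.2 * (1 - p.1.2)))⁻¹ • ((p.2 : E) - x - (1 - p.1.2) • g p.1.1)
  let D : ∀ k, Set (((Fin i → ℝ) × ℝ) × L k) := fun k => (Q ×ˢ Set.Ioo (0 : ℝ) 1) ×ˢ Set.univ
  have hne : ∀ k, ∀ p ∈ D k, φ p.1.1 * (p.1.2 * (1 - p.1.2)) ≠ 0 := by
    rintro k p ⟨⟨h1, h2, h3⟩, -⟩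
    have : 0 < p.1.2 * (1 - p.1.2) := mul_pos h2 (by linarith)
    exact mul_ne_zero (hφQ _ h1) this.ne'
  have hF : ∀ k, ContDiffOn ℝ 1 (F k) (D k) := by
    intro k
    refine ContDiffOn.smul (ContDiffOn.inv ?_ (hne k)) ?_
    · apply ContDiff.contDiffOn
      have : ContDiff ℝ 1 fun p : ((Fin i → ℝ) × ℝ) × L k => φ p.1.1 :=
        hφ.comp (contDiff_fst.comp contDiff_fst)
      fun_prop
    · apply ContDiff.contDiffOn
      have h1 : ContDiff ℝ 1 fun p : ((Fin i → ℝ) × ℝ) × L k => g p.1.1 :=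
        hg.comp (contDiff_fst.comp contDiff_fst)
      have h2 : ContDiff ℝ 1 fun p : ((Fin i → ℝ) × ℝ) × L k => (p.2 : E) :=
        (L k).subtypeL.contDiff.comp contDiff_snd
      fun_prop
  have hdim : dimH (⋃ k, F k '' D k) < Module.finrank ℝ E := by
    have hle : dimH (⋃ k, F k '' D k) ≤ ((Module.finrank ℝ E - 1 : ℕ) : ENNReal) := by
      rw [dimH_iUnion]
      refine iSup_le fun k => ?_
      have hconv : Convex ℝ (D k) := (hQ.prod (convex_Ioo 0 1)).prod convex_univ
      refine ((hF k).dimH_image_le hconv subset_rfl).trans ?_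
      refine (dimH_mono (Set.subset_univ _)).trans ?_
      rw [Real.dimH_univ_eq_finrank]
      have : Module.finrank ℝ (((Fin i → ℝ) × ℝ) × L k) ≤ Module.finrank ℝ E - 1 := by
        have := hi k
        simp only [Module.finrank_prod, Module.finrank_fin_fun, Module.finrank_self]
        omega
      exact_mod_cast this
    refine hle.trans_lt ?_
    have : Module.finrank ℝ E - 1 < Module.finrank ℝ E := by
      have := hi (Classical.arbitrary κ)
      omega
    exact_mod_cast this
  obtain ⟨v, hv⟩ := (dense_compl_of_dimH_lt_finrank hdim).nonempty
  refine ⟨v, fun z hz t ht k hk => hv ?_⟩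
  refine Set.mem_iUnion.2 ⟨k, ⟨((z, t), ⟨_, hk⟩), ⟨⟨hz, ht⟩, trivial⟩, ?_⟩⟩
  have := hne k ((z, t), ⟨_, hk⟩) ⟨⟨hz, ht⟩, trivial⟩
  simp only [F]
  rw [inv_smul_eq_iff₀ this]
  simp only
  abel

theorem homotopicRel_const_of_codim {X : Set E} (hX : IsOpen X) {κ : Type*} [Countable κ]
    (L : κ → Submodule ℝ E) (hL : ∀ w ∉ X, ∃ k, w ∈ L k) (i : ℕ)
    (hi : ∀ k, Module.finrank ℝ (L k) + i + 1 < Module.finrank ℝ E)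
    (g : C(Fin i → unitInterval, X)) (x : X) (hg : ∀ z ∈ Cube.boundary (Fin i), g z = x) :
    g.HomotopicRel (ContinuousMap.const _ x) (Cube.boundary (Fin i)) := by
  let f : (Fin i → ℝ) → E := fun z => (g fun j => clamp (z j)) - (x : E)
  have hf : Continuous f := by
    refine Continuous.sub (continuous_subtype_val.comp (g.continuous.comp ?_)) continuous_const
    exact continuous_pi fun j => continuous_clamp.comp (continuous_apply j)
  have hcpt : IsCompact (Set.range fun z => (g z : E)) :=
    isCompact_range (continuous_subtype_val.comp g.continuous)
  obtain ⟨ε, hε, hεX⟩ := hcpt.exists_thickening_subset_open hX (by rintro _ ⟨z, rfl⟩; exact (g z).2)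
  obtain ⟨g₁, hg₁, hd, hs⟩ := hf.exists_contDiff_approx 1 (ε := fun _ => ε) continuous_const
    (fun _ => hε)
  have hfz : ∀ z : Fin i → unitInterval, f (fun j => z j) = (g z : E) - x := by
    intro z
    simp [f]
  have hg₁b : ∀ z ∈ Cube.boundary (Fin i), g₁ (fun j => (z j : ℝ)) = 0 := by
    intro z hz
    by_contra h
    have := hs h
    rw [mem_support, hfz, hg z hz, sub_self] at this
    exact this rfl
  have hseg : ∀ t ∈ unitInterval, ∀ z : Fin i → unitInterval,
      (g z : E) + t • ((x : E) + g₁ (fun j => (z j : ℝ)) - g z) ∈ X := by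
    intro t ht z
    apply hεX
    rw [Metric.mem_thickening_iff]
    refine ⟨_, ⟨z, rfl⟩, ?_⟩
    have h := hd (fun j => (z j : ℝ))
    rw [hfz, dist_eq_norm] at h
    rw [dist_eq_norm, add_sub_cancel_left, norm_smul, Real.norm_eq_abs, abs_of_nonneg ht.1]
    rw [show (x : E) + g₁ (fun j => (z j : ℝ)) - g z = g₁ (fun j => (z j : ℝ)) - (g z - x) by abel]
    exact (mul_le_of_le_one_left (norm_nonneg _) ht.2).trans_lt h
  have hcoe : Continuous fun z : Fin i → unitInterval => fun j => (z j : ℝ) :=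
    continuous_pi fun j => continuous_subtype_val.comp (continuous_apply j)
  have hg₁c : Continuous fun z : Fin i → unitInterval => g₁ (fun j => (z j : ℝ)) :=
    hg₁.continuous.comp hcoe
  have hmem : ∀ z : Fin i → unitInterval, (x : E) + g₁ (fun j => (z j : ℝ)) ∈ X := by
    intro z
    simpa using hseg 1 ⟨zero_le_one, le_rfl⟩ z
  let m : C(Fin i → unitInterval, X) :=
    ⟨fun z => ⟨_, hmem z⟩, (continuous_const.add hg₁c).subtype_mk _⟩
  refine ContinuousMap.HomotopicRel.trans (g := m) ?_ ?_
  · refine homotopicRel_of_family g m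
      (fun t z => (g z : E) + t • ((x : E) + g₁ (fun j => (z j : ℝ)) - g z)) ?_ hseg ?_ ?_ ?_
    · have h1 : Continuous fun p : ℝ × (Fin i → unitInterval) => (g p.2 : E) :=
        continuous_subtype_val.comp (g.continuous.comp continuous_snd)
      have h2 := hg₁c.comp (continuous_snd (X := ℝ))
      exact h1.add (continuous_fst.smul ((continuous_const.add h2).sub h1))
    · intro y; simp
    · intro y; simp [m]
    · intro t _ y hy
      simp [hg y hy, hg₁b y hy]
  · obtain ⟨v, hv⟩ := exists_translation_avoiding L i hi x (fun z => ∏ j, (z j * (1 - z j)))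
      (by fun_prop) g₁ (by exact_mod_cast hg₁) (Q := Set.univ.pi fun _ => Set.Ioo (0 : ℝ) 1)
      (convex_pi fun j _ => convex_Ioo 0 1)
      (fun z hz => Finset.prod_ne_zero_iff.2 fun j _ =>
        (mul_pos (hz j trivial).1 (by linarith [(hz j trivial).2])).ne')
    have hb : ∀ (t : ℝ) (z : Fin i → unitInterval), z ∈ Cube.boundary (Fin i) →
        (x : E) + (1 - t) • g₁ (fun j => (z j : ℝ)) +
          ((∏ j, ((z j : ℝ) * (1 - z j))) * (t * (1 - t))) • v = x := by
      intro t z hz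
      rw [hg₁b z hz]
      obtain ⟨j, hj⟩ := hz
      rw [Finset.prod_eq_zero (Finset.mem_univ j) (by rcases hj with h | h <;> simp [h])]
      simp
    refine homotopicRel_of_family m _ (fun t z => (x : E) + (1 - t) • g₁ (fun j => (z j : ℝ)) +
        ((∏ j, ((z j : ℝ) * (1 - z j))) * (t * (1 - t))) • v) ?_ ?_ ?_ ?_ ?_
    · have h2 := hg₁c.comp (continuous_snd (X := ℝ))
      have h3 : Continuous fun p : ℝ × (Fin i → unitInterval) =>
          ∏ j, ((p.2 j : ℝ) * (1 - p.2 j)) := by fun_prop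
      exact (continuous_const.add ((continuous_const.sub continuous_fst).smul h2)).add
        ((h3.mul (continuous_fst.mul (continuous_const.sub continuous_fst))).smul continuous_const)
    · intro t ht z
      by_cases hz : z ∈ Cube.boundary (Fin i)
      · rw [hb t z hz]; exact x.2
      rcases eq_or_lt_of_le ht.1 with h0 | h0
      · subst h0; simpa using hmem z
      rcases eq_or_lt_of_le ht.2 with h1 | h1
      · subst h1; simp
      by_contra hn
      obtain ⟨k, hk⟩ := hL _ hn
      refine hv (fun j => (z j : ℝ)) (fun j _ => ?_) t ⟨h0, h1⟩ k hk
      simp only [Cube.boundary, Set.mem_ofPred_eq, not_exists, not_or] at hz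
      exact ⟨lt_of_le_of_ne (z j).2.1 fun h => (hz j).1 (Subtype.ext h.symm),
        lt_of_le_of_ne (z j).2.2 fun h => (hz j).2 (Subtype.ext h)⟩
    · intro z; simp [m]
    · intro z; simp
    · intro t _ z hz
      rw [hb t z hz]; simp [m, hg₁b z hz]

end GeneralPosition

section CodimConsequences

variable {E : Type*} [NormedAddCommGroup E] [NormedSpace ℝ E] [FiniteDimensional ℝ E]
  {X : Set E} {κ : Type*} [Countable κ] (L : κ → Submodule ℝ E)

theorem nonempty_of_codim (hL : ∀ w ∉ X, ∃ k, w ∈ L k)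
    (hi : ∀ k, Module.finrank ℝ (L k) < Module.finrank ℝ E) : X.Nonempty := by
  cases isEmpty_or_nonempty κ
  · by_contra h
    obtain ⟨k, -⟩ := hL 0 (fun h0 => h ⟨0, h0⟩)
    exact isEmptyElim k
  have hdim : dimH (⋃ k, (L k : Set E)) < Module.finrank ℝ E := by
    have hle : dimH (⋃ k, (L k : Set E)) ≤ ((Module.finrank ℝ E - 1 : ℕ) : ENNReal) := by
      rw [dimH_iUnion]
      refine iSup_le fun k => ?_
      have h1 : (L k : Set E) = (L k).subtypeL '' Set.univ := by simp
      rw [h1]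
      refine ((L k).subtypeL.contDiff.contDiffOn.dimH_image_le convex_univ subset_rfl).trans ?_
      rw [Real.dimH_univ_eq_finrank]
      have : Module.finrank ℝ (L k) ≤ Module.finrank ℝ E - 1 := by
        have := hi k
        omega
      exact_mod_cast this
    refine hle.trans_lt ?_
    have : Module.finrank ℝ E - 1 < Module.finrank ℝ E := by
      have := hi (Classical.arbitrary κ)
      omega
    exact_mod_cast this
  obtain ⟨v, hv⟩ := (dense_compl_of_dimH_lt_finrank hdim).nonempty
  refine ⟨v, ?_⟩
  by_contra h
  exact hv (Set.mem_iUnion.2 (hL v h))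

theorem joined_of_codim (hX : IsOpen X) (hL : ∀ w ∉ X, ∃ k, w ∈ L k)
    (hi : ∀ k, Module.finrank ℝ (L k) + 1 < Module.finrank ℝ E) (x y : X) : Joined x y := by
  obtain ⟨H⟩ := (homotopicRel_const_of_codim hX L hL 0 hi (ContinuousMap.const _ x) y
    (by rintro z ⟨i, -⟩; exact i.elim0)).homotopic
  exact ⟨⟨⟨fun t => H (t, Fin.elim0), by fun_prop⟩, by simp, by simp⟩⟩

theorem kConn_of_codim (hX : IsOpen X) (hL : ∀ w ∉ X, ∃ k, w ∈ L k) (m : ℤ) (hm : -1 ≤ m)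
    (hi : ∀ k, (Module.finrank ℝ (L k) : ℤ) + m + 1 < Module.finrank ℝ E) : KConn X m := by
  obtain ⟨w, hw⟩ := nonempty_of_codim L hL fun k => by have := hi k; omega
  have hne : Nonempty X := ⟨⟨w, hw⟩⟩
  refine Or.inr ⟨hne, fun h0 => ?_, fun i h1 hik x => ?_⟩
  · exact ⟨hne, joined_of_codim L hX hL fun k => by have := hi k; omega⟩
  · have : ∀ p : HomotopyGroup (Fin i) X x, p = Quotient.mk _ GenLoop.const := by
      intro p
      induction p using Quotient.inductionOn with
      | h f =>
        refine Quotient.sound ?_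
        exact homotopicRel_const_of_codim hX L hL i (fun k => by have := hi k; omega) f.1 x f.2
    exact ⟨fun p q => (this p).trans (this q).symm⟩

theorem CubeWedge.homotopic_const_of_codim (hX : IsOpen X) (hL : ∀ w ∉ X, ∃ k, w ∈ L k) {d : ℕ}
    {ι : Type*} (hi : ∀ k, Module.finrank ℝ (L k) + d + 1 < Module.finrank ℝ E)
    (F : C(CubeWedge d ι, X)) (x : X) : F.Homotopic (ContinuousMap.const _ x) := by
  have h1 : F.Homotopic (ContinuousMap.const _ (F (CubeWedge.base d ι))) := by
    let g : ι → C(Fin d → unitInterval, X) := fun j =>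
      F.comp ⟨fun z => CubeWedge.cell j fun i => (z i : ℝ),
        (CubeWedge.continuous_cell j).comp (by fun_prop)⟩
    have hg : ∀ j, (g j).HomotopicRel (ContinuousMap.const _ (F (CubeWedge.base d ι)))
        (Cube.boundary (Fin d)) := by
      intro j
      refine homotopicRel_const_of_codim hX L hL d hi (g j) _ ?_
      rintro z ⟨i, hz⟩
      simp only [g, ContinuousMap.comp_apply, ContinuousMap.coe_mk]
      rw [CubeWedge.cell_of_not_mem j ⟨i, ?_⟩]
      rcases hz with h | h <;> simp [h]
    let H := fun j => Classical.choice (hg j)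
    refine CubeWedge.homotopic (fun _ => F (CubeWedge.base d ι))
      (fun j z s => H j (clamp s, fun i => clamp (z i))) continuous_const ?_ ?_ rfl rfl ?_ ?_
    · intro j
      exact (H j).continuous.comp ((continuous_clamp.comp continuous_snd).prodMk
        (continuous_pi fun i => continuous_clamp.comp ((continuous_apply i).comp continuous_fst)))
    · intro j z hz ⟨i, hi⟩ s hs
      have hb : (fun i => clamp (z i)) ∈ Cube.boundary (Fin d) := by
        refine ⟨i, ?_⟩
        rcases hi with h | h
        · exact .inl (clamp_of_le h.le)
        · exact .inr (clamp_of_ge h.ge)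
      rw [(H j).eq_fst _ hb]
      simp only [g, ContinuousMap.comp_apply, ContinuousMap.coe_mk]
      rw [CubeWedge.cell_of_not_mem j ⟨i, ?_⟩]
      rcases hi with h | h
      · exact .inl (by simp [h])
      · exact .inr (by simp [h])
    · intro j z hz
      rw [clamp_of_le le_rfl, ContinuousMap.HomotopyWith.apply_zero]
      simp only [g, ContinuousMap.comp_apply, ContinuousMap.coe_mk]
      congr 2
      ext i
      simp [coe_clamp, (hz i).1, (hz i).2]
    · intro j z hz
      rw [clamp_of_ge le_rfl, ContinuousMap.HomotopyWith.apply_one]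
      rfl
  refine h1.trans ?_
  obtain ⟨γ⟩ := joined_of_codim L hX hL (fun k => by have := hi k; omega)
    (F (CubeWedge.base d ι)) x
  exact ⟨⟨⟨fun p => γ p.1, by fun_prop⟩, by simp, by simp⟩⟩

/-- The mapping cone of an inclusion of a wedge of `d`-spheres into a wedge of `d + 1`-spheres
with complement of large codimension is a wedge of `d + 1`-spheres. -/
theorem hEquiv_mcone_inclusion (hX : IsOpen X) (hL : ∀ w ∉ X, ∃ k, w ∈ L k) {d : ℕ}
    {ι ι' : Type*} (hi : ∀ k, Module.finrank ℝ (L k) + d + 1 < Module.finrank ℝ E)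
    {A : Set E} (h : A ⊆ X) (hA : HEquiv A (CubeWedge d ι'))
    (hXe : HEquiv X (CubeWedge (d + 1) ι)) :
    HEquiv (MCone (⟨Set.inclusion h, continuous_inclusion h⟩ : C(A, X)))
      (CubeWedge (d + 1) (ι ⊕ ι')) := by
  obtain ⟨e⟩ := hA
  obtain ⟨e'⟩ := hXe
  set f : C(A, X) := ⟨Set.inclusion h, continuous_inclusion h⟩
  obtain ⟨x⟩ : Nonempty X := ⟨e'.invFun (CubeWedge.base _ _)⟩
  have hf : f.Homotopic (ContinuousMap.const A x) := by
    have h1 : (f.comp (e.invFun.comp e.toFun)).Homotopic (f.comp (.id _)) :=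
      .comp (.refl f) e.left_inv
    have h2 := CubeWedge.homotopic_const_of_codim L hX hL hi (f.comp e.invFun) x
    have h3 : ((f.comp e.invFun).comp e.toFun).Homotopic
      ((ContinuousMap.const _ x).comp e.toFun) := .comp h2 (.refl _)
    exact h1.symm.trans h3
  refine (MCone.hEquiv_of_homotopic hf).trans ?_
  refine (MCone.hEquiv_precomp x e).trans ?_
  refine (MCone.hEquiv_postcomp _ e').trans ?_
  refine HEquiv.trans (MCone.hEquiv_of_homotopic ?_) CubeWedge.hEquiv_mcone_const
  obtain ⟨γ⟩ := joined_of_codim L hX hL (fun k => by have := hi k; omega)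
    x (e'.invFun (CubeWedge.base _ _))
  have h1 : (e'.toFun.comp (ContinuousMap.const (CubeWedge d ι') x)).Homotopic
      (e'.toFun.comp (ContinuousMap.const _ (e'.invFun (CubeWedge.base _ _)))) :=
    .comp (.refl _) ⟨⟨⟨fun p => γ p.1, by fun_prop⟩, fun _ => γ.source, fun _ => γ.target⟩⟩
  refine h1.trans ?_
  obtain ⟨K⟩ := e'.right_inv
  exact ⟨⟨⟨fun p => K (p.1, CubeWedge.base _ _), by fun_prop⟩, by simp, by simp⟩⟩

end CodimConsequences

namespace Matroid

variable {α : Type*}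

/-- The elements of the ground set of weight at least `c`. -/
def superlevel (M : Matroid α) (w : α → ℝ) (c : ℝ) : Set α := {i ∈ M.E | c ≤ w i}

/-- The weights on the ground set of a matroid some superlevel set of which is not a flat. -/
def nonflatWeights (M : Matroid α) : Set (α → ℝ) :=
  {w | ∃ S ⊆ M.E, M.closure S ≠ S ∧ ∀ i ∈ S, ∀ j ∈ M.E \ S, w j < w i}

variable {M : Matroid α} {w : α → ℝ}

theorem mem_nonflatWeights [Finite α] :
    w ∈ M.nonflatWeights ↔ ∃ c, M.closure (M.superlevel w c) ≠ M.superlevel w c := by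
  constructor
  · rintro ⟨S, hSE, hS, h⟩
    suffices ∃ c, M.superlevel w c = S by
      obtain ⟨c, rfl⟩ := this
      exact ⟨c, hS⟩
    rcases S.eq_empty_or_nonempty with rfl | hne
    · obtain ⟨c, hc⟩ := (Set.toFinite (w '' M.E)).bddAbove
      refine ⟨c + 1, ?_⟩
      ext i
      simp only [superlevel, Set.mem_ofPred_eq, Set.mem_empty_iff_false, iff_false, not_and, not_le]
      intro hi
      have := hc ⟨i, hi, rfl⟩
      linarith
    · obtain ⟨i, hi, hmin⟩ := Set.exists_min_image S w S.toFinite hne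
      refine ⟨w i, ?_⟩
      ext j
      simp only [superlevel, Set.mem_ofPred_eq]
      refine ⟨fun ⟨hj, hle⟩ => ?_, fun hj => ⟨hSE hj, hmin j hj⟩⟩
      by_contra hjS
      exact absurd (h i hi j ⟨hj, hjS⟩) hle.not_gt
  · rintro ⟨c, hc⟩
    refine ⟨_, fun i hi => hi.1, hc, fun i hi j hj => ?_⟩
    have h1 : ¬ c ≤ w j := fun h => hj.2 ⟨hj.1, h⟩
    exact (not_le.1 h1).trans_le hi.2

theorem notMem_nonflatWeights [Finite α] :
    w ∉ M.nonflatWeights ↔ ∀ c, M.closure (M.superlevel w c) = M.superlevel w c := by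
  rw [mem_nonflatWeights]; push Not; rfl

theorem isOpen_nonflatWeights [Finite α] : IsOpen M.nonflatWeights := by
  have : M.nonflatWeights = ⋃ S ∈ {S | S ⊆ M.E ∧ M.closure S ≠ S},
      ⋂ i ∈ S, ⋂ j ∈ M.E \ S, {w : α → ℝ | w j < w i} := by
    ext w
    simp only [nonflatWeights, Set.mem_ofPred_eq, Set.mem_iUnion, Set.mem_iInter, exists_prop,
      and_assoc]
  rw [this]
  refine isOpen_biUnion fun S _ => (Set.toFinite S).isOpen_biInter fun i _ =>
    (Set.toFinite _).isOpen_biInter fun j _ => ?_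
  exact isOpen_lt (continuous_apply j) (continuous_apply i)

theorem update_mem_nonflatWeights [DecidableEq α] {a : α} (ha : a ∉ M.E) (w : α → ℝ) (c : ℝ) :
    update w a c ∈ M.nonflatWeights ↔ w ∈ M.nonflatWeights := by
  unfold nonflatWeights
  simp only [Set.mem_ofPred_eq]
  refine exists_congr fun S => and_congr_right fun hS => and_congr_right fun _ => ?_
  refine forall₂_congr fun i hi => forall₂_congr fun j hj => ?_
  rw [update_of_ne (by rintro rfl; exact ha hj.1), update_of_ne (by rintro rfl; exact ha (hS hi))]

theorem nonflatWeights_eq_univ {a : α} (ha : a ∈ M.closure ∅) : M.nonflatWeights = Set.univ := by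
  refine Set.eq_univ_of_forall fun w => ?_
  refine ⟨{i ∈ M.E | w a < w i}, fun i hi => hi.1, fun h => ?_, ?_⟩
  · have : a ∈ {i ∈ M.E | w a < w i} := by
      rw [← h]
      exact M.closure_mono (Set.empty_subset _) ha
    exact lt_irrefl _ this.2
  · rintro i ⟨-, hi⟩ j ⟨hj, hj'⟩
    have : ¬ w a < w j := fun h => hj' ⟨hj, h⟩
    exact (not_lt.1 this).trans_lt hi

theorem nonflatWeights_eq_empty (h : M.Indep M.E) : M.nonflatWeights = ∅ := by
  refine Set.eq_empty_of_forall_notMem fun w => ?_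
  rintro ⟨S, hS, hne, -⟩
  refine hne ?_
  have := h.closure_inter_eq_self_of_subset hS
  rwa [Set.inter_eq_left.2 (M.closure_subset_ground S)] at this

section threshold

variable {a : α}

theorem superlevel_delete (M : Matroid α) (a : α) (w : α → ℝ) (c : ℝ) :
    (M.delete {a}).superlevel w c = M.superlevel w c \ {a} := by
  ext i
  simp only [superlevel, delete_ground, Set.mem_sdiff, Set.mem_ofPred_eq, Set.mem_singleton_iff]
  tauto

theorem superlevel_contract (M : Matroid α) (a : α) (w : α → ℝ) (c : ℝ) :
    (M.contract {a}).superlevel w c = (M.delete {a}).superlevel w c := rfl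

theorem notMem_superlevel_delete (M : Matroid α) (a : α) (w : α → ℝ) (c : ℝ) :
    a ∉ (M.delete {a}).superlevel w c := by
  rw [superlevel_delete]; simp

theorem superlevel_eq_of_lt {c : ℝ} (h : w a < c) :
    M.superlevel w c = (M.delete {a}).superlevel w c := by
  rw [superlevel_delete, Set.sdiff_singleton_eq_self]
  exact fun h' => absurd h'.2 h.not_ge

theorem superlevel_eq_of_le (ha : a ∈ M.E) {c : ℝ} (h : c ≤ w a) :
    M.superlevel w c = insert a ((M.delete {a}).superlevel w c) := by
  rw [superlevel_delete, Set.insert_sdiff_singleton, Set.insert_eq_of_mem]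
  exact ⟨ha, h⟩

theorem closure_delete_singleton (T : Set α) (h : a ∉ T) :
    (M.delete {a}).closure T = M.closure T \ {a} := by
  rw [delete_closure_eq, Set.sdiff_singleton_eq_self h]

theorem closure_contract_singleton (T : Set α) :
    (M.contract {a}).closure T = M.closure (insert a T) \ {a} := by
  rw [contract_closure_eq, Set.union_singleton]

theorem superlevel_subset_ground (c : ℝ) : M.superlevel w c ⊆ M.E := fun _ h => h.1

theorem superlevel_anti {c c' : ℝ} (h : c ≤ c') : M.superlevel w c' ⊆ M.superlevel w c :=
  fun _ hi => ⟨hi.1, h.trans hi.2⟩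

theorem nonflatWeights_delete_subset [Finite α] :
    (M.delete {a}).nonflatWeights ⊆ (M.contract {a}).nonflatWeights := by
  intro w
  rw [mem_nonflatWeights, mem_nonflatWeights]
  refine fun ⟨c, hc⟩ => ⟨c, fun h => hc ?_⟩
  rw [superlevel_contract, closure_contract_singleton] at h
  have ha := notMem_superlevel_delete M a w c
  have hE := superlevel_subset_ground (M := M.delete {a}) (w := w) c
  set T := (M.delete {a}).superlevel w c
  refine Set.Subset.antisymm ?_ ((M.delete {a}).subset_closure T hE)
  rw [closure_delete_singleton T ha]
  conv_rhs => rw [← h]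
  exact Set.sdiff_subset_sdiff_left (M.closure_mono (Set.subset_insert _ _))

/-- The weight of a spanning subset of `M ＼ a` of maximal bottleneck. -/
theorem exists_threshold [Finite α] (ha : a ∈ M.closure (M.E \ {a})) (ha' : a ∉ M.closure ∅) :
    ∃ v : (α → ℝ) → ℝ, Continuous v ∧
      ∀ w c, c ≤ v w ↔ a ∈ M.closure ((M.delete {a}).superlevel w c) := by
  classical
  have := Fintype.ofFinite α
  let J := {I : Finset α // (I : Set α) ⊆ M.E \ {a} ∧ a ∈ M.closure I}
  have hne : (Finset.univ : Finset J).Nonempty :=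
    ⟨⟨(M.E \ {a}).toFinset, by simp, by simpa using ha⟩, Finset.mem_univ _⟩
  have hI : ∀ I : J, I.1.Nonempty := by
    rintro ⟨I, -, h⟩
    rw [Finset.nonempty_iff_ne_empty]
    rintro rfl
    exact ha' (by simpa using h)
  refine ⟨fun w => Finset.univ.sup' hne fun I : J => I.1.inf' (hI I) w, ?_, fun w c => ?_⟩
  · refine Continuous.finset_sup'_apply hne fun I _ => ?_
    exact Continuous.finset_inf'_apply (f := fun i (w : α → ℝ) => w i) (hI I)
      fun i _ => continuous_apply i
  · rw [Finset.le_sup'_iff]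
    simp only [Finset.mem_univ, true_and, Finset.le_inf'_iff]
    constructor
    · rintro ⟨⟨I, hIE, haI⟩, h⟩
      have hsub : (I : Set α) ⊆ (M.delete {a}).superlevel w c := fun i hi => ⟨hIE hi, h i hi⟩
      exact M.closure_mono hsub haI
    · intro h
      refine ⟨⟨((M.delete {a}).superlevel w c).toFinset, ?_, by simpa using h⟩, fun i hi => ?_⟩
      · simpa using superlevel_subset_ground (M := M.delete {a}) (w := w) c
      · exact (Set.mem_toFinset.1 hi).2

theorem mem_nonflatWeights_iff_threshold [Finite α] (ha : a ∈ M.E) {v : (α → ℝ) → ℝ}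
    (hv : ∀ w c, c ≤ v w ↔ a ∈ M.closure ((M.delete {a}).superlevel w c)) (w : α → ℝ) :
    w ∈ M.nonflatWeights ↔ w a < v w ∨ (v w < w a ∧ w ∈ (M.contract {a}).nonflatWeights) ∨
      w ∈ (M.delete {a}).nonflatWeights := by
  have hT := notMem_superlevel_delete M a w
  have hTE : ∀ c, (M.delete {a}).superlevel w c ⊆ M.E :=
    fun c => (superlevel_subset_ground c).trans Set.sdiff_subset
  have hle := fun c (h : c ≤ w a) => superlevel_eq_of_le ha h
  have hlt := fun c (h : w a < c) => superlevel_eq_of_lt (M := M) h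
  have hv := hv w
  have hanti := fun c c' (h : c ≤ c') => superlevel_anti (M := M.delete {a}) (w := w) h
  rw [mem_nonflatWeights, mem_nonflatWeights, mem_nonflatWeights]
  simp only [superlevel_contract, closure_contract_singleton]
  simp only [fun c => closure_delete_singleton (M := M) _ (hT c)]
  generalize (M.delete {a}).superlevel w = T at *
  generalize M.superlevel w = S at *
  have hins : ∀ c, insert a (T c) ⊆ M.E := fun c => Set.insert_subset ha (hTE c)
  have hflat : ∀ {c}, M.closure (insert a (T c)) = insert a (T c) →
      M.closure (insert a (T c)) \ {a} = T c := by
    intro c h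
    rw [h, Set.insert_sdiff_self_of_notMem (hT c)]
  constructor
  · rintro ⟨c, hc⟩
    by_contra! hcon
    obtain ⟨h1, h2, h3⟩ := hcon
    rcases le_or_gt c (w a) with hca | hca
    · rw [hle c hca] at hc
      have hX : M.closure (insert a (T c)) \ {a} ≠ T c := by
        intro h
        apply hc
        conv_rhs => rw [← h]
        rw [Set.insert_sdiff_singleton]
        refine (Set.insert_eq_of_mem ?_).symm
        exact M.subset_closure _ (hins c) (Set.mem_insert _ _)
      rcases h1.eq_or_lt with h1 | h1
      · rw [← h1, hv] at hca
        apply hX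
        rw [closure_insert_eq_of_mem_closure hca, h3]
      · exact hX (h2 h1 c)
    · rw [hlt c hca] at hc
      have h4 : a ∉ M.closure (T c) := by
        rw [← hv]; exact not_le.2 (h1.trans_lt hca)
      apply hc
      have := h3 c
      rwa [Set.sdiff_singleton_eq_self h4] at this
  · rintro (h | ⟨h, c, hc⟩ | ⟨c, hc⟩)
    · refine ⟨v w, fun h' => ?_⟩
      have h1 := (hv (v w)).1 le_rfl
      rw [hlt _ h] at h'
      rw [h'] at h1
      exact hT _ h1
    · rcases le_or_gt c (w a) with hca | hca
      · exact ⟨c, fun h' => hc (hflat (by rwa [hle c hca] at h'))⟩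
      · by_contra! hcon
        apply hc
        have h1 := hcon (w a)
        have h2 := hcon c
        rw [hle _ le_rfl] at h1
        rw [hlt _ hca] at h2
        have h3 : a ∉ M.closure (T (w a)) := by
          rw [← hv]; exact not_le.2 h
        have hTT := hanti _ _ hca.le
        refine hflat (Set.Subset.antisymm (fun x hx => ?_) (M.subset_closure _ (hins c)))
        by_cases hxT : x ∈ T c
        · exact .inr hxT
        left
        have h4 := M.mem_closure_insert (by rwa [h2]) hx
        by_contra hxa
        have h5 : x ∈ insert a (T (w a)) := by
          rw [← h1]
          exact M.closure_mono (Set.insert_subset_insert hTT) hx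
        have h6 : x ∈ T (w a) := h5.resolve_left hxa
        exact h3 (M.closure_mono (Set.insert_subset h6 hTT) h4)
    · rcases le_or_gt c (w a) with hca | hca
      · refine ⟨c, fun h' => hc ?_⟩
        rw [hle c hca] at h'
        refine Set.Subset.antisymm ?_ fun x hx =>
          ⟨M.subset_closure _ (hTE c) hx, fun h => hT c (by rwa [← Set.mem_singleton_iff.1 h])⟩
        conv_rhs => rw [← hflat h']
        exact Set.sdiff_subset_sdiff_left (M.closure_mono (Set.subset_insert _ _))
      · refine ⟨c, fun h' => hc ?_⟩
        rw [hlt c hca] at h'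
        rw [h', Set.sdiff_singleton_eq_self (hT c)]

end threshold

end Matroid

namespace Matroid

variable {α : Type*} {M : Matroid α} {w : α → ℝ}

/-- Bases `B` together with maps assigning to every ground set element an element of `B`. -/
def BaseRetraction (M : Matroid α) : Type _ :=
  {p : Set α × (α → α) // M.IsBase p.1}

instance [Finite α] : Finite (BaseRetraction M) := inferInstanceAs (Finite (Subtype _))

/-- The space of weights which are determined on the ground set by their values on a base. -/
def BaseRetraction.subspace (p : BaseRetraction M) : Submodule ℝ (α → ℝ) where
  carrier := {w | ∀ i ∈ M.E \ p.1.1, w i = w (p.1.2 i)}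
  add_mem' := by
    intro w w' h h' i hi
    simp only [Pi.add_apply, h i hi, h' i hi]
  zero_mem' := by intro i _; rfl
  smul_mem' := by
    intro c w h i hi
    simp only [Pi.smul_apply, h i hi]

/-- If all superlevel sets are flats, then the values of the weight function occur on a base. -/
theorem exists_mem_subspace_of_notMem [Finite α] (hw : w ∉ M.nonflatWeights) :
    ∃ p : BaseRetraction M, (∀ i ∈ M.E, p.1.2 i ∈ p.1.1) ∧ w ∈ p.subspace := by
  obtain ⟨R, hRE, hR⟩ := Set.exists_subset_bijOn M.E w
  have hind : M.Indep R := by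
    by_contra hcon
    obtain ⟨C, hCR, hC⟩ := ((M.not_indep_iff hRE).1 hcon).exists_isCircuit_subset
    obtain ⟨e, he, hmin⟩ := Set.exists_min_image C w C.toFinite hC.nonempty
    refine hw ⟨{i ∈ M.E | w e < w i}, fun i hi => hi.1, fun h => ?_, ?_⟩
    · have hsub : C \ {e} ⊆ {i ∈ M.E | w e < w i} := by
        rintro i ⟨hi, hie⟩
        refine ⟨hRE (hCR hi), lt_of_le_of_ne (hmin i hi) fun h' => hie ?_⟩
        exact (hR.injOn (hCR he) (hCR hi) h').symm
      have := M.closure_mono hsub (hC.mem_closure_sdiff_singleton_of_mem he)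
      rw [h] at this
      exact lt_irrefl _ this.2
    · rintro i ⟨-, hi⟩ j ⟨hj, hj'⟩
      have : ¬ w e < w j := fun h => hj' ⟨hj, h⟩
      exact (not_lt.1 this).trans_lt hi
  obtain ⟨B, hB, hRB⟩ := hind.exists_isBase_superset
  have : ∀ i, ∃ r, i ∈ M.E → r ∈ R ∧ w r = w i := by
    intro i
    by_cases hi : i ∈ M.E
    · obtain ⟨r, hr, h⟩ := hR.surjOn ⟨i, hi, rfl⟩
      exact ⟨r, fun _ => ⟨hr, h⟩⟩
    · exact ⟨i, fun h => absurd h hi⟩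
  choose φ hφ using this
  exact ⟨⟨(B, φ), hB⟩, fun i hi => hRB (hφ i hi).1, fun i hi => (hφ i hi.1).2.symm⟩

/-- The retractions which do send the ground set to the base. -/
def BaseRetraction.Proper (M : Matroid α) : Type _ :=
  {p : BaseRetraction M // ∀ i ∈ M.E, p.1.2 i ∈ p.1.1}

instance [Finite α] : Finite (BaseRetraction.Proper M) := inferInstanceAs (Finite (Subtype _))

theorem BaseRetraction.finrank_subspace_add [Fintype α] (p : BaseRetraction M)
    (hp : ∀ i ∈ M.E, p.1.2 i ∈ p.1.1) :
    Module.finrank ℝ p.subspace + (M.E \ p.1.1).ncard ≤ Fintype.card α := by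
  classical
  let S : Set α := M.E \ p.1.1
  let f : p.subspace →ₗ[ℝ] (↥Sᶜ → ℝ) :=
    (LinearMap.funLeft ℝ ℝ (Subtype.val : ↥Sᶜ → α)).comp p.subspace.subtype
  have hf : Injective f := by
    rw [← LinearMap.ker_eq_bot, LinearMap.ker_eq_bot']
    rintro ⟨w, hw⟩ h0
    have h1 : ∀ i ∉ S, w i = 0 := fun i hi => congrFun h0 ⟨i, hi⟩
    ext i
    by_cases hi : i ∈ S
    · exact (hw i hi).trans (h1 _ fun h => h.2 (hp i hi.1))
    · exact h1 i hi
  have h1 := LinearMap.finrank_le_finrank_of_injective hf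
  rw [Module.finrank_fintype_fun_eq_card] at h1
  have h2 : Fintype.card ↥Sᶜ = Sᶜ.ncard := by rw [← Nat.card_coe_set_eq, Nat.card_eq_fintype_card]
  have h3 := Set.ncard_add_ncard_compl S
  rw [Nat.card_eq_fintype_card] at h3
  change _ + S.ncard ≤ _
  omega

theorem ncard_sdiff_isBase_eq [Finite α] {B B' : Set α} (h : M.IsBase B) (h' : M.IsBase B') :
    (M.E \ B).ncard = (M.E \ B').ncard := by
  have h1 := Set.ncard_sdiff_add_ncard_of_subset h.subset_ground
  have h2 := Set.ncard_sdiff_add_ncard_of_subset h'.subset_ground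
  rw [h.ncard_eq_ncard_of_isBase h'] at h1
  omega

/-- The weights having a superlevel set which is not a flat form a wedge of spheres. -/
theorem exists_hEquiv_nonflatWeights [Fintype α] (m : ℕ) : ∀ (M : Matroid α), M.E.ncard = m →
    ∀ (d : ℕ) (B : Set α), M.IsBase B → (M.E \ B).ncard = d + 1 →
      ∃ (ι : Type) (_ : Finite ι), HEquiv M.nonflatWeights (CubeWedge d ι) := by
  classical
  induction m with
  | zero =>
    intro M hm d B hB hd
    have := Set.ncard_le_ncard (Set.sdiff_subset (s := M.E) (t := B)) (Set.toFinite _)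
    omega
  | succ m ih =>
    intro M hm d B hB hd
    by_cases hloop : ∃ a, a ∈ M.closure ∅
    · obtain ⟨a, ha⟩ := hloop
      refine ⟨Empty, inferInstance, ?_⟩
      rw [nonflatWeights_eq_univ ha]
      refine (HEquiv.of_homeo (Homeomorph.Set.univ _)).trans ?_
      have : Unique (CubeWedge d Empty) := ⟨inferInstance, fun y => by
        induction y using CubeWedge.induction with
        | hb => rfl
        | hc j => exact j.elim⟩
      exact ContractibleSpace.hequiv _ _
    push Not at hloop
    obtain ⟨a, haE, haB⟩ : (M.E \ B).Nonempty := by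
      rw [← Set.ncard_pos]; omega
    have hdelE : (M.delete {a}).E.ncard = m := by
      rw [delete_ground, Set.ncard_sdiff_singleton_of_mem haE, hm]; rfl
    have hconE : (M.contract {a}).E.ncard = m := hdelE
    have hBsub : B ⊆ M.E \ {a} :=
      Set.subset_sdiff_singleton hB.subset_ground haB
    have hBdel : (M.delete {a}).IsBase B := by
      rw [delete_isBase_iff]
      exact hB.isBasis_of_subset (hX := Set.sdiff_subset) hBsub
    have hBdelc : ((M.delete {a}).E \ B).ncard = d := by
      have : (M.delete {a}).E \ B = (M.E \ B) \ {a} := by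
        rw [delete_ground, Set.sdiff_sdiff_comm]
      have hmem : a ∈ M.E \ B := ⟨haE, haB⟩
      rw [this, Set.ncard_sdiff_singleton_of_mem hmem, hd]; rfl
    have hanl : M.Indep {a} := by
      rw [indep_singleton, ← not_isLoop_iff haE, isLoop_iff]
      exact hloop a
    obtain ⟨B', hB', haB'⟩ := hanl.exists_isBase_superset
    rw [Set.singleton_subset_iff] at haB'
    have hBcon : (M.contract {a}).IsBase (B' \ {a}) := by
      rw [hanl.contract_isBase_iff]
      refine ⟨?_, Set.disjoint_sdiff_left⟩
      rwa [Set.sdiff_union_of_subset (Set.singleton_subset_iff.2 haB')]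
    have hBconc : ((M.contract {a}).E \ (B' \ {a})).ncard = d + 1 := by
      have : (M.contract {a}).E \ (B' \ {a}) = M.E \ B' := by
        rw [contract_ground]
        ext i
        simp only [Set.mem_sdiff, Set.mem_singleton_iff, not_and, not_not]
        constructor
        · rintro ⟨⟨h1, h2⟩, h3⟩
          exact ⟨h1, fun h => h2 (h3 h)⟩
        · rintro ⟨h1, h2⟩
          exact ⟨⟨h1, fun h => h2 (h ▸ haB')⟩, fun h => absurd h h2⟩
      rw [this, ncard_sdiff_isBase_eq hB' hB, hd]
    have hacl : a ∈ M.closure (M.E \ {a}) := by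
      refine M.closure_mono hBsub ?_
      rwa [hB.closure_eq]
    obtain ⟨v, hvc, hv⟩ := exists_threshold hacl (hloop a)
    have hva : ∀ w c, v (update w a c) = v w := by
      intro w c
      have key : ∀ t, t ≤ v (update w a c) ↔ t ≤ v w := by
        intro t
        rw [hv, hv]
        have : (M.delete {a}).superlevel (update w a c) t = (M.delete {a}).superlevel w t := by
          ext i
          refine and_congr_right fun hi => ?_
          rw [update_of_ne hi.2]
        rw [this]
      exact le_antisymm ((key _).1 le_rfl) ((key _).2 le_rfl)
    have haD : a ∉ (M.delete {a}).E := by simp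
    have haC : a ∉ (M.contract {a}).E := by simp
    have hcone := hEquiv_threshold a v hvc
      (isOpen_nonflatWeights (M := M.delete {a})) nonflatWeights_delete_subset hva
      (update_mem_nonflatWeights haD) (update_mem_nonflatWeights haC)
      (mem_nonflatWeights_iff_threshold haE hv)
    obtain ⟨ι, hι, hX⟩ := ih _ hconE d _ hBcon hBconc
    rcases d with _ | d
    · have : IsEmpty (M.delete {a}).nonflatWeights := by
        rw [nonflatWeights_eq_empty, Set.isEmpty_coe_sort]
        have : (M.delete {a}).E = B := by
          refine Set.Subset.antisymm ?_ hBdel.subset_ground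
          rw [← Set.sdiff_eq_empty, ← Set.ncard_eq_zero, hBdelc]
        rw [this]
        exact hBdel.indep
      exact ⟨ι ⊕ Unit, inferInstance, hcone.trans (CubeWedge.hEquiv_mcone_empty _ hX)⟩
    · obtain ⟨ι', hι', hA⟩ := ih _ hdelE d _ hBdel hBdelc
      refine ⟨ι ⊕ ι', inferInstance, hcone.trans ?_⟩
      refine hEquiv_mcone_inclusion
        (fun p : BaseRetraction.Proper (M.contract {a}) => p.1.subspace)
        isOpen_nonflatWeights ?_ ?_ _ hA hX
      · intro w hw
        obtain ⟨p, hp, h⟩ := exists_mem_subspace_of_notMem hw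
        exact ⟨⟨p, hp⟩, h⟩
      · intro p
        have h1 := p.1.finrank_subspace_add p.2
        rw [ncard_sdiff_isBase_eq p.1.2 hBcon, hBconc] at h1
        rw [Module.finrank_fintype_fun_eq_card]
        omega

end Matroid

theorem add_smul_mem_posSpan {V : Type*} [AddCommGroup V] [Module ℝ V] {s : Set V} {x v : V}
    (hx : x ∈ posSpan s) (hv : v ∈ s) {t : ℝ} (ht : 0 ≤ t) : x + t • v ∈ posSpan s := by
  classical
  obtain ⟨T, c, hT, hc, rfl⟩ := hx
  refine ⟨insert v T, fun u => (if u ∈ T then c u else 0) + (if u = v then t else 0), ?_, ?_, ?_⟩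
  · rw [Finset.coe_insert]
    exact Set.insert_subset hv hT
  · intro u
    have := hc u
    positivity
  · simp only [add_smul, ite_smul, zero_smul, Finset.sum_add_distrib]
    rw [Finset.sum_ite_eq' (insert v T) v, if_pos (Finset.mem_insert_self _ _)]
    congr 1
    rw [← Finset.sum_filter]
    congr 1
    ext u
    simp +contextual

theorem posSpan_mono {V : Type*} [AddCommGroup V] [Module ℝ V] {s t : Set V} (h : s ⊆ t) :
    posSpan s ⊆ posSpan t := by
  rintro x ⟨T, c, hT, hc, rfl⟩
  exact ⟨T, c, hT.trans h, hc, rfl⟩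

theorem mrk_univ_eq {n : ℕ} {M : Matroid (Fin n)} {B : Set (Fin n)} (hB : M.IsBase B) :
    mrk M Set.univ = B.ncard := by
  refine IsGreatest.csSup_eq ⟨⟨B, hB.indep, Set.subset_univ _, rfl⟩, ?_⟩
  rintro k ⟨I, hI, -, rfl⟩
  obtain ⟨B', hB', hIB⟩ := hI.exists_isBase_superset
  rw [hB.ncard_eq_ncard_of_isBase hB']
  exact Set.ncard_le_ncard hIB B'.toFinite

section Link

variable {n : ℕ} {V : Type*} [AddCommGroup V] [Module ℝ V] {M : Matroid (Fin n)} {e : Fin n → V}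

theorem linearCombination_indicator (S : Set (Fin n)) :
    Fintype.linearCombination ℝ e (S.indicator 1) = eVec e S := by
  classical
  rw [eVec, finsum_mem_eq_finite_toFinset_sum _ S.toFinite, Fintype.linearCombination_apply]
  simp only [Set.indicator_apply, Pi.one_apply, ite_smul, one_smul, zero_smul]
  rw [← Finset.sum_filter]
  congr 1
  ext i
  simp

theorem linearCombination_const (hsum : ∑ i, e i = 0) (c : ℝ) :
    Fintype.linearCombination ℝ e (fun _ => c) = 0 := by
  rw [Fintype.linearCombination_apply, ← Finset.smul_sum, hsum, smul_zero]

theorem exists_const_of_linearCombination_eq_zero (hsum : ∑ i, e i = 0)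
    (hind : ∀ s : Finset (Fin n), s ≠ Finset.univ → LinearIndependent ℝ (fun i : ↥s => e ↑i))
    {w : Fin n → ℝ} (hw : Fintype.linearCombination ℝ e w = 0) : ∃ c, w = fun _ => c := by
  classical
  cases isEmpty_or_nonempty (Fin n)
  · exact ⟨0, Subsingleton.elim _ _⟩
  obtain ⟨i₀⟩ := ‹Nonempty (Fin n)›
  have h1 : Fintype.linearCombination ℝ e (w - fun _ => w i₀) = 0 := by
    rw [map_sub, hw, linearCombination_const hsum, sub_zero]
  rw [Fintype.linearCombination_apply, ← Finset.add_sum_erase _ _ (Finset.mem_univ i₀)] at h1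
  simp only [Pi.sub_apply, sub_self, zero_smul, zero_add] at h1
  have h2 := hind (Finset.univ.erase i₀) (by simp)
  rw [Fintype.linearIndependent_iff] at h2
  have h3 := h2 (fun i => w i - w i₀) (by
    rw [← h1]
    exact Finset.sum_coe_sort (Finset.univ.erase i₀) fun i => (w i - w i₀) • e i)
  refine ⟨w i₀, funext fun i => ?_⟩
  by_cases hi : i = i₀
  · rw [hi]
  · have := h3 ⟨i, by simp [hi]⟩
    simpa [sub_eq_zero] using this

theorem superlevel_univ (hE : M.E = Set.univ) (w : Fin n → ℝ) (c : ℝ) :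
    M.superlevel w c = {i | c ≤ w i} := by
  simp [Matroid.superlevel, hE]

/-- Weights all of whose superlevel sets are flats are mapped into the Bergman fan. -/
theorem mem_posSpan_of_forall_isFlat (hE : M.E = Set.univ) (hsum : ∑ i, e i = 0) (k : ℕ) :
    ∀ w : Fin n → ℝ, (Finset.univ.image w).card = k → w ∉ M.nonflatWeights →
      Fintype.linearCombination ℝ e w ∈
        posSpan (eVec e '' (Set.range (M.superlevel w) ∩ properFlats M)) := by
  classical
  induction k using Nat.strong_induction_on with
  | _ k ih =>
    intro w hk hw
    by_cases hconst : ∃ c, w = fun _ => c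
    · obtain ⟨c, rfl⟩ := hconst
      rw [linearCombination_const hsum]
      exact ⟨∅, 0, by simp, fun _ => le_rfl, by simp⟩
    have hne : Nonempty (Fin n) := by
      by_contra h
      rw [not_nonempty_iff] at h
      exact hconst ⟨0, Subsingleton.elim _ _⟩
    obtain ⟨a, -, ha⟩ := Finset.exists_min_image Finset.univ w Finset.univ_nonempty
    have hS : ({i | w a < w i} : Finset (Fin n)).Nonempty := by
      by_contra h
      refine hconst ⟨w a, funext fun i => le_antisymm ?_ (ha i (Finset.mem_univ i))⟩
      by_contra h'
      exact h ⟨i, by simpa using h'⟩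
    obtain ⟨b, hb, hbmin⟩ := Finset.exists_min_image _ w hS
    rw [Finset.mem_filter_univ] at hb
    have hcases : ∀ i, w i = w a ∨ w b ≤ w i := by
      intro i
      rcases (ha i (Finset.mem_univ i)).eq_or_lt with h | h
      · exact .inl h.symm
      · exact .inr (hbmin i (by simpa using h))
    set w' : Fin n → ℝ := fun i => max (w i) (w b) with hw'
    have hsl : ∀ c, M.superlevel w' c = Set.univ ∨ M.superlevel w' c = M.superlevel w c := by
      intro c
      rw [superlevel_univ hE, superlevel_univ hE]
      rcases le_or_gt c (w b) with h | h
      · left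
        ext i
        simp [hw', h]
      · right
        ext i
        simp [hw', h.not_ge]
    have hw'U : w' ∉ M.nonflatWeights := by
      rw [Matroid.notMem_nonflatWeights] at hw ⊢
      intro c
      rcases hsl c with h | h
      · rw [h, ← hE]; exact M.closure_ground
      · rw [h]; exact hw c
    have hlt : (Finset.univ.image w').card < k := by
      rw [← hk]
      refine Finset.card_lt_card (Finset.ssubset_iff_subset_ne.2 ⟨?_, fun h => ?_⟩)
      · intro x hx
        obtain ⟨i, -, rfl⟩ := Finset.mem_image.1 hx
        rcases max_choice (w i) (w b) with h | h
        · exact Finset.mem_image.2 ⟨i, Finset.mem_univ _, h.symm⟩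
        · exact Finset.mem_image.2 ⟨b, Finset.mem_univ _, h.symm⟩
      · have : w a ∈ Finset.univ.image w' := by
          rw [h]; exact Finset.mem_image_of_mem _ (Finset.mem_univ _)
        obtain ⟨i, -, hi⟩ := Finset.mem_image.1 this
        have : w b ≤ w' i := le_max_right _ _
        linarith
    have h1 := ih _ hlt w' rfl hw'U
    have h2 : w = w' + (w b - w a) • ((M.superlevel w (w b)).indicator 1 - fun _ => (1 : ℝ)) := by
      ext i
      rw [superlevel_univ hE]
      rcases hcases i with h | h
      · simp [hw', h, hb.le, hb.not_ge]
      · simp [hw', h]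
    have h3 : Fintype.linearCombination ℝ e w = Fintype.linearCombination ℝ e w' +
        (w b - w a) • eVec e (M.superlevel w (w b)) := by
      conv_lhs => rw [h2]
      rw [map_add, map_smul, map_sub, linearCombination_indicator, linearCombination_const hsum,
        sub_zero]
    rw [h3]
    refine add_smul_mem_posSpan (posSpan_mono (Set.image_mono ?_) h1) (Set.mem_image_of_mem _ ?_)
      (sub_nonneg.2 hb.le)
    · rintro _ ⟨⟨c, rfl⟩, hc⟩
      refine ⟨⟨c, ?_⟩, hc⟩
      exact ((hsl c).resolve_left hc.2.2).symm
    · refine ⟨⟨_, rfl⟩, Matroid.notMem_nonflatWeights.1 hw _, ⟨b, ?_⟩, fun h => ?_⟩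
      · rw [superlevel_univ hE]; exact le_rfl (a := w b)
      · have : a ∈ M.superlevel w (w b) := by rw [h]; trivial
        exact hb.not_ge this.2

theorem linearCombination_notMem_bergmanFan (hE : M.E = Set.univ) (hLoopless : M.closure ∅ = ∅)
    (hsum : ∑ i, e i = 0)
    (hind : ∀ s : Finset (Fin n), s ≠ Finset.univ → LinearIndependent ℝ (fun i : ↥s => e ↑i))
    (w : Fin n → ℝ) :
    Fintype.linearCombination ℝ e w ∉ bergmanFan M e ↔ w ∈ M.nonflatWeights := by
  classical
  rw [← not_iff_not, not_not]
  constructor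
  · intro hw
    simp only [bergmanFan, Set.mem_iUnion] at hw
    obtain ⟨C, ⟨hC, hchain⟩, T, c, hT, hc, hw⟩ := hw
    have hT' : ∀ v, ∃ F, v ∈ T → F ∈ C ∧ eVec e F = v := by
      intro v
      by_cases hv : v ∈ T
      · obtain ⟨F, hF⟩ := hT hv
        exact ⟨F, fun _ => hF⟩
      · exact ⟨∅, fun h => absurd h hv⟩
    choose F hF using hT'
    set w₀ : Fin n → ℝ := ∑ v ∈ T, c v • (F v).indicator 1 with hw₀
    have h0 : Fintype.linearCombination ℝ e w₀ = Fintype.linearCombination ℝ e w := by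
      rw [hw, hw₀, map_sum]
      refine Finset.sum_congr rfl fun v hv => ?_
      rw [map_smul, linearCombination_indicator, (hF v hv).2]
    obtain ⟨k, hk⟩ := exists_const_of_linearCombination_eq_zero hsum hind
      (w := w - w₀) (by rw [map_sub, h0, sub_self])
    rw [Matroid.notMem_nonflatWeights]
    intro t
    refine Set.Subset.antisymm (fun x hx => ?_)
      (M.subset_closure _ (Matroid.superlevel_subset_ground t))
    by_contra hxS
    have hlt : ∀ y ∈ M.superlevel w t, ∃ v ∈ T, y ∈ F v ∧ x ∉ F v := by
      intro y hy
      by_contra! hcon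
      apply hxS
      rw [superlevel_univ hE] at hy ⊢
      refine le_trans (b := w y) hy ?_
      have h1 := congrFun hk x
      have h2 := congrFun hk y
      have h3 : w₀ y ≤ w₀ x := by
        rw [hw₀]
        simp only [Finset.sum_apply, Pi.smul_apply, smul_eq_mul]
        refine Finset.sum_le_sum fun v hv => mul_le_mul_of_nonneg_left ?_ (hc v)
        by_cases hy : y ∈ F v
        · rw [Set.indicator_of_mem hy, Set.indicator_of_mem (hcon v hv hy)]
          rfl
        · rw [Set.indicator_of_notMem hy]
          exact Set.indicator_nonneg (fun _ _ => zero_le_one) _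
      simp only [Pi.sub_apply] at h1 h2
      linarith
    have hne : (M.superlevel w t).Nonempty := by
      rw [Set.nonempty_iff_ne_empty]
      intro h
      rw [h, hLoopless] at hx
      exact hx
    obtain ⟨y₀, hy₀⟩ := hne
    obtain ⟨v₀, hv₀, -, hx₀⟩ := hlt y₀ hy₀
    obtain ⟨v, hv, hmax⟩ := Finset.exists_max_image (T.filter fun v => x ∉ F v)
      (fun v => (F v).ncard) ⟨v₀, Finset.mem_filter.2 ⟨hv₀, hx₀⟩⟩
    rw [Finset.mem_filter] at hv
    have hsub : M.superlevel w t ⊆ F v := by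
      intro y hy
      obtain ⟨v', hv', hyv', hxv'⟩ := hlt y hy
      rcases hchain.total (hF v' hv').1 (hF v hv.1).1 with h | h
      · exact h hyv'
      · rwa [Set.eq_of_subset_of_ncard_le h (hmax v' (Finset.mem_filter.2 ⟨hv', hxv'⟩))
          (Set.toFinite _)]
    have := M.closure_mono hsub hx
    rw [(hC (hF v hv.1).1).1] at this
    exact hv.2 this
  · intro hw
    simp only [bergmanFan, Set.mem_iUnion]
    refine ⟨_, ⟨Set.inter_subset_right, ?_⟩, mem_posSpan_of_forall_isFlat hE hsum _ w rfl hw⟩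
    rintro _ ⟨⟨c, rfl⟩, -⟩ _ ⟨⟨c', rfl⟩, -⟩ -
    rcases le_total c c' with h | h
    · exact .inr (Matroid.superlevel_anti h)
    · exact .inl (Matroid.superlevel_anti h)

end Link

section Complement

variable {n r : ℕ} {M : Matroid (Fin n)} {V : Type*} [NormedAddCommGroup V] [NormedSpace ℝ V]
  [FiniteDimensional ℝ V] {e : Fin n → V}

theorem linearCombination_surjective (hV : Module.finrank ℝ V = n - 1) (hsum : ∑ i, e i = 0)
    (hind : ∀ s : Finset (Fin n), s ≠ Finset.univ → LinearIndependent ℝ (fun i : ↥s => e ↑i)) :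
    Surjective (Fintype.linearCombination ℝ e) := by
  rw [← LinearMap.range_eq_top]
  refine Submodule.eq_top_of_finrank_eq (le_antisymm (Submodule.finrank_le _) ?_)
  have h1 := LinearMap.finrank_range_add_finrank_ker (Fintype.linearCombination ℝ e)
  have h2 : Module.finrank ℝ (LinearMap.ker (Fintype.linearCombination ℝ e)) ≤ 1 := by
    refine (Submodule.finrank_mono (t := Submodule.span ℝ {fun _ => (1 : ℝ)}) ?_).trans
      ((finrank_span_le_card ({fun _ => (1 : ℝ)} : Set (Fin n → ℝ))).trans (by simp))
    intro w hw
    obtain ⟨c, rfl⟩ := exists_const_of_linearCombination_eq_zero hsum hind hw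
    exact Submodule.mem_span_singleton.2 ⟨c, by ext; simp⟩
  rw [Module.finrank_fin_fun] at h1
  omega

theorem hEquiv_compl_bergmanFan
    (hE : M.E = Set.univ) (hLoopless : M.closure ∅ = ∅)
    (hV : Module.finrank ℝ V = n - 1) (hsum : ∑ i, e i = 0)
    (hind : ∀ s : Finset (Fin n), s ≠ Finset.univ → LinearIndependent ℝ (fun i : ↥s => e ↑i)) :
    HEquiv ((bergmanFan M e)ᶜ : Set V) M.nonflatWeights := by
  obtain ⟨s, hs⟩ := (Fintype.linearCombination ℝ e).exists_rightInverse_of_surjective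
    (LinearMap.range_eq_top.2 (linearCombination_surjective hV hsum hind))
  have hs' : ∀ y, Fintype.linearCombination ℝ e (s y) = y := fun y => LinearMap.congr_fun hs y
  have key := linearCombination_notMem_bergmanFan hE hLoopless hsum hind
  let f : C(((bergmanFan M e)ᶜ : Set V), M.nonflatWeights) :=
    ⟨fun y => ⟨s y, (key _).1 (by rw [hs']; exact y.2)⟩,
      (s.continuous_of_finiteDimensional.comp continuous_subtype_val).subtype_mk _⟩
  let g : C(M.nonflatWeights, ((bergmanFan M e)ᶜ : Set V)) :=
    ⟨fun w => ⟨Fintype.linearCombination ℝ e w, (key _).2 w.2⟩,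
      ((Fintype.linearCombination ℝ e).continuous_of_finiteDimensional.comp
        continuous_subtype_val).subtype_mk _⟩
  refine ⟨⟨f, g, ?_, ?_⟩⟩
  · have : g.comp f = .id _ := by
      ext y
      exact hs' y
    rw [this]
  · refine homotopic_of_segment _ _ fun w t _ => (key _).1 ?_
    have : Fintype.linearCombination ℝ e ((f.comp g w : Fin n → ℝ) + t • ((w : Fin n → ℝ) -
        (f.comp g w : Fin n → ℝ))) = Fintype.linearCombination ℝ e w := by
      have h1 : Fintype.linearCombination ℝ e (f.comp g w : Fin n → ℝ) =
        Fintype.linearCombination ℝ e w := hs' _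
      rw [map_add, map_smul, map_sub, h1, sub_self, smul_zero, add_zero]
    change Fintype.linearCombination ℝ e ((f.comp g w : Fin n → ℝ) + t • ((w : Fin n → ℝ) -
        (f.comp g w : Fin n → ℝ))) ∉ _
    rw [this]
    exact (key _).2 w.2

theorem kConn_compl_bergmanFan
    (hE : M.E = Set.univ) (hLoopless : M.closure ∅ = ∅)
    (hV : Module.finrank ℝ V = n - 1) (hsum : ∑ i, e i = 0)
    (hind : ∀ s : Finset (Fin n), s ≠ Finset.univ → LinearIndependent ℝ (fun i : ↥s => e ↑i))
    (hrank : mrk M Set.univ = r) (hrn : r < n) :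
    KConn ((bergmanFan M e)ᶜ : Set V) ((n : ℤ) - (r : ℤ) - 2) := by
  obtain ⟨s, hs⟩ := (Fintype.linearCombination ℝ e).exists_rightInverse_of_surjective
    (LinearMap.range_eq_top.2 (linearCombination_surjective hV hsum hind))
  have hs' : ∀ y, Fintype.linearCombination ℝ e (s y) = y := fun y => LinearMap.congr_fun hs y
  have key := linearCombination_notMem_bergmanFan hE hLoopless hsum hind
  have hpre : ((bergmanFan M e)ᶜ : Set V) = s ⁻¹' M.nonflatWeights := by
    ext y
    rw [Set.mem_preimage, ← key, hs', Set.mem_compl_iff]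
  refine kConn_of_codim (fun p : Matroid.BaseRetraction.Proper M =>
    p.1.subspace.map (Fintype.linearCombination ℝ e)) ?_ ?_ _ (by omega) ?_
  · rw [hpre]
    exact Matroid.isOpen_nonflatWeights.preimage s.continuous_of_finiteDimensional
  · intro y hy
    rw [hpre, Set.mem_preimage] at hy
    obtain ⟨p, hp, h⟩ := Matroid.exists_mem_subspace_of_notMem hy
    exact ⟨⟨p, hp⟩, s y, h, hs' y⟩
  · intro p
    have h1 := p.1.finrank_subspace_add p.2
    have h2 := Set.ncard_sdiff_add_ncard_of_subset p.1.2.subset_ground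
    rw [← mrk_univ_eq p.1.2, hrank] at h2
    have h3 : M.E.ncard = n := by rw [hE, Set.ncard_univ, Nat.card_fin]
    rw [Fintype.card_fin] at h1
    set L := p.1.subspace
    have h4 := LinearMap.finrank_range_add_finrank_ker
      ((Fintype.linearCombination ℝ e).domRestrict L)
    rw [LinearMap.range_domRestrict] at h4
    have h5 : 0 < Module.finrank ℝ
        (LinearMap.ker ((Fintype.linearCombination ℝ e).domRestrict L)) := by
      have hone : (fun _ => (1 : ℝ)) ∈ L := fun _ _ => rfl
      have hmem : (⟨fun _ => 1, hone⟩ : L) ∈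
          LinearMap.ker ((Fintype.linearCombination ℝ e).domRestrict L) :=
        linearCombination_const hsum 1
      refine (Module.finrank_pos_iff_exists_ne_zero (R := ℝ)
        (M := LinearMap.ker ((Fintype.linearCombination ℝ e).domRestrict L))).2
        ⟨⟨_, hmem⟩, fun h => ?_⟩
      have : (fun _ : Fin n => (1 : ℝ)) = 0 := congrArg (fun x => x.1.1) h
      exact one_ne_zero (congrFun this ⟨r, hrn⟩)
    omega

theorem exists_hEquiv_cubeWedge
    (hE : M.E = Set.univ) (hLoopless : M.closure ∅ = ∅)
    (hV : Module.finrank ℝ V = n - 1) (hsum : ∑ i, e i = 0)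
    (hind : ∀ s : Finset (Fin n), s ≠ Finset.univ → LinearIndependent ℝ (fun i : ↥s => e ↑i))
    (hrank : mrk M Set.univ = r) (hrn : r < n) :
    ∃ k : ℕ, HEquiv ((bergmanFan M e)ᶜ : Set V) (CubeWedge (n - r - 1) (Fin k)) := by
  obtain ⟨B, hB⟩ := M.exists_isBase
  have hBc : (M.E \ B).ncard = n - r - 1 + 1 := by
    have h1 := Set.ncard_sdiff_add_ncard_of_subset hB.subset_ground
    rw [← mrk_univ_eq hB, hrank, hE, Set.ncard_univ, Nat.card_fin] at h1
    rw [hE]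
    omega
  obtain ⟨ι, _, h⟩ := Matroid.exists_hEquiv_nonflatWeights _ M rfl _ B hB hBc
  obtain ⟨k, ⟨f⟩⟩ := Finite.exists_equiv_fin ι
  exact ⟨k, ((hEquiv_compl_bergmanFan hE hLoopless hV hsum hind).trans h).trans
    (HEquiv.of_homeo (CubeWedge.congr f))⟩

end Complement

namespace CubeWedge

variable {d : ℕ} {ι X : Type*} [TopologicalSpace X] [T2Space X]

/-- A compact space is a wedge of cubes as soon as the complement of a point is a disjoint union
of copies of `ℝ^d`, parametrized in homogeneous coordinates `(m, Z)` by maps extending to the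
hyperplane at infinity `m = 0`, which is sent to the point. -/
theorem nonempty_homeomorph_of_homogeneous [Finite ι] (b : X) (Φ : ι → ℝ → (Fin d → ℝ) → X)
    (hΦ : ∀ j, Continuous fun Z : Fin d → ℝ => Φ j (max 0 (1 - ‖Z‖)) Z)
    (hsmul : ∀ j (m : ℝ) v, 0 < m → Φ j m (m • v) = Φ j 1 v)
    (hzero : ∀ j Z, Z ≠ 0 → Φ j 0 Z = b)
    (hne : ∀ j v, Φ j 1 v ≠ b)
    (hinj : ∀ j j' v v', Φ j 1 v = Φ j' 1 v' → j = j' ∧ v = v')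
    (hsurj : ∀ p, p ≠ b → ∃ j v, Φ j 1 v = p) : Nonempty (CubeWedge d ι ≃ₜ X) := by
  have hcont : Continuous fun z : Fin d → ℝ => (fun i => 2 * z i - 1 : Fin d → ℝ) := by fun_prop
  have hbd : ∀ j (z : Fin d → ℝ), 1 ≤ cubeNorm z →
      Φ j (max 0 (1 - cubeNorm z)) (fun i => 2 * z i - 1) = b := by
    intro j z hz
    rw [max_eq_left (by linarith)]
    refine hzero j _ fun h => ?_
    rw [cubeNorm, h, norm_zero] at hz
    linarith
  have hin : ∀ j (z : Fin d → ℝ), cubeNorm z < 1 →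
      Φ j (max 0 (1 - cubeNorm z)) (fun i => 2 * z i - 1) =
        Φ j 1 ((1 - cubeNorm z)⁻¹ • fun i => 2 * z i - 1) := by
    intro j z hz
    have hpos : 0 < 1 - cubeNorm z := by linarith
    rw [max_eq_right hpos.le, ← hsmul j _ _ hpos, smul_inv_smul₀ hpos.ne']
  let F : C(CubeWedge d ι, X) := desc b
    (fun j z => Φ j (max 0 (1 - cubeNorm z)) (fun i => 2 * z i - 1))
    (fun j => (hΦ j).comp hcont)
    (fun j z _ hz => hbd j z (by
      obtain ⟨i, h⟩ := hz
      exact one_le_cubeNorm_of (i := i) (h.imp le_of_eq ge_of_eq)))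
  have hFb : F (base d ι) = b := desc_base ..
  have hFc : ∀ j z, cubeNorm z < 1 →
      F (cell j z) = Φ j 1 ((1 - cubeNorm z)⁻¹ • fun i => 2 * z i - 1) := fun j z hz => by
    rw [← hin j z hz]
    exact desc_cell j (cubeNorm_le_one.1 hz.le)
  have hcases : ∀ x : CubeWedge d ι, x = base d ι ∨ ∃ j z, cubeNorm z < 1 ∧ x = cell j z := by
    intro x
    induction x using CubeWedge.induction with
    | hb => exact .inl rfl
    | hc j z hz =>
      rcases lt_or_ge (cubeNorm z) 1 with h | h
      · exact .inr ⟨j, z, h, rfl⟩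
      · exact .inl (cell_eq_base j h)
  have hbij : Bijective F := by
    constructor
    · intro x y hxy
      obtain rfl | ⟨j, z, hz, rfl⟩ := hcases x <;> obtain rfl | ⟨j', z', hz', rfl⟩ := hcases y
      · rfl
      · rw [hFb, hFc _ _ hz'] at hxy
        exact absurd hxy.symm (hne _ _)
      · rw [hFb, hFc _ _ hz] at hxy
        exact absurd hxy (hne _ _)
      · rw [hFc _ _ hz, hFc _ _ hz'] at hxy
        obtain ⟨rfl, h⟩ := hinj _ _ _ _ hxy
        have h0 : 0 < 1 - cubeNorm z := by linarith
        have h0' : 0 < 1 - cubeNorm z' := by linarith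
        have h1 := congrArg norm h
        rw [norm_smul, norm_smul, norm_inv, norm_inv, Real.norm_of_nonneg h0.le,
          Real.norm_of_nonneg h0'.le] at h1
        change (1 - cubeNorm z)⁻¹ * cubeNorm z = (1 - cubeNorm z')⁻¹ * cubeNorm z' at h1
        have h2 : cubeNorm z = cubeNorm z' := by
          field_simp at h1
          linarith
        rw [h2] at h
        have h3 := smul_right_injective (Fin d → ℝ) (inv_ne_zero h0'.ne') h
        have : z = z' := by
          ext i
          have := congrFun h3 i
          linarith
        rw [this]
    · intro p
      by_cases hp : p = b
      · exact ⟨base d ι, hp ▸ hFb⟩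
      · obtain ⟨j, v, rfl⟩ := hsurj p hp
        have hpos : 0 < 1 + ‖v‖ := by positivity
        set z : Fin d → ℝ := fun i => 1 / 2 + ((1 + ‖v‖)⁻¹ • v) i / 2 with hz
        have h1 : (fun i => 2 * z i - 1) = (1 + ‖v‖)⁻¹ • v := by
          ext i
          simp only [hz]
          ring
        have h2 : cubeNorm z = (1 + ‖v‖)⁻¹ * ‖v‖ := by
          rw [cubeNorm, h1, norm_smul, norm_inv, Real.norm_of_nonneg hpos.le]
        have h3 : 1 - cubeNorm z = (1 + ‖v‖)⁻¹ := by
          rw [h2]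
          field_simp
          ring
        have h4 : 0 < (1 + ‖v‖)⁻¹ := by positivity
        refine ⟨cell j z, ?_⟩
        rw [hFc _ _ (by linarith), h1, h3, inv_inv, smul_inv_smul₀ hpos.ne']
  exact ⟨F.continuous.homeoOfEquivCompactToT2 (f := Equiv.ofBijective F hbij)⟩

end CubeWedge

theorem mem_wedgeOfSpheres {d k : ℕ} {p : EuclideanSpace ℝ (Fin (d + 1))} :
    p ∈ wedgeOfSpheres d k ↔
      p = 0 ∨ ∃ i : Fin k, p 0 ^ 2 + ∑ l : Fin d, p l.succ ^ 2 = 2 * ((i : ℝ) + 1) * p 0 := by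
  have key : ∀ c : ℝ, 0 ≤ c →
      (p ∈ Metric.sphere (c • EuclideanSpace.single (0 : Fin (d + 1)) (1 : ℝ)) c ↔
        p 0 ^ 2 + ∑ l : Fin d, p l.succ ^ 2 = 2 * c * p 0) := by
    intro c hc
    rw [Metric.mem_sphere, EuclideanSpace.dist_eq, Real.sqrt_eq_iff_eq_sq (by positivity) hc,
      Fin.sum_univ_succ]
    simp only [PiLp.smul_apply, PiLp.single_apply, Real.dist_eq, sq_abs, smul_eq_mul,
      Fin.succ_ne_zero, if_true, if_false, mul_one, mul_zero, sub_zero]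
    constructor <;> intro h <;> linarith
  simp only [wedgeOfSpheres, Set.mem_union, Set.mem_singleton_iff, Set.mem_iUnion,
    Finset.mem_range, exists_prop]
  refine or_congr Iff.rfl ⟨?_, ?_⟩
  · rintro ⟨i, hi, h⟩
    exact ⟨⟨i, hi⟩, (key _ (by positivity)).1 h⟩
  · rintro ⟨i, h⟩
    exact ⟨i, i.2, (key _ (by positivity)).2 h⟩

namespace WedgeOfSpheres

variable {d k : ℕ}

/-- The common denominator of the coordinates of an inverse stereographic projection. -/
def denom (c m : ℝ) (Z : Fin d → ℝ) : ℝ := m ^ 2 / (4 * c ^ 2) + ∑ l, Z l ^ 2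

theorem denom_nonneg (c m : ℝ) (Z : Fin d → ℝ) : 0 ≤ denom c m Z :=
  add_nonneg (by positivity) (Finset.sum_nonneg fun _ _ => sq_nonneg _)

theorem denom_pos {c m : ℝ} {Z : Fin d → ℝ} (hc : 0 < c) (h : m ≠ 0 ∨ Z ≠ 0) :
    0 < denom c m Z := by
  rcases h with h | h
  · exact add_pos_of_pos_of_nonneg (by positivity) (Finset.sum_nonneg fun _ _ => sq_nonneg _)
  · obtain ⟨l, hl⟩ := Function.ne_iff.1 h
    refine add_pos_of_nonneg_of_pos (by positivity)
      (Finset.sum_pos' (fun _ _ => sq_nonneg _) ⟨l, Finset.mem_univ _, ?_⟩)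
    exact sq_pos_of_ne_zero hl

/-- The inverse stereographic projection from the origin onto the sphere of radius `c` centered
at `c • e₀`, in homogeneous coordinates. -/
def point (c m : ℝ) (Z : Fin d → ℝ) : EuclideanSpace ℝ (Fin (d + 1)) :=
  WithLp.toLp 2 (Fin.cons (m ^ 2 / (2 * c * denom c m Z)) fun l => m * Z l / denom c m Z)

@[simp] theorem point_zero (c m : ℝ) (Z : Fin d → ℝ) :
    point c m Z 0 = m ^ 2 / (2 * c * denom c m Z) := rfl

@[simp] theorem point_succ (c m : ℝ) (Z : Fin d → ℝ) (l : Fin d) :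
    point c m Z l.succ = m * Z l / denom c m Z := rfl

theorem point_at_zero (c : ℝ) (Z : Fin d → ℝ) : point c 0 Z = 0 := by
  ext l
  refine Fin.cases ?_ (fun l => ?_) l <;> simp

theorem sum_sq_point {c m : ℝ} {Z : Fin d → ℝ} (hc : 0 < c) :
    point c m Z 0 ^ 2 + ∑ l : Fin d, point c m Z l.succ ^ 2 = 2 * c * point c m Z 0 := by
  rcases (denom_nonneg c m Z).eq_or_lt with h | h
  · simp [← h]
  simp only [point_zero, point_succ, div_pow, mul_pow]
  rw [← Finset.sum_div, ← Finset.mul_sum]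
  have h1 : ∑ l, Z l ^ 2 = denom c m Z - m ^ 2 / (4 * c ^ 2) := by rw [denom]; ring
  rw [h1]
  field_simp
  ring

theorem point_mem {m : ℝ} {Z : Fin d → ℝ} (i : Fin k) :
    point ((i : ℝ) + 1) m Z ∈ wedgeOfSpheres d k :=
  mem_wedgeOfSpheres.2 (.inr ⟨i, sum_sq_point (by positivity)⟩)

theorem continuous_point {c : ℝ} (hc : 0 < c) :
    Continuous fun Z : Fin d → ℝ => point c (max 0 (1 - ‖Z‖)) Z := by
  have hD : Continuous fun Z : Fin d → ℝ => denom c (max 0 (1 - ‖Z‖)) Z := by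
    unfold denom
    fun_prop
  have hpos : ∀ Z : Fin d → ℝ, denom c (max 0 (1 - ‖Z‖)) Z ≠ 0 := fun Z => by
    refine (denom_pos hc ?_).ne'
    by_cases h : Z = 0
    · left
      simp [h]
    · exact .inr h
  refine (PiLp.continuous_toLp 2 _).comp (continuous_pi fun l => ?_)
  refine Fin.cases ?_ (fun l => ?_) l
  · simp only [Fin.cons_zero]
    exact Continuous.div (by fun_prop) (by fun_prop) fun Z =>
      mul_ne_zero (by positivity) (hpos Z)
  · simp only [Fin.cons_succ]
    exact Continuous.div (by fun_prop) hD hpos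

theorem point_smul {c m : ℝ} (hm : 0 < m) (v : Fin d → ℝ) :
    point c m (m • v) = point c 1 v := by
  have h : denom c m (m • v) = m ^ 2 * denom c 1 v := by
    simp only [denom, Pi.smul_apply, smul_eq_mul, mul_pow]
    rw [← Finset.mul_sum]
    ring
  ext l
  refine Fin.cases ?_ (fun l => ?_) l
  · rw [point_zero, point_zero, h]
    field_simp
  · rw [point_succ, point_succ, h, Pi.smul_apply, smul_eq_mul]
    field_simp

theorem point_one_zero_pos {c : ℝ} (hc : 0 < c) (v : Fin d → ℝ) : 0 < point c 1 v 0 := by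
  have := denom_pos (Z := v) hc (.inl (one_ne_zero (α := ℝ)))
  rw [point_zero]
  positivity

theorem point_one_succ {c : ℝ} (hc : 0 < c) (v : Fin d → ℝ) (l : Fin d) :
    v l = point c 1 v l.succ / (2 * c * point c 1 v 0) := by
  have := denom_pos (Z := v) hc (.inl (one_ne_zero (α := ℝ)))
  rw [point_zero, point_succ]
  field_simp

end WedgeOfSpheres

open WedgeOfSpheres in
theorem CubeWedge.nonempty_homeomorph_wedgeOfSpheres (d k : ℕ) :
    Nonempty (CubeWedge d (Fin k) ≃ₜ wedgeOfSpheres d k) := by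
  have hc : ∀ i : Fin k, (0 : ℝ) < (i : ℝ) + 1 := fun i => by positivity
  refine CubeWedge.nonempty_homeomorph_of_homogeneous
    (⟨0, mem_wedgeOfSpheres.2 (.inl rfl)⟩ : wedgeOfSpheres d k)
    (fun i m Z => ⟨point ((i : ℝ) + 1) m Z, point_mem i⟩)
    (fun i => (continuous_point (hc i)).subtype_mk _)
    (fun i m v hm => Subtype.ext (point_smul hm v))
    (fun i Z _ => Subtype.ext (point_at_zero _ _)) ?_ ?_ ?_
  · intro i v h
    have h1 := point_one_zero_pos (hc i) v
    have h2 : point ((i : ℝ) + 1) 1 v = 0 := congrArg Subtype.val h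
    rw [h2] at h1
    exact lt_irrefl _ h1
  · intro i j v w h
    have h1 : point ((i : ℝ) + 1) 1 v = point ((j : ℝ) + 1) 1 w := congrArg Subtype.val h
    have h2 := sum_sq_point (m := 1) (Z := v) (hc i)
    rw [h1, sum_sq_point (hc j)] at h2
    have h3 := mul_right_cancel₀ (point_one_zero_pos (hc j) w).ne' h2
    obtain rfl : i = j := by
      refine Fin.ext (Nat.cast_injective (R := ℝ) ?_)
      linarith
    refine ⟨rfl, ?_⟩
    ext l
    rw [point_one_succ (hc i) v, point_one_succ (hc i) w, h1]
  · rintro ⟨p, hp⟩ hp0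
    obtain rfl | ⟨i, h⟩ := mem_wedgeOfSpheres.1 hp
    · exact absurd rfl hp0
    have hne : p 0 ≠ 0 := by
      intro h0
      refine hp0 (Subtype.ext ?_)
      rw [h0] at h
      have h1 : ∑ l : Fin d, p l.succ ^ 2 = 0 := by linarith
      rw [Finset.sum_eq_zero_iff_of_nonneg fun _ _ => sq_nonneg _] at h1
      ext l
      refine Fin.cases h0 (fun l => ?_) l
      exact pow_eq_zero_iff two_ne_zero |>.1 (h1 l (Finset.mem_univ _))
    refine ⟨i, fun l => p l.succ / (2 * ((i : ℝ) + 1) * p 0), Subtype.ext ?_⟩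
    have hci := hc i
    set c := (i : ℝ) + 1
    have hD : denom c 1 (fun l => p l.succ / (2 * c * p 0)) = 1 / (2 * c * p 0) := by
      simp only [denom, div_pow]
      rw [← Finset.sum_div]
      have h1 : ∑ l : Fin d, p l.succ ^ 2 = 2 * c * p 0 - p 0 ^ 2 := by linarith
      rw [h1]
      field_simp
      ring
    ext l
    refine Fin.cases ?_ (fun l => ?_) l
    · change point c 1 _ 0 = _
      rw [point_zero, hD]
      field_simp
    · change point c 1 _ l.succ = _
      rw [point_succ, hD]
      change 1 * (p l.succ / (2 * c * p 0)) / (1 / (2 * c * p 0)) = p l.succ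
      field_simp

namespace CrossPolytopeWedge

variable {d k : ℕ}

/-- Vertices of a wedge of `k` boundaries of `(d + 1)`-dimensional cross-polytopes: the common
vertex `none` and, for each `j`, the opposite vertex `(j, none)` and the pairs of opposite vertices
`(j, (i, true))`, `(j, (i, false))`. -/
abbrev Vertex (d k : ℕ) : Type := Option (Fin k × Option (Fin d × Bool))

/-- The axis of the cross-polytope on which a vertex lies. -/
def axis : Vertex d k → Option (Fin d)
  | none => none
  | some (_, none) => none
  | some (_, some (i, _)) => some i

/-- The faces of a wedge of boundaries of cross-polytopes. -/
def complex (d k : ℕ) : Set (Finset (Vertex d k)) :=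
  {s | Set.InjOn axis (s : Set (Vertex d k)) ∧ ∀ p q, some p ∈ s → some q ∈ s → p.1 = q.1}

theorem card_le {s : Finset (Vertex d k)} (hs : s ∈ complex d k) : s.card ≤ d + 1 := by
  classical
  rw [← Finset.card_image_of_injOn hs.1]
  exact (Finset.card_le_univ _).trans (by simp)

theorem mem_realization {f : Vertex d k → ℝ} : f ∈ simplicialRealization (complex d k) ↔
    (∀ x, 0 ≤ f x) ∧ (∀ x y, f x ≠ 0 → f y ≠ 0 → axis x = axis y → x = y) ∧
      (∀ p q, f (some p) ≠ 0 → f (some q) ≠ 0 → p.1 = q.1) ∧ ∑ x, f x = 1 := by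
  classical
  rw [simplicialRealization, Set.mem_ofPred_eq, finsum_eq_sum_of_fintype]
  constructor
  · rintro ⟨h0, ⟨s, hs, hf⟩, h1⟩
    exact ⟨h0, fun x y hx hy h => hs.1 (hf hx) (hf hy) h,
      fun p q hp hq => hs.2 p q (hf hp) (hf hq), h1⟩
  · rintro ⟨h0, h2, h3, h1⟩
    refine ⟨h0, ⟨Finset.univ.filter fun x => f x ≠ 0, ⟨fun x hx y hy h => ?_, fun p q hp hq => ?_⟩,
      fun x hx => by simpa using hx⟩, h1⟩
    · exact h2 x y (by simpa using hx) (by simpa using hy) h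
    · exact h3 p q (by simpa using hp) (by simpa using hq)

/-- The `ℓ¹`-norm of the vector `(m ^ 2 - ‖Z‖ ^ 2, m • Z)`. -/
def total (m : ℝ) (Z : Fin d → ℝ) : ℝ := |m ^ 2 - ‖Z‖ ^ 2| + ∑ i, |m * Z i|

theorem total_pos {m : ℝ} {Z : Fin d → ℝ} (h : m ≠ 0 ∨ Z ≠ 0) : 0 < total m Z := by
  have hs : 0 ≤ ∑ i, |m * Z i| := Finset.sum_nonneg fun _ _ => abs_nonneg _
  refine lt_of_le_of_ne (add_nonneg (abs_nonneg _) hs) fun h0 => ?_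
  rw [total] at h0
  have h1 : |m ^ 2 - ‖Z‖ ^ 2| = 0 := by linarith [abs_nonneg (m ^ 2 - ‖Z‖ ^ 2)]
  have h2 : ∑ i, |m * Z i| = 0 := by linarith
  rw [Finset.sum_eq_zero_iff_of_nonneg fun _ _ => abs_nonneg _] at h2
  have h3 : m ^ 2 = ‖Z‖ ^ 2 := by linarith [abs_eq_zero.1 h1]
  by_cases hm : m = 0
  · have : ‖Z‖ = 0 := by
      rw [hm] at h3
      exact pow_eq_zero_iff two_ne_zero |>.1 (by rw [← h3]; simp)
    exact h.elim (fun h => h hm) fun h => h (norm_eq_zero.1 this)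
  · have hZ : Z = 0 := by
      ext i
      simpa [hm] using h2 i (Finset.mem_univ _)
    rw [hZ, norm_zero] at h3
    exact hm (pow_eq_zero_iff two_ne_zero |>.1 (by rw [h3]; simp))

/-- The radial projection of `(m ^ 2 - ‖Z‖ ^ 2, m • Z)` to the boundary of the `j`-th
cross-polytope. -/
def point (j : Fin k) (m : ℝ) (Z : Fin d → ℝ) : Vertex d k → ℝ
  | none => max 0 (-(m ^ 2 - ‖Z‖ ^ 2)) / total m Z
  | some (j', none) => if j' = j then max 0 (m ^ 2 - ‖Z‖ ^ 2) / total m Z else 0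
  | some (j', some (i, true)) => if j' = j then max 0 (m * Z i) / total m Z else 0
  | some (j', some (i, false)) => if j' = j then max 0 (-(m * Z i)) / total m Z else 0

theorem sum_vertex (f : Vertex d k → ℝ) : ∑ x, f x = f none + ∑ j : Fin k, (f (some (j, none)) +
    ∑ i : Fin d, (f (some (j, some (i, true))) + f (some (j, some (i, false))))) := by
  simp only [Fintype.sum_option, Fintype.sum_prod_type, Fintype.sum_bool]

theorem max_add_max_neg (a : ℝ) : max 0 a + max 0 (-a) = |a| := by
  rcases le_total 0 a with h | h
  · rw [max_eq_right h, max_eq_left (by linarith), abs_of_nonneg h, add_zero]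
  · rw [max_eq_left h, max_eq_right (by linarith), abs_of_nonpos h, zero_add]

theorem max_sub_max_neg (a : ℝ) : max 0 a - max 0 (-a) = a := by
  rcases le_total 0 a with h | h
  · rw [max_eq_right h, max_eq_left (by linarith), sub_zero]
  · rw [max_eq_left h, max_eq_right (by linarith)]
    ring

theorem eq_or_eq_of_max_ne_zero {a : ℝ} (h : max 0 a ≠ 0) (h' : max 0 (-a) ≠ 0) : False := by
  rcases le_total 0 a with h0 | h0
  · exact h' (max_eq_left (by linarith))
  · exact h (max_eq_left h0)

theorem point_mem (j : Fin k) {m : ℝ} {Z : Fin d → ℝ} (h : m ≠ 0 ∨ Z ≠ 0) :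
    point j m Z ∈ simplicialRealization (complex d k) := by
  have hT := total_pos h
  refine mem_realization.2 ⟨?_, ?_, ?_, ?_⟩
  · rintro (_ | ⟨j', _ | ⟨i, _ | _⟩⟩) <;> simp only [point] <;> (try split_ifs) <;> positivity
  · have key : ∀ a : ℝ, max 0 a / total m Z ≠ 0 → max 0 (-a) / total m Z ≠ 0 → False :=
      fun a h h' => eq_or_eq_of_max_ne_zero (fun h0 => h (by rw [h0, zero_div]))
        (fun h0 => h' (by rw [h0, zero_div]))
    rintro (_ | ⟨j', _ | ⟨i, _ | _⟩⟩) (_ | ⟨j'', _ | ⟨i', _ | _⟩⟩) hx hy hax <;>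
      simp only [axis, reduceCtorEq, Option.some.injEq] at hax <;>
      simp only [point, ne_eq, ite_eq_right_iff, Classical.not_imp] at hx hy
    · rfl
    · exact (key _ hy.2 hx).elim
    · exact (key _ hx.2 hy).elim
    · rw [hx.1, hy.1]
    · rw [hx.1, hy.1, hax]
    · subst hax
      exact (key _ hy.2 hx.2).elim
    · subst hax
      exact (key _ hx.2 hy.2).elim
    · rw [hx.1, hy.1, hax]
  · have key : ∀ p, point j m Z (some p) ≠ 0 → p.1 = j := by
      rintro ⟨j', _ | ⟨i, _ | _⟩⟩ hx <;>
        simp only [point, ne_eq, ite_eq_right_iff, Classical.not_imp] at hx <;> exact hx.1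
    intro p q hp hq
    rw [key p hp, key q hq]
  · rw [sum_vertex, Finset.sum_eq_single j]
    · simp only [point, if_true, ← add_div, max_add_max_neg]
      rw [← Finset.sum_div, ← add_div, ← add_div, ← add_assoc, add_comm (max 0 (-_)),
        max_add_max_neg]
      exact div_self hT.ne'
    · intro j' _ hj
      simp [point, hj]
    · simp

theorem point_congr {j : Fin k} {m m' s : ℝ} {Z Z' : Fin d → ℝ} (hs : 0 < s)
    (h1 : m ^ 2 - ‖Z‖ ^ 2 = s * (m' ^ 2 - ‖Z'‖ ^ 2)) (h2 : ∀ i, m * Z i = s * (m' * Z' i)) :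
    point j m Z = point j m' Z' := by
  have hT : total m Z = s * total m' Z' := by
    simp only [total, h1, h2, abs_mul, abs_of_pos hs, ← Finset.mul_sum]
    ring
  have key : ∀ a : ℝ, max 0 (s * a) / total m Z = max 0 a / total m' Z' := by
    intro a
    rw [hT, show max 0 (s * a) = s * max 0 a by rw [mul_max_of_nonneg _ _ hs.le, mul_zero],
      mul_div_mul_left _ _ hs.ne']
  funext x
  rcases x with _ | ⟨j', _ | ⟨i, _ | _⟩⟩ <;> simp only [point, h1, h2, ← mul_neg, key]

theorem point_smul {j : Fin k} {m : ℝ} (hm : 0 < m) (v : Fin d → ℝ) :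
    point j m (m • v) = point j 1 v := by
  refine point_congr (s := m ^ 2) (by positivity) ?_ fun i => ?_
  · rw [norm_smul, Real.norm_of_nonneg hm.le]
    ring
  · rw [Pi.smul_apply, smul_eq_mul]
    ring

theorem continuous_point (j : Fin k) :
    Continuous fun Z : Fin d → ℝ => point j (max 0 (1 - ‖Z‖)) Z := by
  have hT : Continuous fun Z : Fin d → ℝ => total (max 0 (1 - ‖Z‖)) Z := by
    unfold total
    fun_prop
  have hpos : ∀ Z : Fin d → ℝ, total (max 0 (1 - ‖Z‖)) Z ≠ 0 := fun Z => by
    refine (total_pos ?_).ne'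
    by_cases h : Z = 0
    · left
      simp [h]
    · exact .inr h
  refine continuous_pi fun x => ?_
  rcases x with _ | ⟨j', _ | ⟨i, _ | _⟩⟩ <;> simp only [point] <;> (try split_ifs)
  all_goals first
    | exact continuous_const
    | exact Continuous.div (by fun_prop) hT hpos

/-- The common vertex of the cross-polytopes. -/
def vertex (d k : ℕ) : Vertex d k → ℝ := Pi.single none 1

theorem vertex_mem : vertex d k ∈ simplicialRealization (complex d k) := by
  have h : ∀ x, vertex d k x ≠ 0 → x = none := fun x hx => by
    by_contra h
    exact hx (Pi.single_eq_of_ne h _)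
  refine mem_realization.2 ⟨fun x => ?_, fun x y hx hy _ => (h x hx).trans (h y hy).symm,
    fun p q hp _ => by simpa using h _ hp, ?_⟩
  · rw [vertex, Pi.single_apply]
    split_ifs <;> norm_num
  · simp [vertex]

theorem point_at_zero (j : Fin k) {Z : Fin d → ℝ} (hZ : Z ≠ 0) : point j 0 Z = vertex d k := by
  have : ‖Z‖ ≠ 0 := norm_ne_zero_iff.2 hZ
  funext x
  rcases x with _ | ⟨j', _ | ⟨i, _ | _⟩⟩ <;> simp [point, vertex, total, this]

/-- Some coordinate of `point j 1 v` at a vertex of the `j`-th cross-polytope is nonzero. -/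
theorem exists_point_ne_zero (j : Fin k) (v : Fin d → ℝ) :
    ∃ p : Fin k × Option (Fin d × Bool), p.1 = j ∧ point j 1 v (some p) ≠ 0 := by
  have hT := total_pos (Z := v) (.inl (one_ne_zero (α := ℝ)))
  by_contra! h
  have hv : v = 0 := by
    ext i
    have h1 := h (j, some (i, true)) rfl
    have h2 := h (j, some (i, false)) rfl
    simp only [point, if_true, one_mul, div_eq_zero_iff, hT.ne', or_false] at h1 h2
    have := max_sub_max_neg (v i)
    rw [h1, h2] at this
    simpa using this.symm
  have h1 := h (j, none) rfl
  simp [point, hv, total] at h1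

theorem point_of_ne {j j' : Fin k} (h : j' ≠ j) (m : ℝ) (Z : Fin d → ℝ) (o) :
    point j m Z (some (j', o)) = 0 := by
  rcases o with _ | ⟨i, _ | _⟩ <;> simp [point, h]

theorem point_injective {j j' : Fin k} {v v' : Fin d → ℝ} (h : point j 1 v = point j' 1 v') :
    j = j' ∧ v = v' := by
  obtain rfl : j = j' := by
    by_contra hj
    obtain ⟨⟨_, o⟩, rfl, hp⟩ := exists_point_ne_zero j v
    rw [h] at hp
    exact hp (point_of_ne hj _ _ _)
  refine ⟨rfl, ?_⟩
  have hT := total_pos (Z := v) (.inl (one_ne_zero (α := ℝ)))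
  have hT' := total_pos (Z := v') (.inl (one_ne_zero (α := ℝ)))
  have h0 : (1 - ‖v‖ ^ 2) / total 1 v = (1 - ‖v'‖ ^ 2) / total 1 v' := by
    have h1 := congrFun h none
    have h2 := congrFun h (some (j, none))
    simp only [point, if_true, one_pow] at h1 h2
    rw [← max_sub_max_neg (1 - ‖v‖ ^ 2), ← max_sub_max_neg (1 - ‖v'‖ ^ 2), sub_div, sub_div,
      h1, h2]
  have hi : ∀ i, v i / total 1 v = v' i / total 1 v' := fun i => by
    have h1 := congrFun h (some (j, some (i, true)))
    have h2 := congrFun h (some (j, some (i, false)))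
    simp only [point, if_true, one_mul] at h1 h2
    rw [← max_sub_max_neg (v i), ← max_sub_max_neg (v' i), sub_div, sub_div, h1, h2]
  set T := total 1 v
  set T' := total 1 v'
  have hv : v = (T / T') • v' := by
    ext i
    have := hi i
    rw [Pi.smul_apply, smul_eq_mul]
    field_simp at this ⊢
    linarith
  have hpos : 0 < T / T' := by positivity
  set l := T / T' with hl
  have hTl : T = l * T' := by rw [hl]; field_simp
  have hn : ‖v‖ = l * ‖v'‖ := by
    conv_lhs => rw [hv]
    rw [norm_smul, Real.norm_of_nonneg hpos.le]
  rw [hn, hTl] at h0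
  field_simp at h0
  have h1 : (1 - l) * (1 + l * ‖v'‖ ^ 2) = 0 := by linarith
  have h2 : l = 1 := by
    have : 0 < 1 + l * ‖v'‖ ^ 2 := by positivity
    have := (mul_eq_zero.1 h1).resolve_right this.ne'
    linarith
  rw [hv, h2, one_smul]

theorem exists_pos_root {a b : ℝ} (h : 0 < a ∨ b ≠ 0) : ∃ t, 0 < t ∧ 1 - t ^ 2 * b ^ 2 = t * a := by
  by_cases hb : b = 0
  · have ha : 0 < a := h.resolve_right (not_not.2 hb)
    exact ⟨a⁻¹, by positivity, by rw [hb]; field_simp; ring⟩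
  · have hb2 : 0 < b ^ 2 := by positivity
    have hs : 0 ≤ a ^ 2 + 4 * b ^ 2 := by positivity
    have hlt : |a| < √(a ^ 2 + 4 * b ^ 2) := by
      rw [← Real.sqrt_sq_eq_abs]
      exact Real.sqrt_lt_sqrt (sq_nonneg a) (by linarith)
    refine ⟨(√(a ^ 2 + 4 * b ^ 2) - a) / (2 * b ^ 2), ?_, ?_⟩
    · have := le_abs_self a
      exact div_pos (by linarith) (by positivity)
    · have := Real.sq_sqrt hs
      field_simp
      nlinarith

theorem point_surjective {f : Vertex d k → ℝ} (hf : f ∈ simplicialRealization (complex d k))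
    (hne : f ≠ vertex d k) : ∃ j v, point j 1 v = f := by
  obtain ⟨h0, hax, hj, h1⟩ := mem_realization.1 hf
  have hex : ∃ p, f (some p) ≠ 0 := by
    by_contra! h
    refine hne (funext fun x => ?_)
    rcases x with _ | p
    · rw [Fintype.sum_option] at h1
      simpa [h, vertex] using h1
    · rw [h p]
      simp [vertex]
  obtain ⟨⟨j, o⟩, hp⟩ := hex
  have hzero : ∀ j' o', j' ≠ j → f (some (j', o')) = 0 := fun j' o' hj' => by
    by_contra h
    exact hj' (hj _ _ h hp)
  have key : ∀ x y, x ≠ y → axis x = axis y →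
      f x = max 0 (f x - f y) ∧ f y = max 0 (-(f x - f y)) := by
    intro x y hxy h
    by_cases hx : f x = 0
    · rw [hx, zero_sub, neg_neg, max_eq_right (h0 y), max_eq_left (by linarith [h0 y])]
      exact ⟨rfl, rfl⟩
    · have hy : f y = 0 := by
        by_contra hy
        exact hxy (hax x y hx hy h)
      rw [hy, sub_zero, max_eq_right (h0 x), max_eq_left (by linarith [h0 x])]
      exact ⟨rfl, rfl⟩
  set a := f (some (j, none)) - f none with ha
  set y : Fin d → ℝ := fun i => f (some (j, some (i, true))) - f (some (j, some (i, false))) with hy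
  obtain ⟨ha1, ha2⟩ := key (some (j, none)) none (by simp) rfl
  have hyi := fun i => key (some (j, some (i, true))) (some (j, some (i, false))) (by simp) rfl
  have hsum : |a| + ∑ i, |y i| = 1 := by
    rw [← h1, sum_vertex, Finset.sum_eq_single j (fun j' _ h => by simp [hzero _ _ h]) (by simp),
      ← max_add_max_neg a, ← ha1, ← ha2, ← add_assoc, add_comm (f none)]
    congr 1
    refine Finset.sum_congr rfl fun i _ => ?_
    rw [← max_add_max_neg (y i), ← (hyi i).1, ← (hyi i).2]
  obtain ⟨t, ht, hroot⟩ : ∃ t, 0 < t ∧ 1 - t ^ 2 * ‖y‖ ^ 2 = t * a := by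
    refine exists_pos_root ?_
    by_contra! h
    have hy0 : y = 0 := norm_eq_zero.1 h.2
    have hf0 : f (some (j, none)) = 0 := by rw [ha1, max_eq_left h.1]
    rcases o with _ | ⟨i, _ | _⟩
    · exact hp hf0
    · refine hp ((hyi i).2.trans ?_)
      change max 0 (-(y i)) = 0
      simp [hy0]
    · refine hp ((hyi i).1.trans ?_)
      change max 0 (y i) = 0
      simp [hy0]
  have hr : (1 : ℝ) ^ 2 - ‖t • y‖ ^ 2 = t * a := by
    rw [norm_smul, Real.norm_of_nonneg ht.le, mul_pow, one_pow, hroot]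
  have hT : total 1 (t • y) = t := by
    rw [total, hr]
    simp only [Pi.smul_apply, smul_eq_mul, one_mul, abs_mul, abs_of_pos ht, ← Finset.mul_sum]
    rw [← mul_add, hsum, mul_one]
  have hmax : ∀ b : ℝ, max 0 (t * b) / t = max 0 b := fun b => by
    rw [show max 0 (t * b) = t * max 0 b by rw [mul_max_of_nonneg _ _ ht.le, mul_zero],
      mul_div_cancel_left₀ _ ht.ne']
  refine ⟨j, t • y, funext fun x => ?_⟩
  rcases x with _ | ⟨j', o'⟩
  · simp only [point, hT, hr, ← mul_neg, hmax]
    exact ha2.symm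
  · by_cases hj' : j' = j
    · subst hj'
      rcases o' with _ | ⟨i, _ | _⟩ <;>
        simp only [point, hT, hr, if_true, Pi.smul_apply, smul_eq_mul, one_mul, ← mul_neg, hmax]
      · exact ha1.symm
      · exact (hyi i).2.symm
      · exact (hyi i).1.symm
    · rw [point_of_ne hj', hzero _ _ hj']

end CrossPolytopeWedge

open CrossPolytopeWedge in
theorem CubeWedge.nonempty_homeomorph_simplicialRealization (d k : ℕ) :
    Nonempty (CubeWedge d (Fin k) ≃ₜ simplicialRealization (complex d k)) := by
  classical
  refine CubeWedge.nonempty_homeomorph_of_homogeneous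
    (⟨vertex d k, vertex_mem⟩ : simplicialRealization (complex d k))
    (fun j m Z => if h : m ≠ 0 ∨ Z ≠ 0 then ⟨point j m Z, point_mem j h⟩
      else ⟨vertex d k, vertex_mem⟩) ?_ ?_ ?_ ?_ ?_ ?_
  · intro j
    have h : ∀ Z : Fin d → ℝ, max 0 (1 - ‖Z‖) ≠ 0 ∨ Z ≠ 0 := fun Z => by
      by_cases h : Z = 0
      · left
        simp [h]
      · exact .inr h
    simp only [dif_pos (h _)]
    exact (continuous_point j).subtype_mk _
  · intro j m v hm
    rw [dif_pos (.inl hm.ne'), dif_pos (.inl one_ne_zero)]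
    exact Subtype.ext (point_smul hm v)
  · intro j Z hZ
    rw [dif_pos (.inr hZ)]
    exact Subtype.ext (point_at_zero j hZ)
  · intro j v h
    rw [dif_pos (.inl one_ne_zero)] at h
    have h1 : point j 1 v = vertex d k := congrArg Subtype.val h
    obtain ⟨p, -, hp⟩ := exists_point_ne_zero j v
    exact hp (by rw [h1]; simp [vertex])
  · intro j j' v v' h
    rw [dif_pos (.inl one_ne_zero), dif_pos (.inl one_ne_zero)] at h
    exact point_injective (congrArg Subtype.val h)
  · rintro ⟨f, hf⟩ hne
    obtain ⟨j, v, h⟩ := point_surjective hf fun h => hne (Subtype.ext h)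
    refine ⟨j, v, ?_⟩
    rw [dif_pos (.inl one_ne_zero)]
    exact Subtype.ext h

/-- **The complement of a Bergman fan** of a rank `r` matroid (`2 ≤ r < n`) in
`ℝ^{n-1}` is `(n-r-2)`-connected, is homotopy equivalent to a finite simplicial
complex of dimension at most `n-r-1`, and indeed is homotopy equivalent to a wedge
of spheres of dimension `n-r-1`. -/
theorem bergmanFan_complement
    {n r : ℕ} (M : Matroid (Fin n)) (hE : M.E = Set.univ)
    (hLoopless : M.closure ∅ = ∅)
    (hrank : mrk M Set.univ = r) (hr : 2 ≤ r) (hrn : r < n)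
    (e : Fin n → EuclideanSpace ℝ (Fin (n - 1)))
    (hsum : ∑ i, e i = 0)
    (hind : ∀ s : Finset (Fin n), s ≠ Finset.univ →
      LinearIndependent ℝ (fun i : ↥s => e ↑i)) :
    KConn (↥((bergmanFan M e)ᶜ)) ((n : ℤ) - (r : ℤ) - 2) ∧
    (∃ (α : Type) (_ : Fintype α) (K : Set (Finset α)),
      (∀ s ∈ K, s.card ≤ n - r) ∧
      Nonempty (ContinuousMap.HomotopyEquiv (↥((bergmanFan M e)ᶜ))
        (↥(simplicialRealization K)))) ∧
    (∃ k : ℕ,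
      Nonempty (ContinuousMap.HomotopyEquiv (↥((bergmanFan M e)ᶜ))
        (↥(wedgeOfSpheres (n - r - 1) k)))) := by
  have hV : Module.finrank ℝ (EuclideanSpace ℝ (Fin (n - 1))) = n - 1 := finrank_euclideanSpace_fin
  obtain ⟨k, hk⟩ := exists_hEquiv_cubeWedge hE hLoopless hV hsum hind hrank hrn
  obtain ⟨f⟩ := CubeWedge.nonempty_homeomorph_simplicialRealization (n - r - 1) k
  obtain ⟨g⟩ := CubeWedge.nonempty_homeomorph_wedgeOfSpheres (n - r - 1) k
  refine ⟨kConn_compl_bergmanFan hE hLoopless hV hsum hind hrank hrn,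
    ⟨CrossPolytopeWedge.Vertex (n - r - 1) k, inferInstance,
      CrossPolytopeWedge.complex (n - r - 1) k, fun s hs => ?_, hk.trans (HEquiv.of_homeo f)⟩,
    k, hk.trans (HEquiv.of_homeo g)⟩
  have := CrossPolytopeWedge.card_le hs
  omega
end
end
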